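/- arXiv:2308.10303 — 5 statements merged into one kernel-verified Lean document; each statement's English description precedes it below -/
import Mathlib

section
/- Let f : ℝ → ℝ, f(t) = ‖X + tY‖^p for fixed vectors X, Y in a real inner product space and 1 < p ≤ 2. Then for every t ∈ (0,1) at which X + tY ≠ 0, f is twice differentiable at t and f''(t) ≥ p(p-1)‖Y‖²‖X+tY‖^(p-2). -/
open RealInnerProductSpace

section NormRpowAlongLine

variable {H : Type*} [NormedAddCommGroup H] [InnerProductSpace ℝ H]

theorem hasDerivAt_add_smul_const (X Y : H) (t : ℝ) :
    HasDerivAt (fun s : ℝ => X + s • Y) Y t := by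
  simpa using ((hasDerivAt_id t).smul_const Y).const_add X

theorem hasDerivAt_norm_add_smul_rpow (X Y : H) (q : ℝ) {t : ℝ} (hne : X + t • Y ≠ 0) :
    HasDerivAt (fun s : ℝ => ‖X + s • Y‖ ^ q)
      (q * ‖X + t • Y‖ ^ (q - 2) * ⟪X + t • Y, Y⟫) t := by
  have hsq (s r : ℝ) : (‖X + s • Y‖ ^ 2) ^ (r / 2) = ‖X + s • Y‖ ^ r := by
    rw [← Real.rpow_natCast_mul (norm_nonneg _)]
    congr 1
    push_cast
    ring
  have hpow := (hasDerivAt_add_smul_const X Y t).norm_sq.rpow_const (p := q / 2)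
    (Or.inl (pow_ne_zero 2 (norm_ne_zero_iff.mpr hne)))
  rw [show q / 2 - 1 = (q - 2) / 2 by ring, hsq] at hpow
  simp only [hsq] at hpow
  exact hpow.congr_deriv (by ring)

end NormRpowAlongLine

theorem stmt_3 {H : Type*} [NormedAddCommGroup H] [InnerProductSpace ℝ H]
    (X Y : H) (p : ℝ) (hp1 : 1 < p) (hp2 : p ≤ 2)
    (f : ℝ → ℝ) (hf : f = fun t => ‖X + t • Y‖ ^ p)
    (t : ℝ) (ht : t ∈ Set.Ioo (0 : ℝ) 1) (hne : X + t • Y ≠ 0) :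
    DifferentiableAt ℝ f t ∧
      ∃ f'' : ℝ, HasDerivAt (deriv f) f'' t ∧
        f'' ≥ p * (p - 1) * ‖Y‖ ^ (2 : ℕ) * ‖X + t • Y‖ ^ (p - 2) := by
  subst hf
  refine ⟨(hasDerivAt_norm_add_smul_rpow X Y p hne).differentiableAt,
    p * ((p - 2) * ‖X + t • Y‖ ^ (p - 2 - 2) * ⟪X + t • Y, Y⟫) * ⟪X + t • Y, Y⟫
      + p * ‖X + t • Y‖ ^ (p - 2) * ⟪Y, Y⟫, ?_, ?_⟩
  · have hline := hasDerivAt_add_smul_const X Y t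
    have hderiv : deriv (fun s : ℝ => ‖X + s • Y‖ ^ p) =ᶠ[nhds t]
        fun s => p * ‖X + s • Y‖ ^ (p - 2) * ⟪X + s • Y, Y⟫ := by
      filter_upwards [hline.continuousAt.eventually_ne hne] with s hs
      exact (hasDerivAt_norm_add_smul_rpow X Y p hs).deriv
    refine HasDerivAt.congr_of_eventuallyEq ?_ hderiv
    refine (((hasDerivAt_norm_add_smul_rpow X Y (p - 2) hne).const_mul p).mul
      (hline.inner ℝ (hasDerivAt_const t Y))).congr_deriv ?_
    simp
  · have hpos : 0 < ‖X + t • Y‖ := norm_pos_iff.mpr hne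
    have hsplit : ‖X + t • Y‖ ^ (p - 2) = ‖X + t • Y‖ ^ (p - 2 - 2) * ‖X + t • Y‖ ^ 2 := by
      rw [← Real.rpow_add_natCast hpos.ne']
      congr 1
      push_cast
      ring
    have hcs : ⟪X + t • Y, Y⟫ ^ 2 ≤ ‖X + t • Y‖ ^ 2 * ‖Y‖ ^ 2 := by
      rw [← mul_pow, ← sq_abs]
      gcongr
      exact abs_real_inner_le_norm _ _
    have hcoef : 0 ≤ p * (2 - p) * ‖X + t • Y‖ ^ (p - 2 - 2) :=
      mul_nonneg (mul_nonneg (by linarith) (by linarith)) (by positivity)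
    rw [real_inner_self_eq_norm_sq, hsplit]
    linear_combination mul_le_mul_of_nonneg_left hcs hcoef
end

section
/- Let N ≥ p > N (i.e., p ≥ N), 1 < p, and let u : ℝᴺ → ℝ be continuously differentiable with compact support contained in ℝᴺ \ {0}. Then ∫ ‖∇u‖^p dx ≥ (|p-N|/p)^p ∫ |u|^p/‖x‖^p dx. -/
open MeasureTheory

/-- Young's inequality for the exponents `p / (p - 1)` and `p`, without conjugate exponents. -/
theorem Real.mul_rpow_sub_one_mul_le {p a b : ℝ} (hp : 1 < p) (ha : 0 ≤ a) (hb : 0 ≤ b) :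
    p * (a ^ (p - 1) * b) ≤ (p - 1) * a ^ p + b ^ p := by
  have hp0 : 0 < p := by linarith
  have hp1 : p - 1 ≠ 0 := by linarith
  have h := Real.young_inequality_of_nonneg (Real.rpow_nonneg ha (p - 1)) hb
    (Real.HolderConjugate.conjExponent hp).symm
  rw [← Real.rpow_mul ha, Real.conjExponent, mul_div_cancel₀ p hp1] at h
  calc p * (a ^ (p - 1) * b) ≤ p * (a ^ p / (p / (p - 1)) + b ^ p / p) := by gcongr
    _ = (p - 1) * a ^ p + b ^ p := by field_simp

section

variable {E : Type*} [NormedAddCommGroup E] [InnerProductSpace ℝ E]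

/-- The integral of the radial derivative `x ↦ Dg(x) x` of a compactly supported `C¹` function. -/
theorem integral_fderiv_apply_self [FiniteDimensional ℝ E] [MeasurableSpace E] [BorelSpace E]
    {μ : Measure E} [μ.IsAddHaarMeasure] {g : E → ℝ}
    (hg : ContDiff ℝ 1 g) (hgs : HasCompactSupport g) :
    ∫ x, fderiv ℝ g x x ∂μ = -(Module.finrank ℝ E * ∫ x, g x ∂μ) := by
  set b := stdOrthonormalBasis ℝ E
  have hcont := hg.continuous
  have hcont' : Continuous (fderiv ℝ g) := hg.continuous_fderiv one_ne_zero
  have hfd (i) (x : E) : HasFDerivAt (fun x ↦ inner ℝ (b i) x) (innerSL ℝ (b i)) x :=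
    (innerSL ℝ (b i)).hasFDerivAt
  have hint (i) : Integrable (fun x ↦ inner ℝ (b i) x * fderiv ℝ g x (b i)) μ := by
    refine Continuous.integrable_of_hasCompactSupport (by fun_prop) ?_
    exact ((hgs.fderiv ℝ).comp_left (g := fun L : E →L[ℝ] ℝ ↦ L (b i)) (by simp)).mul_left
  have hparts (i) : ∫ x, inner ℝ (b i) x * fderiv ℝ g x (b i) ∂μ = -∫ x, g x ∂μ := by
    have hderiv (x) : fderiv ℝ (fun x ↦ inner ℝ (b i) x) x (b i) = 1 := by
      rw [(hfd i x).fderiv]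
      simp
    rw [integral_mul_fderiv_eq_neg_fderiv_mul_of_integrable ?_ (hint i) ?_
      (fun x _ ↦ (hfd i x).differentiableAt)
      (fun x _ ↦ hg.differentiable one_ne_zero x)]
    · simp only [hderiv, one_mul]
    · simp only [hderiv, one_mul]
      exact hcont.integrable_of_hasCompactSupport hgs
    · exact Continuous.integrable_of_hasCompactSupport (by fun_prop) hgs.mul_left
  have hsum (x) : fderiv ℝ g x x = ∑ i, inner ℝ (b i) x * fderiv ℝ g x (b i) := by
    simpa using congrArg (fderiv ℝ g x) (b.sum_repr' x).symm
  simp only [hsum]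
  rw [integral_finsetSum _ fun i _ ↦ hint i]
  simp [hparts]

theorem ContDiff.abs_rpow_div_norm_rpow {u : E → ℝ} {p : ℝ} (hp : 1 < p) (hu : ContDiff ℝ 1 u)
    (h0 : 0 ∉ tsupport u) : ContDiff ℝ 1 (fun x ↦ |u x| ^ p / ‖x‖ ^ p) := by
  refine contDiff_iff_contDiffAt.2 fun x ↦ ?_
  by_cases hx : x = 0
  · subst hx
    refine (contDiffAt_const (c := (0 : ℝ))).congr_of_eventuallyEq ?_
    filter_upwards [notMem_tsupport_iff_eventuallyEq.1 h0] with y hy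
    simp [hy, (zero_lt_one.trans hp).ne']
  · exact (hu.norm_rpow hp).contDiffAt.div (contDiff_norm_rpow hp).contDiffAt
      (Real.rpow_pos_of_pos (norm_pos_iff.2 hx) p).ne'

/-- Bound for `‖x‖⁻ᵖ` times the radial derivative of `|u|ᵖ`. -/
theorem fderiv_abs_rpow_div_norm_rpow_apply_self_add_le {u : E → ℝ} {p : ℝ} (hp : 1 < p)
    (hu : ContDiff ℝ 1 u) (h0 : 0 ∉ tsupport u) (x : E) :
    fderiv ℝ (fun x ↦ |u x| ^ p / ‖x‖ ^ p) x x + p * (|u x| ^ p / ‖x‖ ^ p) ≤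
      p * ((|u x| / ‖x‖) ^ (p - 1) * ‖fderiv ℝ u x‖) := by
  by_cases hx : x = 0
  · subst hx
    simp only [map_zero, zero_add, image_eq_zero_of_notMem_tsupport h0, abs_zero]
    rw [Real.zero_rpow (by linarith), zero_div, mul_zero]
    positivity
  have hx' : 0 < ‖x‖ := norm_pos_iff.2 hx
  set g : E → ℝ := fun x ↦ |u x| ^ p / ‖x‖ ^ p with hg
  have hmul : (fun y ↦ ‖u y‖ ^ p) =ᶠ[nhds x] fun y ↦ g y * ‖y‖ ^ p := by
    filter_upwards [isOpen_ne.mem_nhds hx] with y hy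
    rw [hg, div_mul_cancel₀ _ (Real.rpow_pos_of_pos (norm_pos_iff.2 hy) p).ne', Real.norm_eq_abs]
  have hd : fderiv ℝ (fun y ↦ ‖u y‖ ^ p) x x = (fderiv ℝ g x x + p * g x) * ‖x‖ ^ p := by
    have hgd : HasFDerivAt g (fderiv ℝ g x) x :=
      ((hu.abs_rpow_div_norm_rpow hp h0).differentiable one_ne_zero x).hasFDerivAt
    rw [hmul.fderiv_eq, (hgd.fun_mul (hasFDerivAt_norm_rpow x hp)).fderiv]
    have hpow : ‖x‖ ^ p = ‖x‖ ^ (p - 2) * ‖x‖ ^ 2 := by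
      rw [← Real.rpow_natCast, ← Real.rpow_add hx']
      simp
    simp [hpow]
    ring
  refine le_of_mul_le_mul_right ?_ (Real.rpow_pos_of_pos hx' p)
  calc (fderiv ℝ g x x + p * g x) * ‖x‖ ^ p
      ≤ ‖fderiv ℝ (fun y ↦ ‖u y‖ ^ p) x‖ * ‖x‖ :=
        hd ▸ (Real.le_norm_self _).trans (ContinuousLinearMap.le_opNorm _ _)
    _ ≤ p * ‖u x‖ ^ (p - 1) * ‖fderiv ℝ u x‖ * ‖x‖ := by
        gcongr
        exact norm_fderiv_norm_rpow_le (hu.differentiable one_ne_zero) hp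
    _ = p * ((|u x| / ‖x‖) ^ (p - 1) * ‖fderiv ℝ u x‖) * ‖x‖ ^ p := by
        rw [Real.div_rpow (abs_nonneg _) hx'.le, Real.rpow_sub_one hx'.ne', Real.norm_eq_abs]
        have := Real.rpow_pos_of_pos hx' p
        field_simp

end

theorem stmt_6 (N : ℕ) (p : ℝ) (hp : 1 < p) (hpN : (N : ℝ) ≤ p)
    (u : EuclideanSpace ℝ (Fin N) → ℝ)
    (hu : ContDiff ℝ 1 u) (hsupp : HasCompactSupport u)
    (h0 : (0 : EuclideanSpace ℝ (Fin N)) ∉ tsupport u) :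
    ∫ x, ‖gradient u x‖ ^ p ∂volume ≥
      (|p - N| / p) ^ p * ∫ x, |u x| ^ p / ‖x‖ ^ p ∂volume := by
  have hp0 : 0 < p := by linarith
  have hnorm (x) : ‖gradient u x‖ = ‖fderiv ℝ u x‖ := by
    rw [← toDual_gradient, LinearIsometryEquiv.norm_map]
  simp only [hnorm]
  set c := |p - N| / p with hc
  have hc0 : 0 ≤ c := by positivity
  have hpc : p * c = p - N := by
    rw [hc, abs_of_nonneg (by linarith), mul_div_cancel₀ _ hp0.ne']
  set g : EuclideanSpace ℝ (Fin N) → ℝ := fun x ↦ |u x| ^ p / ‖x‖ ^ p with hg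
  have hgC : ContDiff ℝ 1 g := hu.abs_rpow_div_norm_rpow hp h0
  have hgs : HasCompactSupport g :=
    hsupp.mono fun x hx hux ↦ hx (by simp [hg, hux, hp0.ne'])
  have hg_int : Integrable g := hgC.continuous.integrable_of_hasCompactSupport hgs
  have hdg_int : Integrable fun x ↦ fderiv ℝ g x x := by
    have := hgC.continuous_fderiv one_ne_zero
    exact Continuous.integrable_of_hasCompactSupport (by fun_prop)
      ((hgs.fderiv ℝ).mono fun x hx h ↦ hx (by simp [h]))
  have hdu_int : Integrable fun x ↦ ‖fderiv ℝ u x‖ ^ p := by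
    have := hu.continuous_fderiv one_ne_zero
    exact Continuous.integrable_of_hasCompactSupport (this.norm.rpow_const fun _ ↦ .inr hp0.le)
      ((hsupp.fderiv ℝ).mono fun x hx h ↦ hx (by simp [h, hp0.ne']))
  have hpt (x) : c ^ (p - 1) * (fderiv ℝ g x x + p * g x) ≤
      (p - 1) * c ^ p * g x + ‖fderiv ℝ u x‖ ^ p :=
    calc c ^ (p - 1) * (fderiv ℝ g x x + p * g x)
        ≤ c ^ (p - 1) * (p * ((|u x| / ‖x‖) ^ (p - 1) * ‖fderiv ℝ u x‖)) := by
          gcongr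
          exact fderiv_abs_rpow_div_norm_rpow_apply_self_add_le hp hu h0 x
      _ = p * ((c * (|u x| / ‖x‖)) ^ (p - 1) * ‖fderiv ℝ u x‖) := by
          rw [Real.mul_rpow hc0 (by positivity)]
          ring
      _ ≤ (p - 1) * (c * (|u x| / ‖x‖)) ^ p + ‖fderiv ℝ u x‖ ^ p :=
          Real.mul_rpow_sub_one_mul_le hp (by positivity) (norm_nonneg _)
      _ = (p - 1) * c ^ p * g x + ‖fderiv ℝ u x‖ ^ p := by
          rw [Real.mul_rpow hc0 (by positivity), Real.div_rpow (abs_nonneg _) (norm_nonneg _)]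
          ring
  have hmono := integral_mono ((hdg_int.add (hg_int.const_mul p)).const_mul (c ^ (p - 1)))
    ((hg_int.const_mul ((p - 1) * c ^ p)).add hdu_int) hpt
  simp only [Pi.add_apply] at hmono
  rw [integral_const_mul, integral_add hdg_int (hg_int.const_mul p),
    integral_add (hg_int.const_mul _) hdu_int, integral_const_mul, integral_const_mul,
    integral_fderiv_apply_self hgC hgs, finrank_euclideanSpace_fin] at hmono
  have hcp : c ^ p = c ^ (p - 1) * c := by
    rw [← Real.rpow_add_one' hc0 (by linarith), sub_add_cancel]
  have hN : (N : ℝ) = p - p * c := by linarith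
  rw [hN, hcp] at hmono
  rw [hcp]
  linarith
end

section
/- Let 1 < p < ∞, α, β ∈ ℝ, and let Ω ⊆ ℝᴺ be open. Suppose ρ : Ω → (0,∞) is C² and satisfies the pointwise differential inequality -(1/(p-1+β)) Δ_p ρ ≥ ((α+β)/(p-1+β)) ‖∇ρ‖^p / ρ on Ω, with p-1+β > 0. Then for every u ∈ C_c^1(Ω): ∫_Ω ‖∇u‖^p ρ^α dx ≥ ((p-1+β)/p)^p ∫_Ω |u|^p ‖∇ρ‖^p ρ^(α-p) dx. -/
open MeasureTheory

noncomputable def divg8 {N : ℕ} (F : EuclideanSpace ℝ (Fin N) → EuclideanSpace ℝ (Fin N))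
    (x : EuclideanSpace ℝ (Fin N)) : ℝ :=
  ∑ i, fderiv ℝ F x (EuclideanSpace.single i 1) i

noncomputable def pLap8 {N : ℕ} (p : ℝ) (f : EuclideanSpace ℝ (Fin N) → ℝ)
    (x : EuclideanSpace ℝ (Fin N)) : ℝ :=
  divg8 (fun y => ‖gradient f y‖ ^ (p - 2) • gradient f y) x

/-- The odd extension `t ↦ sign t * |t| ^ q` of the power function. -/
noncomputable def signedPow (q t : ℝ) : ℝ := max t 0 ^ q - max (-t) 0 ^ q

lemma signedPow_of_nonneg {q t : ℝ} (hq : 0 < q) (ht : 0 ≤ t) : signedPow q t = t ^ q := by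
  simp [signedPow, ht, Real.zero_rpow hq.ne']

lemma signedPow_neg (q t : ℝ) : signedPow q (-t) = -signedPow q t := by
  simp [signedPow]

lemma signedPow_mono {q : ℝ} (hq : 0 < q) : Monotone (signedPow q) := by
  intro a b hab
  unfold signedPow
  gcongr

lemma continuous_signedPow {q : ℝ} (hq : 0 < q) : Continuous (signedPow q) := by
  unfold signedPow
  exact ((continuous_id.max continuous_const).rpow_const fun _ => Or.inr hq.le).sub
    ((continuous_neg.max continuous_const).rpow_const fun _ => Or.inr hq.le)

lemma abs_signedPow {q : ℝ} (hq : 0 < q) (t : ℝ) : |signedPow q t| = |t| ^ q := by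
  rcases le_total 0 t with h | h
  · rw [signedPow_of_nonneg hq h, abs_of_nonneg h, abs_of_nonneg (Real.rpow_nonneg h q)]
  · have h' : 0 ≤ -t := by linarith
    rw [← neg_neg t, signedPow_neg, abs_neg, signedPow_of_nonneg hq h',
      abs_of_nonneg (Real.rpow_nonneg h' q), abs_neg, abs_of_nonneg h']

lemma signedPow_mul_self {q : ℝ} (hq : 0 < q) (t : ℝ) : signedPow q t * t = |t| ^ (q + 1) := by
  rcases le_total 0 t with h | h
  · rw [signedPow_of_nonneg hq h, abs_of_nonneg h, Real.rpow_add_one' h (by linarith)]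
  · have h' : 0 ≤ -t := by linarith
    have := signedPow_neg q (-t)
    rw [neg_neg] at this
    rw [this, signedPow_of_nonneg hq h', abs_of_nonpos h, Real.rpow_add_one' h' (by linarith)]
    ring

lemma hasDerivAt_signedPow {q t : ℝ} (hq : 0 < q) (ht : t ≠ 0) :
    HasDerivAt (signedPow q) (q * |t| ^ (q - 1)) t := by
  have key : ∀ s : ℝ, 0 < s → HasDerivAt (signedPow q) (q * |s| ^ (q - 1)) s := by
    intro s hs
    rw [abs_of_pos hs]
    refine (Real.hasDerivAt_rpow_const (Or.inl hs.ne')).congr_of_eventuallyEq ?_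
    filter_upwards [lt_mem_nhds hs] with x hx
    exact signedPow_of_nonneg hq hx.le
  rcases ht.lt_or_gt with h | h
  · have h1 := (key (-t) (by linarith)).comp t (hasDerivAt_neg t)
    have h2 := h1.neg
    have h3 : -signedPow q ∘ Neg.neg = signedPow q := by
      funext x
      simp [signedPow_neg]
    rwa [abs_neg, mul_neg_one, neg_neg, h3] at h2
  · exact key t h

/-- A local Lipschitz bound for `signedPow` whose constant blows up at most like its derivative. -/
lemma exists_abs_signedPow_sub_le {q M : ℝ} (hq : 0 < q) (hM : 0 < M) :
    ∃ C, 0 ≤ C ∧ ∀ A B : ℝ, A ≠ 0 → |B| ≤ M →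
      |signedPow q (A + B) - signedPow q A| ≤ C * (|A| ^ (q - 1) + 1) * |B| := by
  set C₁ : ℝ := q * (2⁻¹ ^ (q - 1) + (3 / 2) ^ (q - 1)) with hC₁
  set C₂ : ℝ := (3 ^ q + 2 ^ q) * (2⁻¹ ^ (q - 1) + M ^ (q - 1)) with hC₂
  have hC₁0 : 0 ≤ C₁ := by positivity
  have hC₂0 : 0 ≤ C₂ := by positivity
  refine ⟨C₁ + C₂, by positivity, fun A B hA hBM => ?_⟩
  have hA' : 0 < |A| := abs_pos.2 hA
  have hApow : 0 ≤ |A| ^ (q - 1) := by positivity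
  rcases le_or_gt |B| (|A| / 2) with hB | hB
  · have hbound : ∀ x ∈ Set.uIcc A (A + B), |A| / 2 ≤ |x| ∧ |x| ≤ 3 / 2 * |A| := by
      intro x hx
      have h1 : |x - A| ≤ |B| := by
        have := Set.abs_sub_left_of_mem_uIcc hx
        simpa using this
      have h2 := abs_sub_abs_le_abs_sub A x
      have h3 := abs_sub_abs_le_abs_sub x A
      rw [abs_sub_comm A x] at h2
      constructor <;> linarith
    have hmv := (convex_uIcc A (A + B)).norm_image_sub_le_of_norm_hasDerivWithin_le
      (f := signedPow q) (f' := fun x => q * |x| ^ (q - 1)) (C := C₁ * |A| ^ (q - 1))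
      (fun x hx => (hasDerivAt_signedPow hq (abs_pos.1
        (lt_of_lt_of_le (by positivity) (hbound x hx).1))).hasDerivWithinAt)
      (fun x hx => ?_) Set.left_mem_uIcc Set.right_mem_uIcc
    · rw [Real.norm_eq_abs, Real.norm_eq_abs, add_sub_cancel_left] at hmv
      refine hmv.trans ?_
      gcongr
      · linarith
      · linarith
    · obtain ⟨hl, hu⟩ := hbound x hx
      have hx0 : 0 < |x| := lt_of_lt_of_le (by positivity) hl
      rw [Real.norm_of_nonneg (by positivity), hC₁, mul_assoc]
      gcongr
      rw [add_mul, ← Real.mul_rpow (by norm_num) hA'.le, ← Real.mul_rpow (by norm_num) hA'.le]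
      rcases le_total 0 (q - 1) with hq1 | hq1
      · have := Real.rpow_le_rpow hx0.le hu hq1
        have h0 : 0 ≤ (2⁻¹ * |A|) ^ (q - 1) := by positivity
        linarith
      · have := Real.rpow_le_rpow_of_nonpos (by positivity) hl hq1
        have h0 : 0 ≤ (3 / 2 * |A|) ^ (q - 1) := by positivity
        rw [inv_mul_eq_div]
        linarith
  · have hB0 : 0 < |B| := lt_of_le_of_lt (by positivity) hB
    have e1 : |A + B| ^ q ≤ (3 * |B|) ^ q := by
      gcongr
      linarith [abs_add_le A B]
    have e2 : |A| ^ q ≤ (2 * |B|) ^ q := by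
      gcongr
      linarith
    rw [Real.mul_rpow (by norm_num) hB0.le] at e1 e2
    have e3 : |B| ^ q = |B| ^ (q - 1) * |B| := by
      rw [← Real.rpow_add_one hB0.ne']; simp
    have e4 : |B| ^ (q - 1) ≤ (2⁻¹ ^ (q - 1) + M ^ (q - 1)) * (|A| ^ (q - 1) + 1) := by
      have i1 : 0 ≤ (2⁻¹ : ℝ) ^ (q - 1) := by positivity
      have i2 : 0 ≤ M ^ (q - 1) := by positivity
      rcases le_total 0 (q - 1) with hq1 | hq1
      · have := Real.rpow_le_rpow hB0.le hBM hq1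
        nlinarith [mul_nonneg i1 hApow, mul_nonneg i2 hApow]
      · have := Real.rpow_le_rpow_of_nonpos (by positivity) hB.le hq1
        rw [← inv_mul_eq_div, Real.mul_rpow (by norm_num) hA'.le] at this
        nlinarith [mul_nonneg i1 hApow, mul_nonneg i2 hApow]
    calc |signedPow q (A + B) - signedPow q A|
        ≤ |signedPow q (A + B)| + |signedPow q A| := abs_sub _ _
      _ ≤ (3 ^ q + 2 ^ q) * |B| ^ q := by
          rw [abs_signedPow hq, abs_signedPow hq]; linarith
      _ ≤ (3 ^ q + 2 ^ q) * ((2⁻¹ ^ (q - 1) + M ^ (q - 1)) * (|A| ^ (q - 1) + 1) * |B|) := by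
          rw [e3]; gcongr
      _ = C₂ * (|A| ^ (q - 1) + 1) * |B| := by rw [hC₂]; ring
      _ ≤ (C₁ + C₂) * (|A| ^ (q - 1) + 1) * |B| := by
          gcongr; linarith

open Metric Filter Topology

/-- Lebesgue measure restricted to the closed unit ball. -/
noncomputable abbrev ballMeasure (N : ℕ) : Measure (EuclideanSpace ℝ (Fin N)) :=
  volume.restrict (closedBall 0 1)

instance isFiniteMeasure_ballMeasure (N : ℕ) : IsFiniteMeasure (ballMeasure N) :=
  ⟨by simpa using measure_closedBall_lt_top⟩

lemma ae_ballMeasure_norm_le (N : ℕ) : ∀ᵐ e ∂(ballMeasure N), ‖e‖ ≤ 1 := by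
  filter_upwards [ae_restrict_mem measurableSet_closedBall] with e he
  simpa using he

lemma measurePreserving_ballMeasure {N : ℕ}
    (R : EuclideanSpace ℝ (Fin N) ≃ₗᵢ[ℝ] EuclideanSpace ℝ (Fin N)) :
    MeasurePreserving R (ballMeasure N) (ballMeasure N) := by
  have h := R.measurePreserving.restrict_preimage
    (s := closedBall (0 : EuclideanSpace ℝ (Fin N)) 1) measurableSet_closedBall
  have hpre : R ⁻¹' closedBall 0 1 = closedBall 0 1 := by
    ext x
    simp
  rwa [hpre] at h

lemma integral_ballMeasure_comp {N : ℕ}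
    (R : EuclideanSpace ℝ (Fin N) ≃ₗᵢ[ℝ] EuclideanSpace ℝ (Fin N))
    (f : EuclideanSpace ℝ (Fin N) → ℝ) :
    ∫ e, f (R e) ∂(ballMeasure N) = ∫ e, f e ∂(ballMeasure N) :=
  (measurePreserving_ballMeasure R).integral_comp
    R.toHomeomorph.toMeasurableEquiv.measurableEmbedding f

lemma exists_isometry_inner_eq {N : ℕ} {a b : EuclideanSpace ℝ (Fin N)} (h : ‖a‖ = ‖b‖) :
    ∃ R : EuclideanSpace ℝ (Fin N) ≃ₗᵢ[ℝ] EuclideanSpace ℝ (Fin N),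
      ∀ e, inner ℝ a (R e) = inner ℝ b e := by
  refine ⟨(ℝ ∙ (a - b))ᗮ.reflection, fun e => ?_⟩
  have h1 := (ℝ ∙ (a - b))ᗮ.reflection.inner_map_map a ((ℝ ∙ (a - b))ᗮ.reflection e)
  rw [Submodule.reflection_sub h, Submodule.reflection_reflection] at h1
  exact h1.symm

lemma ae_inner_ne_zero {N : ℕ} {a : EuclideanSpace ℝ (Fin N)} (ha : a ≠ 0) :
    ∀ᵐ e ∂(ballMeasure N), inner ℝ a e ≠ 0 := by
  refine ae_restrict_of_ae ?_
  have h0 : volume (SetLike.coe (ℝ ∙ a)ᗮ) = 0 := by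
    refine Measure.addHaar_submodule _ _ fun htop => ha ?_
    have : a ∈ (ℝ ∙ a)ᗮ := htop ▸ Submodule.mem_top
    rw [Submodule.mem_orthogonal_singleton_iff_inner_right] at this
    exact inner_self_eq_zero.1 this
  rw [ae_iff]
  convert h0 using 2
  ext e
  simp [Submodule.mem_orthogonal_singleton_iff_inner_right]

lemma integrable_abs_coord_rpow {N : ℕ} {q : ℝ} (hq : 0 < q) (i : Fin N) :
    Integrable (fun e : EuclideanSpace ℝ (Fin N) => |e i| ^ (q - 1)) (ballMeasure N) := by
  have h1 : IntegrableOn (fun t : ℝ => |t| ^ (q - 1)) (Set.Icc (-1) 1) := by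
    have hpos : IntervalIntegrable (fun t : ℝ => |t| ^ (q - 1)) volume 0 1 := by
      refine (intervalIntegral.intervalIntegrable_rpow' (a := 0) (b := 1)
        (r := q - 1) (by linarith)).congr ?_
      intro t ht
      rw [Set.uIoc_of_le zero_le_one] at ht
      simp only [abs_of_pos ht.1]
    have hneg : IntervalIntegrable (fun t : ℝ => |t| ^ (q - 1)) volume (-1) 0 := by
      have := (IntervalIntegrable.iff_comp_neg enorm_ne_top).1 hpos
      simpa using this.symm
    rw [integrableOn_Icc_iff_integrableOn_Ioc,
      ← intervalIntegrable_iff_integrableOn_Ioc_of_le (by norm_num)]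
    exact hneg.trans hpos
  have h2 : Integrable (fun x : Fin N → ℝ => ∏ j, (Set.Icc (-1 : ℝ) 1).indicator
      (fun t => if j = i then |t| ^ (q - 1) else 1) (x j)) (Measure.pi fun _ => volume) := by
    refine Integrable.fintype_prod (f := fun j => (Set.Icc (-1 : ℝ) 1).indicator
      (fun t => if j = i then |t| ^ (q - 1) else 1)) fun j => ?_
    rw [integrable_indicator_iff measurableSet_Icc]
    by_cases hj : j = i
    · simpa [hj] using h1
    · simp [hj]
  have h3 := (PiLp.volume_preserving_ofLp (Fin N)).integrable_comp_of_integrable h2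
  refine (h3.mono_measure Measure.restrict_le_self).congr ?_
  filter_upwards [ae_ballMeasure_norm_le N] with e he
  have hmem : ∀ j, e j ∈ Set.Icc (-1 : ℝ) 1 := fun j =>
    abs_le.1 ((PiLp.norm_apply_le e j).trans he)
  simp only [Function.comp]
  rw [Finset.prod_eq_single i]
  · simp [hmem i]
  · intro j _ hj
    simp [hmem j, hj]
  · simp

lemma exists_integral_abs_inner_rpow (N : ℕ) {q : ℝ} (hq : 0 < q) :
    ∃ J, 0 ≤ J ∧ ∀ a : EuclideanSpace ℝ (Fin N), a ≠ 0 →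
      Integrable (fun e => |inner ℝ a e| ^ (q - 1)) (ballMeasure N) ∧
      ∫ e, |inner ℝ a e| ^ (q - 1) ∂(ballMeasure N) = ‖a‖ ^ (q - 1) * J := by
  rcases Nat.eq_zero_or_pos N with rfl | hN
  · exact ⟨0, le_rfl, fun a ha => (ha (Subsingleton.elim _ _)).elim⟩
  let i : Fin N := ⟨0, hN⟩
  refine ⟨∫ e, |e i| ^ (q - 1) ∂(ballMeasure N), integral_nonneg fun e => by positivity,
    fun a ha => ?_⟩
  obtain ⟨R, hR⟩ := exists_isometry_inner_eq (a := EuclideanSpace.single i ‖a‖) (b := a) (by simp)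
  have hfun : (fun e => |inner ℝ a e| ^ (q - 1)) =
      fun e => ‖a‖ ^ (q - 1) * |(R e) i| ^ (q - 1) := by
    funext e
    rw [← hR e, EuclideanSpace.inner_single_left, abs_mul,
      Real.mul_rpow (abs_nonneg _) (abs_nonneg _)]
    simp
  rw [hfun]
  constructor
  · exact ((measurePreserving_ballMeasure R).integrable_comp_of_integrable
      (integrable_abs_coord_rpow hq i)).const_mul _
  · rw [integral_const_mul, integral_ballMeasure_comp R fun e => |e i| ^ (q - 1)]

lemma integrable_ballMeasure_of_continuous {N : ℕ} {f : EuclideanSpace ℝ (Fin N) → ℝ}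
    (hf : Continuous f) : Integrable f (ballMeasure N) :=
  hf.continuousOn.integrableOn_compact (isCompact_closedBall 0 1)

lemma integral_signedPow_inner (N : ℕ) (q : ℝ) (a : EuclideanSpace ℝ (Fin N)) :
    ∫ e, signedPow q (inner ℝ a e) ∂(ballMeasure N) = 0 := by
  have h := integral_ballMeasure_comp (LinearIsometryEquiv.neg ℝ)
    fun e => signedPow q (inner ℝ a e)
  simp only [LinearIsometryEquiv.coe_neg, inner_neg_right, signedPow_neg, integral_neg] at h
  linarith

/-- Averaging `signedPow q ⟪ξ, e⟫ • e` over the unit ball gives a multiple of `‖ξ‖ ^ (q - 1) • ξ`. -/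
lemma exists_integral_signedPow_inner_mul {N : ℕ} (hN : 0 < N) {q : ℝ} (hq : 0 < q) :
    ∃ c, 0 < c ∧ ∀ ξ η : EuclideanSpace ℝ (Fin N),
      ∫ e, signedPow q (inner ℝ ξ e) * inner ℝ η e ∂(ballMeasure N) =
        c * inner ℝ (‖ξ‖ ^ (q - 1) • ξ) η := by
  let i : Fin N := ⟨0, hN⟩
  let a : EuclideanSpace ℝ (Fin N) := EuclideanSpace.single i 1
  have ha : a ≠ 0 := by simp [a]
  have hcont : ∀ ξ : EuclideanSpace ℝ (Fin N), Continuous fun e => |inner ℝ ξ e| ^ (q + 1) :=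
    fun ξ => by
      refine Continuous.rpow_const (by fun_prop) fun _ => Or.inr (by linarith)
  have hInt : ∀ ξ η : EuclideanSpace ℝ (Fin N),
      Integrable (fun e => signedPow q (inner ℝ ξ e) * inner ℝ η e) (ballMeasure N) := fun ξ η =>
    integrable_ballMeasure_of_continuous
      (((continuous_signedPow hq).comp (by fun_prop)).mul (by fun_prop))
  refine ⟨∫ e, |inner ℝ a e| ^ (q + 1) ∂(ballMeasure N), ?_, fun ξ η => ?_⟩
  · rw [integral_pos_iff_support_of_nonneg (fun e => by positivity)
      (integrable_ballMeasure_of_continuous (hcont a))]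
    have hpos : 0 < ballMeasure N Set.univ := by
      simpa using measure_closedBall_pos volume (0 : EuclideanSpace ℝ (Fin N)) one_pos
    refine hpos.trans_le (le_of_eq (measure_congr ?_))
    filter_upwards [ae_inner_ne_zero ha] with e he
    refine propext ⟨fun _ => ?_, fun _ => trivial⟩
    exact (Real.rpow_pos_of_pos (abs_pos.2 he) _).ne'
  rcases eq_or_ne ξ 0 with rfl | hξ
  · simp [signedPow]
  have hξn : 0 < ‖ξ‖ := norm_pos_iff.2 hξ
  have hpar : ∫ e, signedPow q (inner ℝ ξ e) * inner ℝ ξ e ∂(ballMeasure N) =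
      ‖ξ‖ ^ (q + 1) * ∫ e, |inner ℝ a e| ^ (q + 1) ∂(ballMeasure N) := by
    obtain ⟨R, hR⟩ := exists_isometry_inner_eq (a := ‖ξ‖ • a) (b := ξ) (by simp [a, norm_smul])
    simp_rw [signedPow_mul_self hq, ← hR]
    rw [integral_ballMeasure_comp R fun e => |inner ℝ (‖ξ‖ • a) e| ^ (q + 1),
      ← integral_const_mul]
    congr with e
    rw [real_inner_smul_left, abs_mul, abs_of_pos hξn, Real.mul_rpow hξn.le (abs_nonneg _)]
  have horth : ∀ ζ : EuclideanSpace ℝ (Fin N), inner ℝ ξ ζ = 0 →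
      ∫ e, signedPow q (inner ℝ ξ e) * inner ℝ ζ e ∂(ballMeasure N) = 0 := by
    intro ζ hζ
    set R := (ℝ ∙ ξ).reflection
    have hRξ : R ξ = ξ :=
      Submodule.reflection_mem_subspace_eq_self (Submodule.mem_span_singleton_self ξ)
    have hRζ : R ζ = -ζ := Submodule.reflection_mem_subspace_orthogonalComplement_eq_neg
      (Submodule.mem_orthogonal_singleton_iff_inner_right.2 hζ)
    have hmv : ∀ x e, inner ℝ x (R e) = inner ℝ (R x) e := fun x e => by
      rw [← R.inner_map_map x (R e), Submodule.reflection_reflection]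
    have h := integral_ballMeasure_comp R
      fun e => signedPow q (inner ℝ ξ e) * inner ℝ ζ e
    simp only [hmv, hRξ, hRζ, inner_neg_left, mul_neg, integral_neg] at h
    linarith
  set t : ℝ := inner ℝ ξ η / ‖ξ‖ ^ 2
  have hη : η = t • ξ + (η - t • ξ) := by abel
  have hζ : inner ℝ ξ (η - t • ξ) = 0 := by
    rw [inner_sub_right, real_inner_smul_right, real_inner_self_eq_norm_sq]
    simp only [t]
    field_simp
    ring
  have hsplit : ∫ e, signedPow q (inner ℝ ξ e) * inner ℝ η e ∂(ballMeasure N) =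
      t * ∫ e, signedPow q (inner ℝ ξ e) * inner ℝ ξ e ∂(ballMeasure N) := by
    rw [← integral_const_mul, ← sub_eq_zero, ← integral_sub (hInt ξ η) ((hInt ξ ξ).const_mul t),
      ← horth _ hζ]
    congr with e
    rw [inner_sub_left, real_inner_smul_left]
    ring
  have hpow : ‖ξ‖ ^ (q + 1) = ‖ξ‖ ^ (q - 1) * ‖ξ‖ ^ 2 := by
    rw [← Real.rpow_natCast ‖ξ‖ 2, ← Real.rpow_add hξn]
    norm_num
    ring_nf
  rw [hsplit, hpar, real_inner_smul_left, hpow]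
  simp only [t]
  field_simp

/-- Differentiating `∫ signedPow q ⟪a, e⟫` under the integral sign, along a family of increments
which is bounded and converges pointwise. -/
lemma tendsto_integral_signedPow_slope {N : ℕ} {q : ℝ} (hq : 0 < q)
    {a : EuclideanSpace ℝ (Fin N)} (ha : a ≠ 0) {R : ℝ → EuclideanSpace ℝ (Fin N) → ℝ}
    {R₀ g : EuclideanSpace ℝ (Fin N) → ℝ} {K : ℝ} (hK : 0 < K)
    (hRc : ∀ h, 0 < h → Continuous (R h))
    (hRb : ∀ h, 0 < h → ∀ e, ‖e‖ ≤ 1 → |R h e| ≤ K)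
    (hR : ∀ e, Tendsto (fun h => R h e) (𝓝[>] 0) (𝓝 (R₀ e)))
    (hgc : Continuous g) (hgb : ∃ G, ∀ e, ‖e‖ ≤ 1 → |g e| ≤ G) :
    Tendsto (fun h => ∫ e, (signedPow q (inner ℝ a e + h * R h e) - signedPow q (inner ℝ a e)) / h
      * g e ∂(ballMeasure N)) (𝓝[>] 0)
      (𝓝 (∫ e, q * |inner ℝ a e| ^ (q - 1) * R₀ e * g e ∂(ballMeasure N))) := by
  obtain ⟨C, hC0, hC⟩ := exists_abs_signedPow_sub_le hq hK
  obtain ⟨J, -, hJ⟩ := exists_integral_abs_inner_rpow N hq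
  obtain ⟨G, hG⟩ := hgb
  have hsmall : ∀ᶠ h in 𝓝[>] (0 : ℝ), 0 < h ∧ h ≤ 1 := by
    filter_upwards [Ioc_mem_nhdsGT (zero_lt_one' ℝ)] with h hh using hh
  refine tendsto_integral_filter_of_dominated_convergence
    (fun e => C * (|inner ℝ a e| ^ (q - 1) + 1) * K * G) ?_ ?_ ?_ ?_
  · filter_upwards [hsmall] with h hh
    have h1 := continuous_signedPow hq
    have h2 := hRc h hh.1
    exact Continuous.aestronglyMeasurable (by fun_prop)
  · filter_upwards [hsmall] with h ⟨h0, h1⟩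
    filter_upwards [ae_inner_ne_zero ha, ae_ballMeasure_norm_le N] with e he hen
    have hb := hRb h h0 e hen
    have hB : |h * R h e| ≤ K := by
      rw [abs_mul, abs_of_pos h0]
      nlinarith [abs_nonneg (R h e)]
    have hmain := hC _ _ he hB
    rw [norm_mul, norm_div, Real.norm_eq_abs, Real.norm_eq_abs, Real.norm_eq_abs, abs_of_pos h0]
    refine mul_le_mul ?_ (hG e hen) (abs_nonneg _) (by positivity)
    rw [div_le_iff₀ h0]
    refine hmain.trans ?_
    rw [abs_mul, abs_of_pos h0, mul_assoc, mul_comm h, ← mul_assoc, ← mul_assoc]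
    gcongr
  · exact ((((hJ a ha).1.add (integrable_const 1)).const_mul C).mul_const K).mul_const G
  · filter_upwards [ae_inner_ne_zero ha] with e he
    refine Tendsto.mul_const _ ?_
    have hd := hasDerivAt_signedPow hq he
    have hlin : HasDerivWithinAt (fun h => inner ℝ a e + h * R h e) (R₀ e) (Set.Ioi 0) 0 := by
      rw [hasDerivWithinAt_iff_tendsto_slope' (by simp)]
      refine (hR e).congr' ?_
      filter_upwards [self_mem_nhdsWithin] with h hh
      have : h ≠ 0 := ne_of_gt hh
      simp [slope_def_field, this]
    have hcomp : HasDerivWithinAt (fun h => signedPow q (inner ℝ a e + h * R h e))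
        (q * |inner ℝ a e| ^ (q - 1) * R₀ e) (Set.Ioi 0) 0 := by
      refine HasDerivAt.comp_hasDerivWithinAt (h₂ := signedPow q) 0 ?_ hlin
      simpa using hd
    rw [hasDerivWithinAt_iff_tendsto_slope' (by simp)] at hcomp
    refine hcomp.congr fun h => ?_
    simp [slope_def_field]

section PLaplacian

variable {N : ℕ}

lemma contDiff_gradient {f : EuclideanSpace ℝ (Fin N) → ℝ} {m n : WithTop ℕ∞}
    (hf : ContDiff ℝ n f) (hmn : m + 1 ≤ n) : ContDiff ℝ m (gradient f) :=
  (InnerProductSpace.toDual ℝ (EuclideanSpace ℝ (Fin N))).symm.contDiff.comp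
    (hf.fderiv_right hmn)

lemma abs_sub_sub_inner_gradient_le {f : EuclideanSpace ℝ (Fin N) → ℝ} {K : NNReal}
    (hf : Differentiable ℝ f) (hK : LipschitzWith K (gradient f))
    (y z : EuclideanSpace ℝ (Fin N)) :
    |f (y + z) - f y - inner ℝ (gradient f y) z| ≤ K * ‖z‖ ^ 2 := by
  have h := (convex_closedBall y ‖z‖).norm_image_sub_le_of_norm_hasFDerivWithin_le'
    (f := f) (f' := fderiv ℝ f) (φ := fderiv ℝ f y) (C := K * ‖z‖) (x := y) (y := y + z)
    (fun x _ => (hf x).hasFDerivAt.hasFDerivWithinAt) (fun x hx => ?_)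
    (mem_closedBall_self (norm_nonneg z)) (by simp)
  · rw [add_sub_cancel_left, Real.norm_eq_abs] at h
    rw [inner_gradient_left]
    linarith
  · have h1 := hK.dist_le_mul x y
    rw [dist_eq_norm] at h1
    rw [← toDual_gradient, ← toDual_gradient, ← map_sub, LinearIsometryEquiv.norm_map]
    exact h1.trans (by gcongr; simpa using hx)

lemma differentiableAt_norm_rpow_smul {q : ℝ} {a : EuclideanSpace ℝ (Fin N)} (ha : a ≠ 0) :
    DifferentiableAt ℝ (fun x : EuclideanSpace ℝ (Fin N) => ‖x‖ ^ (q - 1) • x) a :=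
  ((differentiableAt_id.norm ℝ ha).rpow_const (Or.inl (norm_ne_zero_iff.2 ha))).smul
    differentiableAt_id

lemma inner_fderiv_norm_rpow_smul {q c : ℝ} (hq : 0 < q)
    (hc : ∀ ξ η : EuclideanSpace ℝ (Fin N),
      ∫ e, signedPow q (inner ℝ ξ e) * inner ℝ η e ∂(ballMeasure N) =
        c * inner ℝ (‖ξ‖ ^ (q - 1) • ξ) η)
    {a : EuclideanSpace ℝ (Fin N)} (ha : a ≠ 0) (ζ η : EuclideanSpace ℝ (Fin N)) :
    c * inner ℝ (fderiv ℝ (fun x : EuclideanSpace ℝ (Fin N) => ‖x‖ ^ (q - 1) • x) a ζ) η =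
      ∫ e, q * |inner ℝ a e| ^ (q - 1) * inner ℝ ζ e * inner ℝ η e ∂(ballMeasure N) := by
  set F := fun x : EuclideanSpace ℝ (Fin N) => ‖x‖ ^ (q - 1) • x
  have hbd : ∀ x e : EuclideanSpace ℝ (Fin N), ‖e‖ ≤ 1 → |inner ℝ x e| ≤ ‖x‖ := fun x e he =>
    (abs_real_inner_le_norm x e).trans (mul_le_of_le_one_right (norm_nonneg x) he)
  have hlim := tendsto_integral_signedPow_slope hq ha (R := fun _ e => inner ℝ ζ e)
    (R₀ := fun e => inner ℝ ζ e) (g := fun e => inner ℝ η e) (K := ‖ζ‖ + 1) (by positivity)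
    (fun h _ => by fun_prop) (fun h _ e he => (hbd ζ e he).trans (by linarith))
    (fun e => tendsto_const_nhds) (by fun_prop) ⟨‖η‖, hbd η⟩
  have hline : HasDerivAt (fun h : ℝ => a + h • ζ) ζ 0 := by
    simpa using ((hasDerivAt_id (0 : ℝ)).smul_const ζ).const_add a
  have hF : HasFDerivAt F (fderiv ℝ F a) (a + (0 : ℝ) • ζ) := by
    simpa using (differentiableAt_norm_rpow_smul (q := q) ha).hasFDerivAt
  have hd := ((hF.comp_hasDerivAt 0 hline).inner ℝ (hasDerivAt_const 0 η)).const_mul c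
  simp only [inner_zero_right, zero_add] at hd
  have hd' := (hasDerivWithinAt_iff_tendsto_slope' (s := Set.Ioi 0) (by simp)).1
    hd.hasDerivWithinAt
  refine tendsto_nhds_unique hd' (hlim.congr fun h => ?_)
  have hInt : ∀ ξ : EuclideanSpace ℝ (Fin N),
      Integrable (fun e => signedPow q (inner ℝ ξ e) * inner ℝ η e) (ballMeasure N) := fun ξ =>
    integrable_ballMeasure_of_continuous
      (((continuous_signedPow hq).comp (by fun_prop)).mul (by fun_prop))
  simp only [slope_def_field, Function.comp, zero_smul, add_zero, sub_zero, F]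
  rw [← hc, ← hc, ← integral_sub (hInt _) (hInt _), ← integral_div]
  congr with e
  rw [inner_add_left, real_inner_smul_left]
  ring

lemma pLap8_eq_integral {p c : ℝ} (hp : 1 < p)
    (hc : ∀ ξ η : EuclideanSpace ℝ (Fin N),
      ∫ e, signedPow (p - 1) (inner ℝ ξ e) * inner ℝ η e ∂(ballMeasure N) =
        c * inner ℝ (‖ξ‖ ^ (p - 1 - 1) • ξ) η)
    {ρ : EuclideanSpace ℝ (Fin N) → ℝ} {y : EuclideanSpace ℝ (Fin N)}
    (hρ : DifferentiableAt ℝ (gradient ρ) y) (hy : gradient ρ y ≠ 0) :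
    c * pLap8 p ρ y = ∫ e, (p - 1) * |inner ℝ (gradient ρ y) e| ^ (p - 1 - 1) *
      inner ℝ (fderiv ℝ (gradient ρ) y e) e ∂(ballMeasure N) := by
  have hq : 0 < p - 1 := by linarith
  have hcomp : fderiv ℝ (fun z => ‖gradient ρ z‖ ^ (p - 2) • gradient ρ z) y =
      (fderiv ℝ (fun x : EuclideanSpace ℝ (Fin N) => ‖x‖ ^ (p - 1 - 1) • x) (gradient ρ y)).comp
        (fderiv ℝ (gradient ρ) y) := by
    rw [← fderiv_comp y (differentiableAt_norm_rpow_smul hy) hρ]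
    congr 1
    funext z
    simp only [Function.comp]
    ring_nf
  set D := fderiv ℝ (gradient ρ) y
  have hcoord : ∀ i (v : EuclideanSpace ℝ (Fin N)),
      v i = inner ℝ v (EuclideanSpace.single i (1 : ℝ)) := fun i v => by
    simp [EuclideanSpace.inner_single_right]
  obtain ⟨J, -, hJ⟩ := exists_integral_abs_inner_rpow N hq
  rw [pLap8, divg8, Finset.mul_sum, hcomp]
  simp only [ContinuousLinearMap.comp_apply]
  simp_rw [hcoord, inner_fderiv_norm_rpow_smul hq hc hy]
  rw [← integral_finsetSum]
  · congr with e
    simp_rw [mul_assoc, ← Finset.mul_sum]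
    congr 2
    conv_rhs => rw [← (EuclideanSpace.basisFun (Fin N) ℝ).sum_repr' e]
    simp only [map_sum, map_smul, sum_inner, real_inner_smul_left]
    rw [(EuclideanSpace.basisFun (Fin N) ℝ).sum_repr' e]
    refine Finset.sum_congr rfl fun i _ => ?_
    simp [mul_comm]
  · intro i _
    have hb : ∀ᵐ e ∂(ballMeasure N), ‖inner ℝ (D (EuclideanSpace.single i 1)) e *
        inner ℝ (EuclideanSpace.single i (1 : ℝ)) e‖ ≤ ‖D (EuclideanSpace.single i 1)‖ := by
      filter_upwards [ae_ballMeasure_norm_le N] with e he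
      rw [norm_mul, ← mul_one ‖D _‖]
      refine mul_le_mul ((norm_inner_le_norm _ _).trans
        (mul_le_of_le_one_right (norm_nonneg _) he)) ((norm_inner_le_norm _ _).trans ?_)
        (norm_nonneg _) (norm_nonneg _)
      simpa using he
    have := (((hJ _ hy).1.const_mul (p - 1)).mul_bdd
      (Continuous.aestronglyMeasurable (by fun_prop)) hb)
    simpa only [mul_assoc] using this

/-- The nonlocal approximation of the `(q + 1)`-Laplacian at scale `h`. -/
noncomputable def nonlocalPLap (q h : ℝ) (w : EuclideanSpace ℝ (Fin N) → ℝ)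
    (x : EuclideanSpace ℝ (Fin N)) : ℝ :=
  (∫ e, signedPow q ((w (x + h • e) - w x) / h) ∂(ballMeasure N)) / h

lemma tendsto_second_order_quotient {ρ : EuclideanSpace ℝ (Fin N) → ℝ}
    (hρ : ContDiff ℝ 2 ρ) (y e : EuclideanSpace ℝ (Fin N)) :
    Tendsto (fun h : ℝ => (ρ (y + h • e) - ρ y - h * inner ℝ (gradient ρ y) e) / h ^ 2) (𝓝[>] 0)
      (𝓝 (2⁻¹ * inner ℝ (fderiv ℝ (gradient ρ) y e) e)) := by
  have hline : ∀ h : ℝ, HasDerivAt (fun h : ℝ => y + h • e) e h := fun h => by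
    simpa using ((hasDerivAt_id h).smul_const e).const_add y
  have h1 : ∀ h : ℝ, HasDerivAt (fun h : ℝ => ρ (y + h • e))
      (inner ℝ (gradient ρ (y + h • e)) e) h := fun h => by
    rw [inner_gradient_left]
    exact ((hρ.differentiable (by norm_num)) _).hasFDerivAt.comp_hasDerivAt h (hline h)
  have hnum : ∀ h : ℝ, HasDerivAt
      (fun h : ℝ => ρ (y + h • e) - ρ y - h * inner ℝ (gradient ρ y) e)
      (inner ℝ (gradient ρ (y + h • e)) e - inner ℝ (gradient ρ y) e) h := fun h => by
    have := ((h1 h).sub_const (ρ y)).sub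
      ((hasDerivAt_id h).mul_const (inner ℝ (gradient ρ y) e))
    rwa [one_mul] at this
  have hgrad : HasFDerivAt (gradient ρ) (fderiv ℝ (gradient ρ) y) (y + (0 : ℝ) • e) := by
    simpa using ((contDiff_gradient hρ (m := 1) (by norm_num)).differentiable
      (by norm_num) y).hasFDerivAt
  have h2 := ((hgrad.comp_hasDerivAt 0 (hline 0)).inner ℝ (hasDerivAt_const (0 : ℝ) e))
  simp only [inner_zero_right, zero_add] at h2
  have h3 := ((hasDerivWithinAt_iff_tendsto_slope' (s := Set.Ioi 0) (by simp)).1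
    h2.hasDerivWithinAt).const_mul 2⁻¹
  refine HasDerivAt.lhopital_zero_nhdsGT (g' := fun h => 2 * h)
    (Eventually.of_forall hnum) (Eventually.of_forall fun h => by simpa using hasDerivAt_pow 2 h)
    ?_ ?_ ?_ (h3.congr' ?_)
  · filter_upwards [self_mem_nhdsWithin] with h hh
    have : (0 : ℝ) < h := hh
    positivity
  · have := (hnum 0).continuousAt.tendsto
    simp only [zero_smul, add_zero, sub_self, zero_mul] at this
    exact this.mono_left nhdsWithin_le_nhds
  · have := (hasDerivAt_pow 2 (0 : ℝ)).continuousAt.tendsto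
    simp only [ne_eq, OfNat.ofNat_ne_zero, not_false_eq_true, zero_pow] at this
    exact this.mono_left nhdsWithin_le_nhds
  · filter_upwards [self_mem_nhdsWithin] with h hh
    have : h ≠ 0 := ne_of_gt hh
    simp [slope_def_field]
    field_simp

lemma tendsto_nonlocalPLap {p c : ℝ} (hp : 1 < p)
    (hc : ∀ ξ η : EuclideanSpace ℝ (Fin N),
      ∫ e, signedPow (p - 1) (inner ℝ ξ e) * inner ℝ η e ∂(ballMeasure N) =
        c * inner ℝ (‖ξ‖ ^ (p - 1 - 1) • ξ) η)
    {ρ : EuclideanSpace ℝ (Fin N) → ℝ} {K : NNReal} (hρ : ContDiff ℝ 2 ρ)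
    (hK : LipschitzWith K (gradient ρ)) {y : EuclideanSpace ℝ (Fin N)} (hy : gradient ρ y ≠ 0) :
    Tendsto (fun h => nonlocalPLap (p - 1) h ρ y) (𝓝[>] 0) (𝓝 (2⁻¹ * (c * pLap8 p ρ y))) := by
  have hq : 0 < p - 1 := by linarith
  have hρc := hρ.continuous
  have hlim := tendsto_integral_signedPow_slope hq hy
    (R := fun h e => (ρ (y + h • e) - ρ y - h * inner ℝ (gradient ρ y) e) / h ^ 2)
    (R₀ := fun e => 2⁻¹ * inner ℝ (fderiv ℝ (gradient ρ) y e) e) (g := fun _ => 1) (K := K + 1)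
    (by positivity) (fun h _ => by fun_prop) (fun h hh e he => ?_)
    (tendsto_second_order_quotient hρ y) continuous_const ⟨1, fun e _ => by simp⟩
  · rw [pLap8_eq_integral hp hc ((contDiff_gradient hρ (m := 1) (by norm_num)).differentiable
      (by norm_num) y) hy, ← integral_const_mul]
    have hval : ∫ e, (p - 1) * |inner ℝ (gradient ρ y) e| ^ (p - 1 - 1) *
          (2⁻¹ * inner ℝ (fderiv ℝ (gradient ρ) y e) e) * 1 ∂(ballMeasure N) =
        ∫ e, 2⁻¹ * ((p - 1) * |inner ℝ (gradient ρ y) e| ^ (p - 1 - 1) *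
          inner ℝ (fderiv ℝ (gradient ρ) y e) e) ∂(ballMeasure N) := by
      congr with e
      ring
    rw [← hval]
    refine hlim.congr' ?_
    filter_upwards [self_mem_nhdsWithin] with h hh
    have hh0 : h ≠ 0 := ne_of_gt hh
    have hs := continuous_signedPow hq
    simp only [mul_one]
    rw [nonlocalPLap, integral_div, integral_sub, integral_signedPow_inner, sub_zero]
    · congr with e
      congr 1
      field_simp
      ring
    · exact integrable_ballMeasure_of_continuous (by fun_prop)
    · exact integrable_ballMeasure_of_continuous (by fun_prop)
  · have h1 := abs_sub_sub_inner_gradient_le (hρ.differentiable (by norm_num)) hK y (h • e)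
    rw [real_inner_smul_right, norm_smul, Real.norm_of_nonneg hh.le] at h1
    rw [abs_div, abs_of_pos (by positivity : 0 < h ^ 2), div_le_iff₀ (by positivity)]
    refine h1.trans ?_
    rw [mul_pow]
    have h2 : ‖e‖ ^ 2 ≤ 1 := pow_le_one₀ (norm_nonneg e) he
    have h3 : 0 ≤ (K : ℝ) := K.2
    nlinarith [mul_le_mul_of_nonneg_left h2 (mul_nonneg h3 (sq_nonneg h)), sq_nonneg h]

end PLaplacian

section InfConvolution

variable {N : ℕ}

lemma exists_infConvolution {ρ : EuclideanSpace ℝ (Fin N) → ℝ} (hρ : Continuous ρ)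
    (hcs : HasCompactSupport ρ) {n : ℕ} (hn : n ≠ 0) {r : ℝ} (hr : 0 < r) :
    ∃ k : ℝ, 0 < k ∧ ∃ (w : EuclideanSpace ℝ (Fin N) → ℝ)
      (Z : EuclideanSpace ℝ (Fin N) → EuclideanSpace ℝ (Fin N)),
      (∀ x, w x = ρ (x + Z x) + k * (‖Z x‖ ^ 2) ^ n) ∧
      (∀ x z, w x ≤ ρ (x + z) + k * (‖z‖ ^ 2) ^ n) ∧ ∀ x, ‖Z x‖ ≤ r := by
  obtain ⟨M, hM⟩ := hcs.exists_bound_of_continuous hρ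
  have hM0 : 0 ≤ M := (norm_nonneg _).trans (hM 0)
  set k : ℝ := (2 * M + 1) / (r ^ 2) ^ n
  have hk : 0 < k := by positivity
  have hfar : ∀ x z, r < ‖z‖ → ρ x < ρ (x + z) + k * (‖z‖ ^ 2) ^ n := by
    intro x z hz
    have h1 : 2 * M + 1 ≤ k * (‖z‖ ^ 2) ^ n := by
      calc 2 * M + 1 = k * (r ^ 2) ^ n := by simp only [k]; field_simp
        _ ≤ k * (‖z‖ ^ 2) ^ n := by gcongr
    have h2 := abs_le.1 (hM x)
    have h3 := abs_le.1 (hM (x + z))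
    linarith [h2.2, h3.1]
  have hmin : ∀ x, ∃ z, ∀ z', ρ (x + z) + k * (‖z‖ ^ 2) ^ n ≤ ρ (x + z') + k * (‖z'‖ ^ 2) ^ n := by
    intro x
    refine Continuous.exists_forall_le' (by fun_prop) 0 ?_
    filter_upwards [(isCompact_closedBall (0 : EuclideanSpace ℝ (Fin N)) r).compl_mem_cocompact]
      with z hz
    have := hfar x z (by simpa using hz)
    simpa [hn] using this.le
  choose Z hZ using hmin
  refine ⟨k, hk, fun x => ρ (x + Z x) + k * (‖Z x‖ ^ 2) ^ n, Z, fun x => rfl, hZ, fun x => ?_⟩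
  by_contra! hlt
  have h1 := hfar x (Z x) hlt
  have h2 := hZ x 0
  simp [hn] at h2
  linarith

lemma eq_zero_of_isMin_of_gradient_eq_zero {ρ : EuclideanSpace ℝ (Fin N) → ℝ}
    (hρ : Differentiable ℝ ρ) {n : ℕ} (hn : n ≠ 0) {k : ℝ} (hk : 0 < k)
    {x z : EuclideanSpace ℝ (Fin N)}
    (hmin : ∀ z', ρ (x + z) + k * (‖z‖ ^ 2) ^ n ≤ ρ (x + z') + k * (‖z'‖ ^ 2) ^ n)
    (hgrad : gradient ρ (x + z) = 0) : z = 0 := by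
  have hline : HasDerivAt (fun t : ℝ => x + t • z) z 1 := by
    simpa using ((hasDerivAt_id (1 : ℝ)).smul_const z).const_add x
  have hρ' : HasFDerivAt ρ (0 : EuclideanSpace ℝ (Fin N) →L[ℝ] ℝ) (x + (1 : ℝ) • z) := by
    have h := (hρ (x + z)).hasFDerivAt
    rw [← toDual_gradient, hgrad, map_zero] at h
    simpa using h
  have hpow : HasDerivAt (fun t : ℝ => k * (‖z‖ ^ 2) ^ n * t ^ (2 * n))
      (k * (‖z‖ ^ 2) ^ n * (2 * n)) 1 := by
    simpa using (hasDerivAt_pow (2 * n) (1 : ℝ)).const_mul (k * (‖z‖ ^ 2) ^ n)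
  have hsum := (hρ'.comp_hasDerivAt 1 hline).add hpow
  have hloc : IsLocalMin ((ρ ∘ fun t : ℝ => x + t • z) +
      fun t : ℝ => k * (‖z‖ ^ 2) ^ n * t ^ (2 * n)) 1 := by
    refine Eventually.of_forall fun t => ?_
    have h := hmin (t • z)
    rw [norm_smul, mul_pow, mul_pow, Real.norm_eq_abs, sq_abs, ← pow_mul t] at h
    simp only [Pi.add_apply, Function.comp, one_smul, one_pow, mul_one]
    linarith
  have h0 := hloc.hasDerivAt_eq_zero hsum
  have hn' : (n : ℝ) ≠ 0 := Nat.cast_ne_zero.2 hn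
  simpa [hk.ne', hn', hn] using h0

lemma exists_pow_le_taylor (i : ℕ) : ∃ C : ℝ, 0 ≤ C ∧ ∀ X Y : ℝ, 0 ≤ X → 0 ≤ Y → Y ≤ 4 * X →
    Y ^ (i + 2) ≤ X ^ (i + 2) + (i + 2) * X ^ (i + 1) * (Y - X) + C * X ^ i * (Y - X) ^ 2 := by
  induction i with
  | zero => exact ⟨1, zero_le_one, fun X Y _ _ _ => by norm_num; nlinarith⟩
  | succ i ih =>
    obtain ⟨C, hC, h⟩ := ih
    refine ⟨4 * C + (i + 2), by positivity, fun X Y hX hY hXY => ?_⟩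
    have h1 := mul_le_mul_of_nonneg_left (h X Y hX hY hXY) hY
    have h2 : Y * (C * X ^ i * (Y - X) ^ 2) ≤ 4 * X * (C * X ^ i * (Y - X) ^ 2) := by gcongr
    push_cast
    calc Y ^ (i + 1 + 2) = Y * Y ^ (i + 2) := by ring
      _ ≤ _ := h1
      _ = Y * (X ^ (i + 2) + (i + 2) * X ^ (i + 1) * (Y - X)) + Y * (C * X ^ i * (Y - X) ^ 2) := by
        ring
      _ ≤ Y * (X ^ (i + 2) + (i + 2) * X ^ (i + 1) * (Y - X)) +
          4 * X * (C * X ^ i * (Y - X) ^ 2) := by gcongr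
      _ = _ := by ring

lemma exists_norm_pow_le_taylor (i : ℕ) : ∃ C : ℝ, 0 < C ∧
    ∀ z ζ : EuclideanSpace ℝ (Fin N), ‖ζ‖ ≤ ‖z‖ →
      (‖z - ζ‖ ^ 2) ^ (i + 2) - (‖z‖ ^ 2) ^ (i + 2) ≤
        -(2 * (i + 2) * (‖z‖ ^ 2) ^ (i + 1)) * inner ℝ z ζ +
          C * (‖z‖ ^ 2) ^ (i + 1) * ‖ζ‖ ^ 2 := by
  obtain ⟨C, hC, h⟩ := exists_pow_le_taylor i
  refine ⟨(i + 2) + 9 * C, by positivity, fun z ζ hζ => ?_⟩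
  have hle : ‖z - ζ‖ ≤ 2 * ‖z‖ := (norm_sub_le z ζ).trans (by linarith)
  have h4 : ‖z - ζ‖ ^ 2 ≤ 4 * ‖z‖ ^ 2 := by
    nlinarith [norm_nonneg (z - ζ), norm_nonneg z]
  have hmain := h (‖z‖ ^ 2) (‖z - ζ‖ ^ 2) (by positivity) (by positivity) h4
  have hexp : ‖z - ζ‖ ^ 2 - ‖z‖ ^ 2 = -2 * inner ℝ z ζ + ‖ζ‖ ^ 2 := by
    rw [norm_sub_sq_real]; ring
  have hsq : (‖z - ζ‖ ^ 2 - ‖z‖ ^ 2) ^ 2 ≤ 9 * ‖z‖ ^ 2 * ‖ζ‖ ^ 2 := by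
    have h5 := abs_real_inner_le_norm z ζ
    have h6 : |‖z - ζ‖ ^ 2 - ‖z‖ ^ 2| ≤ 3 * (‖z‖ * ‖ζ‖) := by
      rw [hexp]
      have h7 := abs_le.1 h5
      rw [abs_le]
      constructor <;> nlinarith [norm_nonneg z, norm_nonneg ζ]
    calc (‖z - ζ‖ ^ 2 - ‖z‖ ^ 2) ^ 2 = |‖z - ζ‖ ^ 2 - ‖z‖ ^ 2| ^ 2 := (sq_abs _).symm
      _ ≤ (3 * (‖z‖ * ‖ζ‖)) ^ 2 := by gcongr
      _ = _ := by ring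
  have h8 : C * (‖z‖ ^ 2) ^ i * (‖z - ζ‖ ^ 2 - ‖z‖ ^ 2) ^ 2 ≤
      C * (‖z‖ ^ 2) ^ i * (9 * ‖z‖ ^ 2 * ‖ζ‖ ^ 2) := by gcongr
  calc (‖z - ζ‖ ^ 2) ^ (i + 2) - (‖z‖ ^ 2) ^ (i + 2)
      ≤ (i + 2) * (‖z‖ ^ 2) ^ (i + 1) * (‖z - ζ‖ ^ 2 - ‖z‖ ^ 2) +
        C * (‖z‖ ^ 2) ^ i * (9 * ‖z‖ ^ 2 * ‖ζ‖ ^ 2) := by linarith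
    _ = _ := by rw [hexp]; ring

lemma nonlocalPLap_le {q h : ℝ} (hq : 0 < q) (hh : 0 < h) {w : EuclideanSpace ℝ (Fin N) → ℝ}
    (hw : Continuous w) {x : EuclideanSpace ℝ (Fin N)} {g : EuclideanSpace ℝ (Fin N) → ℝ}
    (hg : Integrable g (ballMeasure N))
    (hle : ∀ᵐ e ∂(ballMeasure N), signedPow q ((w (x + h • e) - w x) / h) ≤ g e) :
    nonlocalPLap q h w x ≤ (∫ e, g e ∂(ballMeasure N)) / h := by
  have hs := continuous_signedPow hq
  rw [nonlocalPLap]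
  exact div_le_div_of_nonneg_right
    (integral_mono_ae (integrable_ballMeasure_of_continuous (by fun_prop)) hg hle) hh.le

lemma nonlocalPLap_le_of_norm_le {q k h : ℝ} (hq : 0 < q) (hk : 0 < k) (i : ℕ)
    {w : EuclideanSpace ℝ (Fin N) → ℝ} (hw : Continuous w) {x z : EuclideanSpace ℝ (Fin N)}
    (hh : 0 < h) (hz : ‖z‖ ≤ h)
    (htouch : ∀ ζ, w (x + ζ) - w x ≤ k * (‖z - ζ‖ ^ 2) ^ (i + 2) - k * (‖z‖ ^ 2) ^ (i + 2)) :
    nonlocalPLap q h w x ≤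
      (ballMeasure N).real Set.univ * (k * 4 ^ (i + 2)) ^ q * h ^ ((2 * i + 3) * q - 1) := by
  have hb : ∀ᵐ e ∂(ballMeasure N), signedPow q ((w (x + h • e) - w x) / h) ≤
      (k * 4 ^ (i + 2)) ^ q * h ^ ((2 * i + 3) * q) := by
    filter_upwards [ae_ballMeasure_norm_le N] with e he
    have h1 : ‖z - h • e‖ ≤ 2 * h := by
      refine (norm_sub_le _ _).trans ?_
      rw [norm_smul, Real.norm_of_nonneg hh.le]
      nlinarith
    have h2 : (w (x + h • e) - w x) / h ≤ k * 4 ^ (i + 2) * h ^ (2 * i + 3) := by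
      rw [div_le_iff₀ hh]
      calc w (x + h • e) - w x ≤ k * (‖z - h • e‖ ^ 2) ^ (i + 2) - k * (‖z‖ ^ 2) ^ (i + 2) :=
            htouch _
        _ ≤ k * (‖z - h • e‖ ^ 2) ^ (i + 2) := sub_le_self _ (by positivity)
        _ ≤ k * ((2 * h) ^ 2) ^ (i + 2) := by gcongr
        _ = k * 4 ^ (i + 2) * h ^ (2 * i + 3) * h := by
            rw [mul_pow, mul_pow]; ring
    refine (signedPow_mono hq h2).trans (le_of_eq ?_)
    rw [signedPow_of_nonneg hq (by positivity), Real.mul_rpow (by positivity) (by positivity),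
      ← Real.rpow_natCast h, ← Real.rpow_mul hh.le]
    push_cast
    rfl
  refine (nonlocalPLap_le hq hh hw (integrable_const _) hb).trans (le_of_eq ?_)
  rw [integral_const, smul_eq_mul, Real.rpow_sub_one hh.ne']
  ring

/-- A function touched from above by a translate of `k * ‖·‖ ^ (2 * i + 4)` has nonlocal
`(q + 1)`-Laplacian bounded above uniformly in the scale, if the power is large enough. -/
lemma exists_nonlocalPLap_le (N : ℕ) {q k : ℝ} (hq : 0 < q) (hk : 0 < k) {i : ℕ}
    (hi : 1 < (2 * i + 3) * q) :
    ∃ C : ℝ, ∀ (w : EuclideanSpace ℝ (Fin N) → ℝ) (x z : EuclideanSpace ℝ (Fin N)) (h : ℝ),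
      Continuous w → ‖z‖ ≤ 1 → 0 < h → h ≤ 1 →
      (∀ ζ, w (x + ζ) - w x ≤ k * (‖z - ζ‖ ^ 2) ^ (i + 2) - k * (‖z‖ ^ 2) ^ (i + 2)) →
      nonlocalPLap q h w x ≤ C := by
  obtain ⟨T, hT0, hT⟩ := exists_norm_pow_le_taylor (N := N) i
  obtain ⟨S, hS0, hS⟩ := exists_abs_signedPow_sub_le hq (mul_pos hk hT0)
  obtain ⟨J, hJ0, hJ⟩ := exists_integral_abs_inner_rpow N hq
  set V : ℝ := (ballMeasure N).real Set.univ
  have hV : 0 ≤ V := measureReal_nonneg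
  set m : ℝ := 2 * (i + 2) * k with hm
  have hm0 : 0 < m := by positivity
  refine ⟨max (V * (k * 4 ^ (i + 2)) ^ q) (S * (k * T) * (m ^ (q - 1) * J + V)),
    fun w x z h hw hz hh hh1 htouch => ?_⟩
  rcases le_or_gt ‖z‖ h with hzh | hzh
  · refine le_max_of_le_left ((nonlocalPLap_le_of_norm_le hq hk i hw hh hzh htouch).trans ?_)
    exact mul_le_of_le_one_right (by positivity)
      (Real.rpow_le_one hh.le hh1 (by linarith))
  refine le_max_of_le_right ?_
  have hz0 : 0 < ‖z‖ := hh.trans hzh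
  set X : ℝ := (‖z‖ ^ 2) ^ (i + 1) with hX
  have hX0 : 0 < X := by positivity
  have hX1 : X ≤ 1 := pow_le_one₀ (by positivity) (pow_le_one₀ hz0.le hz)
  set a : EuclideanSpace ℝ (Fin N) := (-(m * X)) • z with ha
  have ha0 : a ≠ 0 := smul_ne_zero (by simp [hm0.ne', hX0.ne']) (norm_pos_iff.1 hz0)
  have han : ‖a‖ = m * ‖z‖ ^ (2 * i + 3 : ℝ) := by
    have hpow : ‖z‖ ^ (2 * i + 3 : ℝ) = X * ‖z‖ := by
      rw [hX, ← pow_mul, ← pow_succ, ← Real.rpow_natCast]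
      congr 1
      push_cast
      ring
    rw [ha, norm_smul, norm_neg, Real.norm_of_nonneg (by positivity), hpow, mul_assoc]
  have hXpow : X = ‖z‖ ^ (2 * i + 2 : ℝ) := by
    rw [hX, ← pow_mul, ← Real.rpow_natCast]
    congr 1
    push_cast
    ring
  set D : ℝ := k * T * X with hD
  have hD0 : 0 ≤ D := by positivity
  have hDle : D ≤ k * T := mul_le_of_le_one_right (by positivity) hX1
  have hb : ∀ᵐ e ∂(ballMeasure N), signedPow q ((w (x + h • e) - w x) / h) ≤
      signedPow q (inner ℝ a e) + S * (|inner ℝ a e| ^ (q - 1) + 1) * (h * D) := by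
    filter_upwards [ae_ballMeasure_norm_le N, ae_inner_ne_zero ha0] with e he hae
    have hζ : ‖h • e‖ ≤ h := by
      rw [norm_smul, Real.norm_of_nonneg hh.le]
      exact mul_le_of_le_one_right hh.le he
    have h1 := mul_le_mul_of_nonneg_left (hT z (h • e) (hζ.trans hzh.le)) hk.le
    have h2 : T * X * ‖h • e‖ ^ 2 ≤ T * X * h ^ 2 := by gcongr
    have h3 : (w (x + h • e) - w x) / h ≤ inner ℝ a e + h * D := by
      rw [div_le_iff₀ hh, ha, real_inner_smul_left, hD]
      rw [real_inner_smul_right] at h1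
      have h4 := htouch (h • e)
      rw [hm]
      nlinarith [mul_le_mul_of_nonneg_left h2 hk.le]
    have hhD : |h * D| = h * D := abs_of_nonneg (by positivity)
    have h5 := hS (inner ℝ a e) (h * D) hae (by rw [hhD]; nlinarith)
    rw [hhD] at h5
    linarith [signedPow_mono hq h3, (abs_le.1 h5).2]
  have hs := continuous_signedPow hq
  have hi1 : Integrable (fun e => signedPow q (inner ℝ a e)) (ballMeasure N) :=
    integrable_ballMeasure_of_continuous (by fun_prop)
  have hi2 : Integrable (fun e => |inner ℝ a e| ^ (q - 1) + 1) (ballMeasure N) :=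
    (hJ a ha0).1.add (integrable_const _)
  refine (nonlocalPLap_le hq hh hw (hi1.add ((hi2.const_mul S).mul_const (h * D))) hb).trans ?_
  have hval : ∫ e, (|inner ℝ a e| ^ (q - 1) + 1) ∂(ballMeasure N) = ‖a‖ ^ (q - 1) * J + V := by
    rw [integral_add (hJ a ha0).1 (integrable_const _), (hJ a ha0).2]
    simp [V]
  rw [integral_add' hi1 ((hi2.const_mul S).mul_const (h * D)), integral_signedPow_inner,
    integral_mul_const, integral_const_mul, hval, zero_add]
  have hkey : ‖a‖ ^ (q - 1) * X ≤ m ^ (q - 1) := by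
    rw [han, Real.mul_rpow hm0.le (by positivity), ← Real.rpow_mul hz0.le, hXpow, mul_assoc,
      ← Real.rpow_add hz0]
    exact mul_le_of_le_one_right (by positivity)
      (Real.rpow_le_one hz0.le hz (by nlinarith))
  calc S * (‖a‖ ^ (q - 1) * J + V) * (h * D) / h
      = S * (k * T) * (‖a‖ ^ (q - 1) * X * J + V * X) := by rw [hD]; field_simp
    _ ≤ S * (k * T) * (m ^ (q - 1) * J + V) := by
        gcongr
        exact mul_le_of_le_one_right hV hX1

end InfConvolution

section WeakInequality

variable {N : ℕ}

lemma gradient_eq_zero_of_notMem_tsupport {f : EuclideanSpace ℝ (Fin N) → ℝ}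
    {x : EuclideanSpace ℝ (Fin N)} (hx : x ∉ tsupport f) : gradient f x = 0 := by
  have : fderiv ℝ f x = 0 := by
    by_contra hne
    exact hx (support_fderiv_subset ℝ hne)
  simp [gradient, this]

lemma integrable_prod_ballMeasure
    {g : EuclideanSpace ℝ (Fin N) × EuclideanSpace ℝ (Fin N) → ℝ} (hg : Continuous g)
    {S : Set (EuclideanSpace ℝ (Fin N))} (hS : IsCompact S)
    (h0 : ∀ x e, ‖e‖ ≤ 1 → x ∉ S → g (x, e) = 0) :
    Integrable g (volume.prod (ballMeasure N)) := by
  have h1 : IntegrableOn g (S ×ˢ closedBall 0 1) (volume.prod volume) :=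
    hg.continuousOn.integrableOn_compact (hS.prod (isCompact_closedBall 0 1))
  have h2 : IntegrableOn g (Set.univ ×ˢ closedBall 0 1) (volume.prod volume) := by
    refine h1.of_forall_sdiff_eq_zero (MeasurableSet.univ.prod measurableSet_closedBall) ?_
    rintro ⟨x, e⟩ ⟨hx, hxS⟩
    have he : ‖e‖ ≤ 1 := by simpa using hx.2
    exact h0 x e he fun hxS' => hxS ⟨hxS', hx.2⟩
  rwa [IntegrableOn, ← Measure.prod_restrict, Measure.restrict_univ] at h2

lemma ae_prod_ballMeasure_norm_le (N : ℕ) :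
    ∀ᵐ z ∂((volume : Measure (EuclideanSpace ℝ (Fin N))).prod (ballMeasure N)), ‖z.2‖ ≤ 1 := by
  have h := Measure.quasiMeasurePreserving_snd
    (μ := (volume : Measure (EuclideanSpace ℝ (Fin N)))) (ν := ballMeasure N)
  exact h.ae (p := fun e => ‖e‖ ≤ 1) (ae_ballMeasure_norm_le N)

lemma continuous_nonlocalPLap {q h : ℝ} (hq : 0 < q) {w : EuclideanSpace ℝ (Fin N) → ℝ}
    (hw : Continuous w) : Continuous (nonlocalPLap q h w) := by
  have hs := continuous_signedPow hq
  refine Continuous.div_const ?_ h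
  exact continuous_parametric_integral_of_continuous (by fun_prop) (isCompact_closedBall 0 1)

lemma notMem_cthickening_imp {φ : EuclideanSpace ℝ (Fin N) → ℝ} {h : ℝ} (hh : 0 < h)
    (hh1 : h ≤ 1) {x e : EuclideanSpace ℝ (Fin N)} (he : ‖e‖ ≤ 1)
    (hx : x ∉ cthickening 1 (tsupport φ)) : φ x = 0 ∧ φ (x + h • e) = 0 := by
  refine ⟨image_eq_zero_of_notMem_tsupport fun hx' => hx (self_subset_cthickening _ hx'),
    image_eq_zero_of_notMem_tsupport fun hx' => hx (mem_cthickening_of_dist_le x _ 1 _ hx' ?_)⟩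
  rw [dist_eq_norm, sub_add_cancel_left, norm_neg, norm_smul, Real.norm_of_nonneg hh.le]
  exact mul_le_one₀ hh1 (norm_nonneg e) he

/-- Summation by parts for the nonlocal `(q + 1)`-Laplacian. -/
lemma integral_mul_nonlocalPLap {q h : ℝ} (hq : 0 < q) (hh : 0 < h) (hh1 : h ≤ 1)
    {w φ : EuclideanSpace ℝ (Fin N) → ℝ} (hw : Continuous w) (hφ : Continuous φ)
    (hcs : HasCompactSupport φ) :
    ∫ x, φ x * nonlocalPLap q h w x = -2⁻¹ * ∫ z, (φ (z.1 + h • z.2) - φ z.1) / h *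
      signedPow q ((w (z.1 + h • z.2) - w z.1) / h) ∂(volume.prod (ballMeasure N)) := by
  have hs := continuous_signedPow hq
  have hS : IsCompact (cthickening 1 (tsupport φ)) := IsCompact.cthickening hcs
  set s : EuclideanSpace ℝ (Fin N) → EuclideanSpace ℝ (Fin N) → ℝ :=
    fun x e => signedPow q ((w (x + h • e) - w x) / h) with hsdef
  have hi1 : Integrable (fun z : _ × _ => φ z.1 * s z.1 z.2) (volume.prod (ballMeasure N)) :=
    integrable_prod_ballMeasure (by fun_prop) hS fun x e he hx => by
      simp [(notMem_cthickening_imp hh hh1 he hx).1]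
  have hi2 : Integrable (fun z : _ × _ => φ (z.1 + h • z.2) * s z.1 z.2)
      (volume.prod (ballMeasure N)) :=
    integrable_prod_ballMeasure (by fun_prop) hS fun x e he hx => by
      simp [(notMem_cthickening_imp hh hh1 he hx).2]
  have hswap : ∫ z, φ z.1 * s z.1 z.2 ∂(volume.prod (ballMeasure N)) =
      -∫ z, φ (z.1 + h • z.2) * s z.1 z.2 ∂(volume.prod (ballMeasure N)) := by
    rw [integral_prod_symm _ hi1, integral_prod_symm _ hi2, ← integral_neg,
      ← integral_ballMeasure_comp (LinearIsometryEquiv.neg ℝ)]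
    refine integral_congr_ae (Eventually.of_forall fun e => ?_)
    simp only [LinearIsometryEquiv.coe_neg]
    rw [← integral_neg, ← integral_add_right_eq_self _ (h • e)]
    refine integral_congr_ae (Eventually.of_forall fun x => ?_)
    simp only [hsdef, smul_neg, add_neg_cancel_right]
    rw [← mul_neg, ← signedPow_neg, ← neg_div, neg_sub]
  have hlhs : ∫ x, φ x * nonlocalPLap q h w x =
      h⁻¹ * ∫ z, φ z.1 * s z.1 z.2 ∂(volume.prod (ballMeasure N)) := by
    rw [integral_prod _ hi1, ← integral_const_mul]
    refine integral_congr_ae (Eventually.of_forall fun x => ?_)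
    simp only [nonlocalPLap, hsdef]
    rw [integral_const_mul]
    ring
  have hrhs : ∫ z, (φ (z.1 + h • z.2) - φ z.1) / h * s z.1 z.2 ∂(volume.prod (ballMeasure N)) =
      h⁻¹ * (∫ z, φ (z.1 + h • z.2) * s z.1 z.2 ∂(volume.prod (ballMeasure N)) -
        ∫ z, φ z.1 * s z.1 z.2 ∂(volume.prod (ballMeasure N))) := by
    rw [← integral_sub hi2 hi1, ← integral_const_mul]
    refine integral_congr_ae (Eventually.of_forall fun z => ?_)
    ring
  rw [hlhs, hrhs]
  linear_combination (2⁻¹ * h⁻¹) * hswap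

lemma tendsto_integral_mul_nonlocalPLap {q c : ℝ} (hq : 0 < q)
    (hc : ∀ ξ η : EuclideanSpace ℝ (Fin N),
      ∫ e, signedPow q (inner ℝ ξ e) * inner ℝ η e ∂(ballMeasure N) =
        c * inner ℝ (‖ξ‖ ^ (q - 1) • ξ) η)
    {φ : EuclideanSpace ℝ (Fin N) → ℝ} (hφ : ContDiff ℝ 1 φ) (hcs : HasCompactSupport φ)
    {v : EuclideanSpace ℝ (Fin N) → EuclideanSpace ℝ (Fin N)} (hv : Continuous v)
    {G : ℝ} (hG : ∀ x, ‖v x‖ ≤ G)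
    {w : ℕ → EuclideanSpace ℝ (Fin N) → ℝ} {h ε : ℕ → ℝ} (hw : ∀ n, Continuous (w n))
    (hh : ∀ n, 0 < h n) (hh1 : ∀ n, h n ≤ 1) (hh0 : Tendsto h atTop (𝓝 0))
    (hε1 : ∀ n, ε n ≤ 1) (hε : Tendsto ε atTop (𝓝 0))
    (happrox : ∀ n x e, ‖e‖ ≤ 1 → |(w n (x + h n • e) - w n x) / h n - inner ℝ (v x) e| ≤ ε n) :
    Tendsto (fun n => ∫ x, φ x * nonlocalPLap q (h n) (w n) x) atTop
      (𝓝 (-2⁻¹ * (c * ∫ x, inner ℝ (‖v x‖ ^ (q - 1) • v x) (gradient φ x)))) := by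
  have hs := continuous_signedPow hq
  have hφc := hφ.continuous
  have hS : IsCompact (cthickening 1 (tsupport φ)) := IsCompact.cthickening hcs
  have hgφ : Continuous (gradient φ) := (contDiff_gradient (m := 0) hφ (by norm_num)).continuous
  obtain ⟨L, hL⟩ := hφ.lipschitzWith_of_hasCompactSupport hcs one_ne_zero
  have hG0 : 0 ≤ G := (norm_nonneg _).trans (hG 0)
  have hlim : Tendsto (fun n => ∫ z, (φ (z.1 + h n • z.2) - φ z.1) / h n *
      signedPow q ((w n (z.1 + h n • z.2) - w n z.1) / h n) ∂(volume.prod (ballMeasure N))) atTop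
      (𝓝 (∫ z, inner ℝ (gradient φ z.1) z.2 * signedPow q (inner ℝ (v z.1) z.2)
        ∂(volume.prod (ballMeasure N)))) := by
    have hball := ae_prod_ballMeasure_norm_le N
    refine tendsto_integral_of_dominated_convergence
      (fun z => (cthickening 1 (tsupport φ)).indicator (fun _ => L * (G + 1) ^ q) z.1)
      (fun n => ?_) ?_ (fun n => ?_) ?_
    · have := hw n
      exact (by fun_prop : Continuous _).aestronglyMeasurable
    · refine Integrable.comp_fst ?_ _
      exact (integrable_indicator_iff isClosed_cthickening.measurableSet).2
        (integrableOn_const hS.measure_lt_top.ne)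
    · filter_upwards [hball] with z hz
      by_cases hzS : z.1 ∈ cthickening 1 (tsupport φ)
      · rw [Set.indicator_of_mem hzS, norm_mul, Real.norm_eq_abs, Real.norm_eq_abs,
          abs_signedPow hq]
        have h1 : |(φ (z.1 + h n • z.2) - φ z.1) / h n| ≤ L := by
          rw [abs_div, abs_of_pos (hh n), div_le_iff₀ (hh n)]
          have := hL.dist_le_mul (z.1 + h n • z.2) z.1
          rw [Real.dist_eq, dist_eq_norm, add_sub_cancel_left, norm_smul,
            Real.norm_of_nonneg (hh n).le] at this
          refine this.trans ?_
          gcongr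
          exact mul_le_of_le_one_right (hh n).le hz
        have h2 : |(w n (z.1 + h n • z.2) - w n z.1) / h n| ≤ G + 1 := by
          have h3 := happrox n z.1 z.2 hz
          have h4 : |inner ℝ (v z.1) z.2| ≤ G :=
            (abs_real_inner_le_norm _ _).trans
              ((mul_le_of_le_one_right (norm_nonneg _) hz).trans (hG _))
          have h5 := abs_sub_abs_le_abs_sub ((w n (z.1 + h n • z.2) - w n z.1) / h n)
            (inner ℝ (v z.1) z.2)
          linarith [hε1 n]
        gcongr
      · rw [Set.indicator_of_notMem hzS, (notMem_cthickening_imp (hh n) (hh1 n) hz hzS).1,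
          (notMem_cthickening_imp (hh n) (hh1 n) hz hzS).2]
        simp
    · filter_upwards [hball] with z hz
      refine Tendsto.mul ?_ ((hs.tendsto _).comp ?_)
      · have hd : HasDerivAt (fun t : ℝ => φ (z.1 + t • z.2)) (inner ℝ (gradient φ z.1) z.2) 0 := by
          rw [inner_gradient_left]
          have hl : HasDerivAt (fun t : ℝ => z.1 + t • z.2) z.2 0 := by
            simpa using ((hasDerivAt_id (0 : ℝ)).smul_const z.2).const_add z.1
          have hf : HasFDerivAt φ (fderiv ℝ φ z.1) (z.1 + (0 : ℝ) • z.2) := by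
            simpa using (hφ.differentiable one_ne_zero z.1).hasFDerivAt
          exact hf.comp_hasDerivAt 0 hl
        have hd' := hd.tendsto_slope_zero.comp
          (tendsto_nhdsWithin_iff.2 ⟨hh0, Eventually.of_forall fun n => (hh n).ne'⟩)
        refine hd'.congr fun n => ?_
        simp [div_eq_inv_mul]
      · rw [tendsto_iff_norm_sub_tendsto_zero]
        exact squeeze_zero (fun n => norm_nonneg _) (fun n => happrox n z.1 z.2 hz) hε
  have hval : ∫ z, inner ℝ (gradient φ z.1) z.2 * signedPow q (inner ℝ (v z.1) z.2)
      ∂(volume.prod (ballMeasure N)) =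
      c * ∫ x, inner ℝ (‖v x‖ ^ (q - 1) • v x) (gradient φ x) := by
    rw [integral_prod, ← integral_const_mul]
    · refine integral_congr_ae (Eventually.of_forall fun x => ?_)
      simp only [← hc, mul_comm]
    · exact integrable_prod_ballMeasure (by fun_prop) hcs fun x e _ hx => by
        simp [gradient_eq_zero_of_notMem_tsupport hx]
  rw [← hval]
  refine (hlim.const_mul (-2⁻¹)).congr fun n => ?_
  rw [integral_mul_nonlocalPLap hq (hh n) (hh1 n) (hw n) hφc hcs]

end WeakInequality

section Supersolution

variable {N : ℕ}

lemma hasCompactSupport_gradient {f : EuclideanSpace ℝ (Fin N) → ℝ} (hf : HasCompactSupport f) :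
    HasCompactSupport (gradient f) :=
  (hf.fderiv ℝ).comp_left (map_zero _)

lemma abs_sub_sub_inner_le_of_touching {ρ w : EuclideanSpace ℝ (Fin N) → ℝ}
    {Z : EuclideanSpace ℝ (Fin N) → EuclideanSpace ℝ (Fin N)} {K : NNReal} {r : ℝ}
    (hρ : Differentiable ℝ ρ) (hK : LipschitzWith K (gradient ρ)) (hZ : ∀ x, ‖Z x‖ ≤ r)
    (hT : ∀ x ζ, w (x + ζ) - w x ≤ ρ (x + Z x + ζ) - ρ (x + Z x))
    (x ζ : EuclideanSpace ℝ (Fin N)) :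
    |w (x + ζ) - w x - inner ℝ (gradient ρ x) ζ| ≤ K * (r + 2 * ‖ζ‖) * ‖ζ‖ := by
  have hinner : ∀ a b ζ : EuclideanSpace ℝ (Fin N),
      |inner ℝ (gradient ρ a) ζ - inner ℝ (gradient ρ b) ζ| ≤ K * ‖a - b‖ * ‖ζ‖ := by
    intro a b ζ
    rw [← inner_sub_left]
    refine (abs_real_inner_le_norm _ _).trans ?_
    gcongr
    simpa [dist_eq_norm] using hK.dist_le_mul a b
  have hup : ∀ x ζ, w (x + ζ) - w x ≤ inner ℝ (gradient ρ x) ζ + K * (r + ‖ζ‖) * ‖ζ‖ := by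
    intro x ζ
    have h1 := (abs_le.1 (abs_sub_sub_inner_gradient_le hρ hK (x + Z x) ζ)).2
    have h2 := (abs_le.1 (hinner (x + Z x) x ζ)).2
    rw [add_sub_cancel_left] at h2
    have h3 : K * ‖Z x‖ * ‖ζ‖ ≤ K * r * ‖ζ‖ := by gcongr; exact hZ x
    nlinarith [hT x ζ]
  have h1 := hup x ζ
  have h2 := hup (x + ζ) (-ζ)
  have h3 := (abs_le.1 (hinner (x + ζ) x ζ)).1
  rw [add_sub_cancel_left] at h3
  rw [add_neg_cancel_right, inner_neg_right, norm_neg] at h2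
  have h4 : 0 ≤ K * ‖ζ‖ * ‖ζ‖ := by positivity
  rw [abs_le]
  constructor <;> nlinarith

lemma continuous_of_touching {ρ w : EuclideanSpace ℝ (Fin N) → ℝ}
    {Z : EuclideanSpace ℝ (Fin N) → EuclideanSpace ℝ (Fin N)} {L : NNReal}
    (hL : LipschitzWith L ρ)
    (hT : ∀ x ζ, w (x + ζ) - w x ≤ ρ (x + Z x + ζ) - ρ (x + Z x)) : Continuous w := by
  have hle : ∀ x y, w y - w x ≤ L * dist x y := by
    intro x y
    have h1 := hT x (y - x)
    have h2 := hL.dist_le_mul (x + Z x + (y - x)) (x + Z x)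
    rw [add_sub_cancel] at h1
    rw [Real.dist_eq, dist_eq_norm, add_sub_cancel_left, ← dist_eq_norm, dist_comm y x] at h2
    exact h1.trans ((le_abs_self _).trans h2)
  refine (LipschitzWith.of_dist_le_mul (K := L) fun x y => ?_).continuous
  rw [Real.dist_eq, abs_le]
  have h1 := hle x y
  have h2 := hle y x
  rw [dist_comm] at h2
  constructor <;> linarith

/-- At small scales the nonlocal `p`-Laplacian of a function touched from above by a translate of
`ρ`, and by `k * ‖·‖ ^ (2 * i + 4)` where that translate is critical, is at most a multiple of
`pLap8 p ρ`. -/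
lemma tendsto_max_nonlocalPLap_sub {p c k b : ℝ} (hp : 1 < p) (hk : 0 < k)
    (hc : ∀ ξ η : EuclideanSpace ℝ (Fin N),
      ∫ e, signedPow (p - 1) (inner ℝ ξ e) * inner ℝ η e ∂(ballMeasure N) =
        c * inner ℝ (‖ξ‖ ^ (p - 1 - 1) • ξ) η)
    {ρ w : EuclideanSpace ℝ (Fin N) → ℝ} {K : NNReal} (hρ : ContDiff ℝ 2 ρ)
    (hK : LipschitzWith K (gradient ρ)) (hw : Continuous w) {i : ℕ}
    (hi : 1 < (2 * i + 3) * (p - 1)) {x z : EuclideanSpace ℝ (Fin N)}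
    (hT : ∀ ζ, w (x + ζ) - w x ≤ ρ (x + z + ζ) - ρ (x + z))
    (htouch : ∀ ζ, w (x + ζ) - w x ≤ k * (‖z - ζ‖ ^ 2) ^ (i + 2) - k * (‖z‖ ^ 2) ^ (i + 2))
    (hzero : gradient ρ (x + z) = 0 → z = 0)
    (hcrit : gradient ρ (x + z) = 0 → 0 ≤ b)
    (hsup : gradient ρ (x + z) ≠ 0 → 2⁻¹ * (c * pLap8 p ρ (x + z)) ≤ b) :
    Tendsto (fun h => max (nonlocalPLap (p - 1) h w x - b) 0) (𝓝[>] 0) (𝓝 0) := by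
  have hq : 0 < p - 1 := by linarith
  have key : ∀ g : ℝ → ℝ, ∀ l, Tendsto g (𝓝[>] 0) (𝓝 l) → l ≤ b →
      (∀ h, 0 < h → nonlocalPLap (p - 1) h w x ≤ g h) →
      Tendsto (fun h => max (nonlocalPLap (p - 1) h w x - b) 0) (𝓝[>] 0) (𝓝 0) := by
    intro g l hg hl hle
    have hlim : Tendsto (fun h => max (g h - b) 0) (𝓝[>] 0) (𝓝 0) := by
      have := (hg.sub_const b).max (tendsto_const_nhds (x := (0 : ℝ)))
      rwa [max_eq_right (by linarith)] at this
    refine squeeze_zero' (Eventually.of_forall fun h => le_max_right _ _) ?_ hlim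
    filter_upwards [self_mem_nhdsWithin] with h hh
    exact max_le_max_right 0 (by linarith [hle h hh])
  by_cases hg : gradient ρ (x + z) = 0
  · have hz : ‖z‖ = 0 := by simp [hzero hg]
    refine key _ 0 ?_ (hcrit hg) fun h hh =>
      nonlocalPLap_le_of_norm_le hq hk i hw hh (hz.trans_le hh.le) htouch
    have hcont := (Real.continuous_rpow_const (q := (2 * i + 3) * (p - 1) - 1)
      (by linarith)).tendsto 0
    rw [Real.zero_rpow (by linarith)] at hcont
    simpa using (hcont.mono_left nhdsWithin_le_nhds).const_mul
      ((ballMeasure N).real Set.univ * (k * 4 ^ (i + 2)) ^ (p - 1))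
  · refine key _ _ (tendsto_nonlocalPLap hp hc hρ hK hg) (hsup hg) fun h hh => ?_
    have hs := continuous_signedPow hq
    have hρc := hρ.continuous
    refine nonlocalPLap_le hq hh hw (integrable_ballMeasure_of_continuous (by fun_prop))
      (Eventually.of_forall fun e => signedPow_mono hq ?_)
    exact div_le_div_of_nonneg_right (hT _) hh.le

lemma exists_approximate_supersolution {p c : ℝ} (hp : 1 < p) (hc0 : 0 < c)
    (hc : ∀ ξ η : EuclideanSpace ℝ (Fin N),
      ∫ e, signedPow (p - 1) (inner ℝ ξ e) * inner ℝ η e ∂(ballMeasure N) =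
        c * inner ℝ (‖ξ‖ ^ (p - 1 - 1) • ξ) η)
    {ρ f φ : EuclideanSpace ℝ (Fin N) → ℝ} (hρ : ContDiff ℝ 2 ρ) (hρcs : HasCompactSupport ρ)
    (hf : Continuous f) (hfcs : HasCompactSupport f) (hφ : Continuous φ)
    (hφcs : HasCompactSupport φ) (hφ0 : ∀ x, 0 ≤ φ x) {r₀ : ℝ} (hr₀ : 0 < r₀)
    (hcrit : ∀ x z, φ x ≠ 0 → ‖z‖ ≤ r₀ → gradient ρ (x + z) = 0 → 0 ≤ f (x + z))
    (hsup : ∀ x z, φ x ≠ 0 → ‖z‖ ≤ r₀ → gradient ρ (x + z) ≠ 0 →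
      pLap8 p ρ (x + z) ≤ f (x + z)) {ε : ℝ} (hε : 0 < ε) :
    ∃ (w : EuclideanSpace ℝ (Fin N) → ℝ) (h : ℝ), Continuous w ∧ 0 < h ∧ h ≤ ε ∧
      (∀ x e, ‖e‖ ≤ 1 → |(w (x + h • e) - w x) / h - inner ℝ (gradient ρ x) e| ≤ ε) ∧
      ∫ x, φ x * nonlocalPLap (p - 1) h w x ≤ 2⁻¹ * c * (∫ x, φ x * f x) + ε := by
  have hq : 0 < p - 1 := by linarith
  have hρd : Differentiable ℝ ρ := hρ.differentiable (by norm_num)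
  obtain ⟨K, hK⟩ := (contDiff_gradient (m := 1) hρ (by norm_num)).lipschitzWith_of_hasCompactSupport
    (hasCompactSupport_gradient hρcs) one_ne_zero
  obtain ⟨L, hL⟩ := hρ.lipschitzWith_of_hasCompactSupport hρcs (by norm_num)
  obtain ⟨i, hi⟩ : ∃ i : ℕ, 1 < (2 * i + 3) * (p - 1) := by
    obtain ⟨i, hi⟩ := exists_nat_gt (1 / (p - 1))
    rw [div_lt_iff₀ hq] at hi
    exact ⟨i, by nlinarith [(Nat.cast_nonneg i : (0 : ℝ) ≤ i)]⟩
  have hφi : Integrable φ := hφ.integrable_of_hasCompactSupport hφcs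
  set A : ℝ := ∫ x, φ x
  have hA : 0 ≤ A := integral_nonneg hφ0
  set η : ℝ := ε / (c * (A + 1)) with hη
  have hη0 : 0 < η := by positivity
  have hηA : 2⁻¹ * c * (η * A) ≤ ε / 2 := by
    have : c * (η * A) = ε * (A / (A + 1)) := by rw [hη]; field_simp
    have h1 : A / (A + 1) ≤ 1 := (div_le_one (by linarith)).2 (by linarith)
    nlinarith
  obtain ⟨δ, hδ, hunif⟩ := Metric.uniformContinuous_iff.1
    (hfcs.uniformContinuous_of_continuous hf) η hη0
  set θ : ℝ := ε / (3 * (K + 1)) with hθ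
  have hθ0 : 0 < θ := by positivity
  have hKθ : K * (3 * θ) ≤ ε := by
    have : K * (3 * θ) = ε * (K / (K + 1)) := by rw [hθ]; field_simp
    have h1 : (K : ℝ) / (K + 1) ≤ 1 := (div_le_one (by positivity)).2 (by linarith)
    nlinarith
  set r : ℝ := min (min (δ / 2) r₀) (min 1 θ)
  have hr : 0 < r := by positivity
  have hrδ : r < δ := ((min_le_left _ _).trans (min_le_left _ _)).trans_lt (by linarith)
  have hrr₀ : r ≤ r₀ := (min_le_left _ _).trans (min_le_right _ _)
  have hr1 : r ≤ 1 := (min_le_right _ _).trans (min_le_left _ _)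
  have hrθ : r ≤ θ := (min_le_right _ _).trans (min_le_right _ _)
  obtain ⟨k, hk, w, Z, hwZ, hwle, hZ⟩ :=
    exists_infConvolution hρ.continuous hρcs (n := i + 2) (by lia) hr
  have hT : ∀ x ζ, w (x + ζ) - w x ≤ ρ (x + Z x + ζ) - ρ (x + Z x) := by
    intro x ζ
    have h1 := hwle (x + ζ) (Z x)
    rw [add_right_comm] at h1
    linarith [hwZ x]
  have htouch : ∀ x ζ, w (x + ζ) - w x ≤
      k * (‖Z x - ζ‖ ^ 2) ^ (i + 2) - k * (‖Z x‖ ^ 2) ^ (i + 2) := by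
    intro x ζ
    have h1 := hwle (x + ζ) (Z x - ζ)
    rw [add_add_sub_cancel] at h1
    linarith [hwZ x]
  have hw : Continuous w := continuous_of_touching hL hT
  obtain ⟨C, hC⟩ := exists_nonlocalPLap_le N hq hk hi
  set B : EuclideanSpace ℝ (Fin N) → ℝ := fun x => 2⁻¹ * c * (f x + η) with hB
  have hBc : Continuous B := by fun_prop
  have hNc : ∀ h, Continuous (nonlocalPLap (p - 1) h w) := fun h => continuous_nonlocalPLap hq hw
  have hlim : Tendsto (fun h => ∫ x, φ x * max (nonlocalPLap (p - 1) h w x - B x) 0) (𝓝[>] 0)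
      (𝓝 (∫ _ : EuclideanSpace ℝ (Fin N), (0 : ℝ))) := by
    refine tendsto_integral_filter_of_dominated_convergence
      (fun x => φ x * max (C - B x) 0) (Eventually.of_forall fun h => ?_) ?_ ?_ ?_
    · have := hNc h
      exact (by fun_prop : Continuous _).aestronglyMeasurable
    · filter_upwards [Ioo_mem_nhdsGT (zero_lt_one' ℝ)] with h hh
      refine Eventually.of_forall fun x => ?_
      rw [Real.norm_of_nonneg (mul_nonneg (hφ0 x) (le_max_right _ _))]
      have := hC w x (Z x) h hw ((hZ x).trans hr1) hh.1 hh.2.le (htouch x)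
      exact mul_le_mul_of_nonneg_left (max_le_max_right 0 (by linarith)) (hφ0 x)
    · exact (by fun_prop : Continuous _).integrable_of_hasCompactSupport hφcs.mul_right
    · refine Eventually.of_forall fun x => ?_
      by_cases hx : φ x = 0
      · simp [hx]
      have hx0 := hZ x
      have hfx : f (x + Z x) ≤ f x + η := by
        have h1 := hunif (a := x + Z x) (b := x) (by
          rw [dist_eq_norm, add_sub_cancel_left]; exact hx0.trans_lt hrδ)
        rw [Real.dist_eq] at h1
        linarith [(abs_lt.1 h1).2]
      have := tendsto_max_nonlocalPLap_sub (b := B x) hp hk hc hρ hK hw hi (hT x) (htouch x)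
        (eq_zero_of_isMin_of_gradient_eq_zero hρd (by lia) hk
          fun z' => (hwZ x).symm.trans_le (hwle x z'))
        (fun hg => mul_nonneg (by positivity)
          ((hcrit x (Z x) hx (hx0.trans hrr₀) hg).trans hfx))
        (fun hg => by
          rw [← mul_assoc]
          exact mul_le_mul_of_nonneg_left ((hsup x (Z x) hx (hx0.trans hrr₀) hg).trans hfx)
            (by positivity))
      simpa using this.const_mul (φ x)
  rw [integral_zero] at hlim
  obtain ⟨h, hhlim, hh⟩ := ((hlim.eventually_le_const (half_pos hε)).and
    (Ioo_mem_nhdsGT (lt_min hε hθ0))).exists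
  have hh0 : 0 < h := hh.1
  have hhε : h ≤ ε := hh.2.le.trans (min_le_left _ _)
  have hhθ : h ≤ θ := hh.2.le.trans (min_le_right _ _)
  refine ⟨w, h, hw, hh0, hhε, fun x e he => ?_, ?_⟩
  · have h1 := abs_sub_sub_inner_le_of_touching hρd hK hZ hT x (h • e)
    have hζ : ‖h • e‖ ≤ h := by
      rw [norm_smul, Real.norm_of_nonneg hh0.le]
      exact mul_le_of_le_one_right hh0.le he
    have h2 : (w (x + h • e) - w x) / h - inner ℝ (gradient ρ x) e =
        (w (x + h • e) - w x - inner ℝ (gradient ρ x) (h • e)) / h := by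
      rw [real_inner_smul_right]
      field_simp
    rw [h2, abs_div, abs_of_pos hh0, div_le_iff₀ hh0]
    refine h1.trans ?_
    have h3 : K * (r + 2 * ‖h • e‖) ≤ ε := by
      refine le_trans ?_ hKθ
      gcongr
      linarith
    exact mul_le_mul h3 hζ (norm_nonneg _) hε.le
  · have hNh := hNc h
    have hi1 : Integrable fun x => φ x * max (nonlocalPLap (p - 1) h w x - B x) 0 :=
      (by fun_prop : Continuous _).integrable_of_hasCompactSupport hφcs.mul_right
    have hi2 : Integrable fun x => φ x * f x :=
      (by fun_prop : Continuous _).integrable_of_hasCompactSupport hφcs.mul_right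
    have hi3 : Integrable fun x => φ x * nonlocalPLap (p - 1) h w x :=
      (by fun_prop : Continuous _).integrable_of_hasCompactSupport hφcs.mul_right
    calc ∫ x, φ x * nonlocalPLap (p - 1) h w x
        ≤ ∫ x, (φ x * max (nonlocalPLap (p - 1) h w x - B x) 0 +
          (2⁻¹ * c * (φ x * f x) + 2⁻¹ * c * (η * φ x))) := by
          refine integral_mono hi3
            (hi1.add ((hi2.const_mul _).add ((hφi.const_mul η).const_mul _))) fun x => ?_
          have h1 := mul_le_mul_of_nonneg_left
            (le_max_left (nonlocalPLap (p - 1) h w x - B x) 0) (hφ0 x)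
          simp only [hB] at h1 ⊢
          linarith
      _ = (∫ x, φ x * max (nonlocalPLap (p - 1) h w x - B x) 0) +
          (2⁻¹ * c * (∫ x, φ x * f x) + 2⁻¹ * c * (η * A)) := by
          rw [integral_add hi1, integral_add (hi2.const_mul _) ((hφi.const_mul η).const_mul _), integral_const_mul,
            integral_const_mul, integral_const_mul]
          exact (hi2.const_mul _).add ((hφi.const_mul η).const_mul _)
      _ ≤ _ := by linarith

/-- A pointwise supersolution inequality for `pLap8`, required only off the critical set, implies
the weak one. -/
lemma integral_inner_add_integral_nonneg {p : ℝ} (hN : 0 < N) (hp : 1 < p)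
    {ρ f φ : EuclideanSpace ℝ (Fin N) → ℝ} (hρ : ContDiff ℝ 2 ρ) (hρcs : HasCompactSupport ρ)
    (hf : Continuous f) (hfcs : HasCompactSupport f) (hφ : ContDiff ℝ 1 φ)
    (hφcs : HasCompactSupport φ) (hφ0 : ∀ x, 0 ≤ φ x) {r₀ : ℝ} (hr₀ : 0 < r₀)
    (hcrit : ∀ x z, φ x ≠ 0 → ‖z‖ ≤ r₀ → gradient ρ (x + z) = 0 → 0 ≤ f (x + z))
    (hsup : ∀ x z, φ x ≠ 0 → ‖z‖ ≤ r₀ → gradient ρ (x + z) ≠ 0 →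
      pLap8 p ρ (x + z) ≤ f (x + z)) :
    0 ≤ (∫ x, inner ℝ (‖gradient ρ x‖ ^ (p - 2) • gradient ρ x) (gradient φ x)) +
      ∫ x, φ x * f x := by
  obtain ⟨c, hc0, hc⟩ := exists_integral_signedPow_inner_mul hN (q := p - 1) (by linarith)
  have hε : ∀ n : ℕ, (0 : ℝ) < 1 / (n + 1) := fun n => by positivity
  have hε1 : ∀ n : ℕ, (1 : ℝ) / (n + 1) ≤ 1 := fun n =>
    (div_le_one (by positivity)).2 (by linarith [(Nat.cast_nonneg n : (0 : ℝ) ≤ n)])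
  choose w h hw hh hhε happrox hle using fun n => exists_approximate_supersolution hp hc0 hc hρ hρcs
    hf hfcs hφ.continuous hφcs hφ0 hr₀ hcrit hsup (hε n)
  have hgc : Continuous (gradient ρ) := (contDiff_gradient (m := 1) hρ (by norm_num)).continuous
  obtain ⟨G, hG⟩ := (hasCompactSupport_gradient hρcs).exists_bound_of_continuous hgc
  have hlim := tendsto_integral_mul_nonlocalPLap (by linarith) hc hφ hφcs hgc hG hw hh
    (fun n => (hhε n).trans (hε1 n))
    (squeeze_zero (fun n => (hh n).le) hhε tendsto_one_div_add_atTop_nhds_zero_nat) hε1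
    tendsto_one_div_add_atTop_nhds_zero_nat happrox
  have hfin := le_of_tendsto_of_tendsto' hlim
    (tendsto_one_div_add_atTop_nhds_zero_nat.const_add (2⁻¹ * c * ∫ x, φ x * f x)) hle
  rw [show p - 1 - 1 = p - 2 by ring] at hfin
  nlinarith

end Supersolution

section Hardy

variable {N : ℕ}

lemma contDiff_mul_of_tsupport_subset {n : WithTop ℕ∞} {χ g : EuclideanSpace ℝ (Fin N) → ℝ}
    {Ω : Set (EuclideanSpace ℝ (Fin N))} (hΩ : IsOpen Ω) (hχ : ContDiff ℝ n χ)
    (hg : ContDiffOn ℝ n g Ω) (hsub : tsupport χ ⊆ Ω) : ContDiff ℝ n fun x => χ x * g x := by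
  rw [contDiff_iff_contDiffAt]
  intro x
  by_cases hx : x ∈ tsupport χ
  · exact hχ.contDiffAt.mul (hg.contDiffAt (hΩ.mem_nhds (hsub hx)))
  · refine (contDiffAt_const (c := (0 : ℝ))).congr_of_eventuallyEq ?_
    filter_upwards [(isClosed_tsupport χ).isOpen_compl.mem_nhds hx] with y hy
    rw [image_eq_zero_of_notMem_tsupport hy, zero_mul]

lemma continuous_mul_of_tsupport_subset {χ g : EuclideanSpace ℝ (Fin N) → ℝ}
    {Ω : Set (EuclideanSpace ℝ (Fin N))} (hΩ : IsOpen Ω) (hχ : Continuous χ)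
    (hg : ContinuousOn g Ω) (hsub : tsupport χ ⊆ Ω) : Continuous fun x => χ x * g x :=
  contDiff_zero.1 (contDiff_mul_of_tsupport_subset hΩ (contDiff_zero.2 hχ)
    (contDiffOn_zero.2 hg) hsub)

lemma exists_contDiff_cutoff {S Ω : Set (EuclideanSpace ℝ (Fin N))} (hS : IsCompact S)
    (hΩ : IsOpen Ω) (hSΩ : S ⊆ Ω) :
    ∃ χ : EuclideanSpace ℝ (Fin N) → ℝ, ContDiff ℝ 2 χ ∧ HasCompactSupport χ ∧ tsupport χ ⊆ Ω ∧
      ∃ V, IsOpen V ∧ S ⊆ V ∧ V ⊆ Ω ∧ ∀ x ∈ V, χ x = 1 := by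
  obtain ⟨T, hT, hST, hTΩ⟩ := exists_compact_between hS hΩ hSΩ
  obtain ⟨χ, h1, h0, -⟩ := exists_contMDiffMap_one_nhds_of_subset_interior
    (modelWithCornersSelf ℝ (EuclideanSpace ℝ (Fin N))) (n := 2) hS.isClosed hST
  have hsub : tsupport χ ⊆ T := closure_minimal
    (fun x hx => by_contra fun hxT => hx (h0 x hxT)) hT.isClosed
  obtain ⟨V, hV, hSV, hV1⟩ := eventually_nhdsSet_iff_exists.1 h1
  refine ⟨χ, χ.contMDiff.contDiff, hT.of_isClosed_subset (isClosed_tsupport χ) hsub,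
    hsub.trans hTΩ, V, hV, hSV, fun x hx => hTΩ (hsub (subset_tsupport χ ?_)), hV1⟩
  simp [Function.mem_support, hV1 x hx]

lemma gradient_congr {f g : EuclideanSpace ℝ (Fin N) → ℝ} {x : EuclideanSpace ℝ (Fin N)}
    (h : f =ᶠ[𝓝 x] g) : gradient f x = gradient g x := by
  rw [gradient, gradient, h.fderiv_eq]

lemma pLap8_congr {p : ℝ} {f g : EuclideanSpace ℝ (Fin N) → ℝ} {x : EuclideanSpace ℝ (Fin N)}
    (h : f =ᶠ[𝓝 x] g) : pLap8 p f x = pLap8 p g x := by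
  have h' : (fun y => ‖gradient f y‖ ^ (p - 2) • gradient f y) =ᶠ[𝓝 x]
      fun y => ‖gradient g y‖ ^ (p - 2) • gradient g y := by
    filter_upwards [h.eventuallyEq_nhds] with y hy
    rw [gradient_congr hy]
  rw [pLap8, pLap8, divg8, divg8, h'.fderiv_eq]

lemma continuous_norm_rpow_smul {p : ℝ} (hp : 1 < p) :
    Continuous fun x : EuclideanSpace ℝ (Fin N) => ‖x‖ ^ (p - 2) • x := by
  rw [continuous_iff_continuousAt]
  intro x
  by_cases hx : x = 0
  · subst hx
    rw [ContinuousAt, smul_zero, tendsto_zero_iff_norm_tendsto_zero]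
    have h : Tendsto (fun x : EuclideanSpace ℝ (Fin N) => ‖x‖ ^ (p - 1)) (𝓝 0) (𝓝 0) := by
      have := ((continuous_norm (E := EuclideanSpace ℝ (Fin N))).rpow_const
        (p := p - 1) fun _ => Or.inr (by linarith)).tendsto 0
      rwa [norm_zero, Real.zero_rpow (by linarith)] at this
    refine h.congr fun y => ?_
    rw [norm_smul, Real.norm_of_nonneg (by positivity),
      ← Real.rpow_add_one' (norm_nonneg y) (by linarith)]
    congr 1
    ring
  · have h := (differentiableAt_norm_rpow_smul (q := p - 1) hx).continuousAt
    rwa [show p - 1 - 1 = p - 2 by ring] at h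

lemma rpow_mul_le_of_young {p α β : ℝ} (hp : 1 < p) (hβ : 0 < p - 1 + β) {t g s R : ℝ}
    (ht : 0 ≤ t) (hg : 0 ≤ g) (hs : 0 ≤ s) (hR : 0 < R) :
    ((p - 1 + β) / p) ^ (p - 1) *
        (p * (t ^ (p - 1) * g ^ (p - 1) * s * R ^ (α - p + 1)) -
          (p - 1 + β) * (t ^ p * g ^ p * R ^ (α - p))) ≤
      s ^ p * R ^ α - ((p - 1 + β) / p) ^ p * (t ^ p * g ^ p * R ^ (α - p)) := by
  have hp0 : 0 < p := by linarith
  set κ : ℝ := (p - 1 + β) / p with hκ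
  have hκ0 : 0 < κ := by positivity
  have hκp : p - 1 + β = p * κ := by rw [hκ]; field_simp
  have hpq : p.HolderConjugate (p / (p - 1)) := Real.HolderConjugate.conjExponent hp
  have hp1 : 0 < p - 1 := by linarith
  set X : ℝ := κ * t * g / R with hX
  have hX0 : 0 ≤ X := by positivity
  have hy := Real.young_inequality_of_nonneg hs (Real.rpow_nonneg hX0 (p - 1)) hpq
  rw [← Real.rpow_mul hX0, mul_div_cancel₀ _ hp1.ne'] at hy
  have hy' : p * (X ^ (p - 1) * s) ≤ s ^ p + (p - 1) * X ^ p := by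
    have := mul_le_mul_of_nonneg_left hy hp0.le
    calc p * (X ^ (p - 1) * s) = p * (s * X ^ (p - 1)) := by ring
      _ ≤ p * (s ^ p / p + X ^ p / (p / (p - 1))) := this
      _ = s ^ p + (p - 1) * X ^ p := by field_simp
  have hXp : ∀ a : ℝ, X ^ a * R ^ α = κ ^ a * (t ^ a * g ^ a * R ^ (α - a)) := by
    intro a
    rw [hX, Real.div_rpow (by positivity) hR.le, Real.mul_rpow (by positivity) hg,
      Real.mul_rpow hκ0.le ht, Real.rpow_sub hR]
    ring
  have hfin := mul_le_mul_of_nonneg_right hy' (Real.rpow_nonneg hR.le α)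
  have e1 := hXp (p - 1)
  have e2 := hXp p
  rw [show α - (p - 1) = α - p + 1 by ring] at e1
  have hκpow : κ ^ p = κ ^ (p - 1) * κ := by
    rw [← Real.rpow_add_one hκ0.ne', sub_add_cancel]
  rw [hκp]
  have e3 : p * (X ^ (p - 1) * s) * R ^ α =
      κ ^ (p - 1) * (p * (t ^ (p - 1) * g ^ (p - 1) * s * R ^ (α - p + 1))) := by
    linear_combination p * s * e1
  have e4 : (s ^ p + (p - 1) * X ^ p) * R ^ α =
      s ^ p * R ^ α + (p - 1) * (κ ^ p * (t ^ p * g ^ p * R ^ (α - p))) := by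
    linear_combination (p - 1) * e2
  rw [e3, e4] at hfin
  have e5 : κ ^ (p - 1) * (p * κ * (t ^ p * g ^ p * R ^ (α - p))) =
      p * (κ ^ p * (t ^ p * g ^ p * R ^ (α - p))) := by rw [hκpow]; ring
  rw [mul_sub, e5]
  linarith

/-- The gradient of `|u| ^ p * ρ ^ γ` tested against the flux `‖∇ρ‖ ^ (p - 2) • ∇ρ`. -/
lemma inner_flux_gradient_le {p γ : ℝ} (hp : 1 < p) {ρ u : EuclideanSpace ℝ (Fin N) → ℝ}
    {x : EuclideanSpace ℝ (Fin N)} (hρ : DifferentiableAt ℝ ρ x) (hu : DifferentiableAt ℝ u x)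
    (hpos : 0 < ρ x) :
    inner ℝ (‖gradient ρ x‖ ^ (p - 2) • gradient ρ x)
        (gradient (fun y => |u y| ^ p * ρ y ^ γ) x) ≤
      p * (|u x| ^ (p - 1) * ‖gradient ρ x‖ ^ (p - 1) * ‖gradient u x‖ * ρ x ^ γ) +
        γ * (|u x| ^ p * ‖gradient ρ x‖ ^ p * ρ x ^ (γ - 1)) := by
  have hd := ((hasDerivAt_abs_rpow (u x) hp).comp_hasFDerivAt x hu.hasFDerivAt).mul
    (hρ.hasFDerivAt.rpow_const (p := γ) (Or.inl hpos.ne'))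
  have hgrad : ∀ v, inner ℝ v (gradient (fun y => |u y| ^ p * ρ y ^ γ) x) =
      |u x| ^ p * (γ * ρ x ^ (γ - 1) * inner ℝ v (gradient ρ x)) +
        ρ x ^ γ * (p * |u x| ^ (p - 2) * u x * inner ℝ v (gradient u x)) := by
    intro v
    rw [inner_gradient_right, inner_gradient_right, inner_gradient_right]
    have hd' : HasFDerivAt (fun y => |u y| ^ p * ρ y ^ γ) _ x := hd
    rw [hd'.fderiv]
    simp
  have hpow : ∀ a : ℝ, 0 ≤ a → a ^ (p - 2) * a = a ^ (p - 1) := fun a ha => by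
    rw [← Real.rpow_add_one' ha (by linarith)]
    congr 1
    ring
  have hpow' : ∀ a : ℝ, 0 ≤ a → a ^ (p - 1) * a = a ^ p := fun a ha => by
    rw [← Real.rpow_add_one' ha (by linarith), sub_add_cancel]
  set g := ‖gradient ρ x‖ with hg
  have hg0 : 0 ≤ g := norm_nonneg _
  have h1 : g ^ (p - 2) * inner ℝ (gradient ρ x) (gradient ρ x) = g ^ p := by
    rw [real_inner_self_eq_norm_sq, ← hg, sq, ← mul_assoc, hpow g hg0, hpow' g hg0]
  have h2 : g ^ (p - 2) * (|u x| ^ (p - 2) * u x * inner ℝ (gradient ρ x) (gradient u x)) ≤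
      g ^ (p - 1) * |u x| ^ (p - 1) * ‖gradient u x‖ := by
    rw [← hpow g hg0, ← hpow _ (abs_nonneg (u x))]
    calc g ^ (p - 2) * (|u x| ^ (p - 2) * u x * inner ℝ (gradient ρ x) (gradient u x))
        = g ^ (p - 2) * |u x| ^ (p - 2) * (u x * inner ℝ (gradient ρ x) (gradient u x)) := by ring
      _ ≤ g ^ (p - 2) * |u x| ^ (p - 2) * (|u x| * (g * ‖gradient u x‖)) := by
          refine mul_le_mul_of_nonneg_left ((le_abs_self _).trans ?_) (by positivity)
          rw [abs_mul]
          exact mul_le_mul_of_nonneg_left (abs_real_inner_le_norm _ _) (abs_nonneg _)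
      _ = _ := by ring
  rw [real_inner_smul_left, hgrad]
  have h3 := mul_le_mul_of_nonneg_left h2 (by positivity : 0 ≤ p * ρ x ^ γ)
  calc _ = γ * (|u x| ^ p * (g ^ (p - 2) * inner ℝ (gradient ρ x) (gradient ρ x)) *
        ρ x ^ (γ - 1)) + p * ρ x ^ γ *
        (g ^ (p - 2) * (|u x| ^ (p - 2) * u x * inner ℝ (gradient ρ x) (gradient u x))) := by ring
    _ ≤ _ := by rw [h1]; linarith

end Hardy

theorem stmt_8 (N : ℕ) (p α β : ℝ) (hp : 1 < p) (hβ : 0 < p - 1 + β)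
    (Ω : Set (EuclideanSpace ℝ (Fin N))) (hΩ : IsOpen Ω)
    (ρ : EuclideanSpace ℝ (Fin N) → ℝ)
    (hρC2 : ContDiffOn ℝ 2 ρ Ω) (hρpos : ∀ x ∈ Ω, 0 < ρ x)
    (hsuper : ∀ x ∈ Ω,
      -(1 / (p - 1 + β)) * pLap8 p ρ x ≥
        ((α + β) / (p - 1 + β)) * ‖gradient ρ x‖ ^ p / ρ x)
    (u : EuclideanSpace ℝ (Fin N) → ℝ)
    (hu : ContDiff ℝ 1 u) (hsupp : HasCompactSupport u) (hΩu : tsupport u ⊆ Ω) :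
    ∫ x in Ω, ‖gradient u x‖ ^ p * ρ x ^ α ∂volume ≥
      ((p - 1 + β) / p) ^ p *
        ∫ x in Ω, |u x| ^ p * ‖gradient ρ x‖ ^ p * ρ x ^ (α - p) ∂volume := by
  have hp0 : 0 < p := by linarith
  rcases Nat.eq_zero_or_pos N with rfl | hN
  · have h0 : ∀ (f : EuclideanSpace ℝ (Fin 0) → ℝ) x, gradient f x = 0 :=
      fun f x => Subsingleton.elim _ _
    simp [h0, Real.zero_rpow hp0.ne']
  have hgu : Continuous (gradient u) := (contDiff_gradient (m := 0) hu (by norm_num)).continuous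
  have hgρ : ContinuousOn (gradient ρ) Ω :=
    (InnerProductSpace.toDual ℝ (EuclideanSpace ℝ (Fin N))).symm.continuous.comp_continuousOn
      (hρC2.continuousOn_fderiv_of_isOpen hΩ (by norm_num))
  have hρd : ∀ x ∈ Ω, DifferentiableAt ℝ ρ x := fun x hx =>
    (hρC2.contDiffAt (hΩ.mem_nhds hx)).differentiableAt (by norm_num)
  have hρpow : ∀ a : ℝ, ContDiffOn ℝ 2 (fun x => ρ x ^ a) Ω := fun a =>
    hρC2.rpow_const_of_ne fun x hx => (hρpos x hx).ne'
  have hgρpow : ContinuousOn (fun x => ‖gradient ρ x‖ ^ p) Ω :=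
    hgρ.norm.rpow_const fun _ _ => Or.inr hp0.le
  -- integrability of the two sides
  have htu : tsupport (fun x => |u x| ^ p) ⊆ tsupport u :=
    tsupport_comp_subset (g := fun t : ℝ => |t| ^ p) (by simp [hp0.ne']) u
  have htgu : tsupport (fun x => ‖gradient u x‖ ^ p) ⊆ tsupport u := by
    refine closure_minimal (fun x hx => by_contra fun hxu => hx ?_) (isClosed_tsupport u)
    simp [gradient_eq_zero_of_notMem_tsupport hxu, hp0.ne']
  have hupC1 : ContDiff ℝ 1 fun x => |u x| ^ p := hu.norm_rpow hp
  have hcsup : HasCompactSupport fun x => |u x| ^ p :=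
    hsupp.of_isClosed_subset (isClosed_tsupport _) htu
  have hcsgu : HasCompactSupport fun x => ‖gradient u x‖ ^ p :=
    hsupp.of_isClosed_subset (isClosed_tsupport _) htgu
  have hI1 : Integrable fun x => ‖gradient u x‖ ^ p * ρ x ^ α :=
    (continuous_mul_of_tsupport_subset hΩ (hgu.norm.rpow_const fun _ => Or.inr hp0.le)
      (hρpow α).continuousOn (htgu.trans hΩu)).integrable_of_hasCompactSupport hcsgu.mul_right
  have hI2 : Integrable fun x => |u x| ^ p * ‖gradient ρ x‖ ^ p * ρ x ^ (α - p) := by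
    simp_rw [mul_assoc]
    exact (continuous_mul_of_tsupport_subset hΩ hupC1.continuous
      (hgρpow.mul (hρpow (α - p)).continuousOn)
      (htu.trans hΩu)).integrable_of_hasCompactSupport hcsup.mul_right
  have hu0 : ∀ x, x ∉ tsupport u → |u x| ^ p = 0 := fun x hx => by
    simp [image_eq_zero_of_notMem_tsupport hx, hp0.ne']
  have hgu0 : ∀ x, x ∉ tsupport u → ‖gradient u x‖ ^ p = 0 := fun x hx => by
    simp [gradient_eq_zero_of_notMem_tsupport hx, hp0.ne']
  rw [ge_iff_le,
    setIntegral_eq_integral_of_forall_compl_eq_zero fun x hx => by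
      rw [hu0 x fun h => hx (hΩu h), zero_mul, zero_mul],
    setIntegral_eq_integral_of_forall_compl_eq_zero fun x hx => by
      rw [hgu0 x fun h => hx (hΩu h), zero_mul]]
  -- localization
  obtain ⟨χ, hχ, hχcs, hχΩ, V, hV, hSV, hVΩ, hχ1⟩ := exists_contDiff_cutoff hsupp hΩ hΩu
  obtain ⟨r₀, hr₀, hr₀V⟩ := hsupp.isCompact.exists_cthickening_subset_open hV hSV
  set f : EuclideanSpace ℝ (Fin N) → ℝ :=
    fun x => χ x * (-(α + β) * ‖gradient ρ x‖ ^ p / ρ x) with hf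
  have hfc : Continuous f := continuous_mul_of_tsupport_subset hΩ hχ.continuous
    ((continuousOn_const.mul hgρpow).div hρC2.continuousOn fun x hx => (hρpos x hx).ne') hχΩ
  set ρ' : EuclideanSpace ℝ (Fin N) → ℝ := fun x => χ x * ρ x with hρ'
  have hρ'C2 : ContDiff ℝ 2 ρ' := contDiff_mul_of_tsupport_subset hΩ hχ hρC2 hχΩ
  set φ : EuclideanSpace ℝ (Fin N) → ℝ := fun x => |u x| ^ p * ρ x ^ (α - p + 1) with hφ
  have hφC1 : ContDiff ℝ 1 φ := contDiff_mul_of_tsupport_subset hΩ hupC1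
    ((hρpow (α - p + 1)).of_le (by norm_num)) (htu.trans hΩu)
  have hφcs : HasCompactSupport φ := hcsup.mul_right
  have hφ0 : ∀ x, x ∉ tsupport u → φ x = 0 := fun x hx => by
    simp only [hφ, hu0 x hx, zero_mul]
  have heq : ∀ x ∈ V, ρ' =ᶠ[𝓝 x] ρ := fun x hx => by
    filter_upwards [hV.mem_nhds hx] with y hy
    simp only [hρ', hχ1 y hy, one_mul]
  have hfV : ∀ x ∈ V, f x = -(α + β) * ‖gradient ρ x‖ ^ p / ρ x := fun x hx => by
    simp only [hf, hχ1 x hx, one_mul]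
  have hnear : ∀ x z, φ x ≠ 0 → ‖z‖ ≤ r₀ → x + z ∈ V := fun x z hx hz =>
    hr₀V (mem_cthickening_of_dist_le _ x _ _ (by_contra fun h => hx (hφ0 x h)) (by simpa using hz))
  have hweak := integral_inner_add_integral_nonneg hN hp hρ'C2 hχcs.mul_right hfc hχcs.mul_right
    hφC1 hφcs (fun x => by
      by_cases hx : x ∈ Ω
      · have := hρpos x hx
        positivity
      · exact (hφ0 x fun h => hx (hΩu h)).ge) hr₀
    (fun x z hx hz hg => by
      rw [gradient_congr (heq _ (hnear x z hx hz))] at hg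
      simp [hfV _ (hnear x z hx hz), hg, hp0.ne'])
    (fun x z hx hz _ => by
      have hxV := hnear x z hx hz
      rw [pLap8_congr (heq _ hxV), hfV _ hxV]
      have h := mul_le_mul_of_nonneg_left (hsuper _ (hVΩ hxV)) hβ.le
      have e1 : (p - 1 + β) * ((α + β) / (p - 1 + β) * ‖gradient ρ (x + z)‖ ^ p / ρ (x + z)) =
          (α + β) * ‖gradient ρ (x + z)‖ ^ p / ρ (x + z) := by field_simp
      have e2 : (p - 1 + β) * (-(1 / (p - 1 + β)) * pLap8 p ρ (x + z)) = -pLap8 p ρ (x + z) := by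
        field_simp
      rw [e1, e2] at h
      rw [neg_mul, neg_div]
      linarith)
  -- pointwise comparison
  have hgφ : Continuous (gradient φ) := (contDiff_gradient (m := 0) hφC1 (by norm_num)).continuous
  have hflux : Continuous fun x => ‖gradient ρ' x‖ ^ (p - 2) • gradient ρ' x :=
    (continuous_norm_rpow_smul hp).comp
      (contDiff_gradient (m := 1) hρ'C2 (by norm_num)).continuous
  have hJ1 : Integrable fun x =>
      inner ℝ (‖gradient ρ' x‖ ^ (p - 2) • gradient ρ' x) (gradient φ x) :=
    (hflux.inner hgφ).integrable_of_hasCompactSupport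
      ((hasCompactSupport_gradient hφcs).mono fun x hx => by
        rw [Function.mem_support] at hx ⊢
        contrapose! hx
        rw [hx, inner_zero_right])
  have hJ2 : Integrable fun x => φ x * f x :=
    (hφC1.continuous.mul hfc).integrable_of_hasCompactSupport hφcs.mul_right
  rw [← integral_add hJ1 hJ2] at hweak
  set κ : ℝ := (p - 1 + β) / p
  have hκ : 0 < κ := by positivity
  have hpoint : ∀ x, κ ^ (p - 1) *
      (inner ℝ (‖gradient ρ' x‖ ^ (p - 2) • gradient ρ' x) (gradient φ x) + φ x * f x) ≤
      ‖gradient u x‖ ^ p * ρ x ^ α -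
        κ ^ p * (|u x| ^ p * ‖gradient ρ x‖ ^ p * ρ x ^ (α - p)) := by
    intro x
    by_cases hx : x ∈ tsupport u
    · have hxΩ := hΩu hx
      have hpos := hρpos x hxΩ
      refine le_trans (mul_le_mul_of_nonneg_left ?_ (by positivity))
        (rpow_mul_le_of_young hp hβ (abs_nonneg (u x)) (norm_nonneg (gradient ρ x))
          (norm_nonneg (gradient u x)) hpos)
      have h1 := inner_flux_gradient_le (γ := α - p + 1) hp (hρd x hxΩ)
        (hu.differentiable one_ne_zero x) hpos
      rw [add_sub_cancel_right] at h1
      have h2 : φ x * f x =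
          -(α + β) * (|u x| ^ p * ‖gradient ρ x‖ ^ p * ρ x ^ (α - p)) := by
        rw [hfV x (hSV hx)]
        simp only [hφ]
        rw [Real.rpow_add_one hpos.ne']
        field_simp
      rw [gradient_congr (heq x (hSV hx)), h2]
      linarith
    · have hgφ0 : gradient φ x = 0 := gradient_eq_zero_of_notMem_tsupport fun h =>
        hx (htu ((tsupport_mul_subset_left : tsupport φ ⊆ _) h))
      rw [hgφ0, hφ0 x hx, hu0 x hx, hgu0 x hx]
      simp
  have hmono := integral_mono ((hJ1.add hJ2).const_mul (κ ^ (p - 1)))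
    (hI1.sub (hI2.const_mul (κ ^ p))) hpoint
  rw [integral_const_mul, integral_sub' hI1 (hI2.const_mul _), integral_const_mul] at hmono
  have := mul_nonneg (Real.rpow_nonneg hκ.le (p - 1)) hweak
  exact sub_nonneg.1 (this.trans hmono)
end

section
/- Let 1 < p < ∞ and let Ω ⊆ ℝᴺ be open. Suppose ρ : Ω → (0,∞) is C² with Δ_p ρ ≤ 0 pointwise on Ω. Then for every u ∈ C_c^1(Ω): ∫_Ω ‖∇u‖^p dx ≥ ((p-1)/p)^p ∫_Ω |u|^p ‖∇ρ‖^p / ρ^p dx. -/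
open MeasureTheory

noncomputable def divg9 {N : ℕ} (F : EuclideanSpace ℝ (Fin N) → EuclideanSpace ℝ (Fin N))
    (x : EuclideanSpace ℝ (Fin N)) : ℝ :=
  ∑ i, fderiv ℝ F x (EuclideanSpace.single i 1) i

noncomputable def pLap9 {N : ℕ} (p : ℝ) (f : EuclideanSpace ℝ (Fin N) → ℝ)
    (x : EuclideanSpace ℝ (Fin N)) : ℝ :=
  divg9 (fun y => ‖gradient f y‖ ^ (p - 2) • gradient f y) x

section LinearAlgebra

variable {E : Type*} [NormedAddCommGroup E] [InnerProductSpace ℝ E]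

/-- A positive operator whose trace is at most the dimension has determinant in `[0, 1]`. -/
theorem LinearMap.IsPositive.abs_det_le_one [FiniteDimensional ℝ E] {T : E →ₗ[ℝ] E}
    (hT : T.IsPositive) (htr : LinearMap.trace ℝ E T ≤ Module.finrank ℝ E) :
    |LinearMap.det T| ≤ 1 := by
  have hnonneg := hT.nonneg_eigenvalues rfl
  rw [hT.isSymmetric.trace_eq_sum_eigenvalues rfl] at htr
  rw [hT.isSymmetric.det_eq_prod_eigenvalues rfl]
  simp only [RCLike.ofReal_real_eq_id, id_eq] at htr ⊢
  rw [abs_of_nonneg (Finset.prod_nonneg fun i _ => hnonneg i)]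
  calc ∏ i, hT.isSymmetric.eigenvalues rfl i
      ≤ ∏ i, Real.exp (hT.isSymmetric.eigenvalues rfl i - 1) :=
        Finset.prod_le_prod (fun i _ => hnonneg i) fun i _ => by
          linarith [Real.add_one_le_exp (hT.isSymmetric.eigenvalues rfl i - 1)]
    _ = Real.exp (∑ i, hT.isSymmetric.eigenvalues rfl i - Module.finrank ℝ E) := by
        rw [← Real.exp_sum, Finset.sum_sub_distrib]; simp
    _ ≤ 1 := Real.exp_le_one_iff.mpr (by linarith)

theorem LinearMap.det_one_add_mul_comm [FiniteDimensional ℝ E] (A B : E →ₗ[ℝ] E) :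
    LinearMap.det (1 + A * B) = LinearMap.det (1 + B * A) := by
  let b := Module.finBasis ℝ E
  rw [← LinearMap.det_toMatrix b, ← LinearMap.det_toMatrix b, map_add, map_add,
    LinearMap.toMatrix_mul, LinearMap.toMatrix_mul, LinearMap.toMatrix_one,
    Matrix.det_one_add_mul_comm]

/-- The operator `v ↦ v + r ⟪n, v⟫ n`. -/
noncomputable def rankOnePerturb (r : ℝ) (n : E) : E →L[ℝ] E :=
  ContinuousLinearMap.id ℝ E + r • (innerSL ℝ n).smulRight n

theorem rankOnePerturb_apply (r : ℝ) (n v : E) :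
    rankOnePerturb r n v = v + (r * inner ℝ n v) • n := by
  simp [rankOnePerturb, mul_smul]

theorem inner_rankOnePerturb_left (r : ℝ) (n v w : E) :
    inner ℝ (rankOnePerturb r n v) w = inner ℝ v w + r * inner ℝ n v * inner ℝ n w := by
  rw [rankOnePerturb_apply, inner_add_left, real_inner_smul_left]

theorem inner_rankOnePerturb_right (r : ℝ) (n v w : E) :
    inner ℝ v (rankOnePerturb r n w) = inner ℝ v w + r * inner ℝ n v * inner ℝ n w := by
  rw [rankOnePerturb_apply, inner_add_right, real_inner_smul_right, real_inner_comm n v]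
  ring

theorem rankOnePerturb_comp_self {n : E} (hn : ‖n‖ = 1) (s : ℝ) (v : E) :
    rankOnePerturb (s - 1) n (rankOnePerturb (s - 1) n v) = rankOnePerturb (s ^ 2 - 1) n v := by
  have hnn : inner ℝ n n = (1 : ℝ) := by rw [real_inner_self_eq_norm_sq, hn]; norm_num
  rw [rankOnePerturb_apply _ _ (rankOnePerturb (s - 1) n v), inner_rankOnePerturb_right, hnn,
    rankOnePerturb_apply, rankOnePerturb_apply, add_assoc, ← add_smul]
  congr 2
  ring

/-- If `H + D⁻¹` is positive for the positive operator `D = c (1 + (p - 2) n ⊗ n)` and `D H` has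
nonpositive trace, then `1 + D H` has determinant in `[0, 1]`. -/
theorem abs_det_one_add_le_one [FiniteDimensional ℝ E] {p c : ℝ} (hp : 1 < p) (hc : 0 < c)
    {n : E} (hn : ‖n‖ = 1) {H : E →ₗ[ℝ] E} (hH : H.IsSymmetric)
    (hpos : ∀ w, 0 ≤ inner ℝ (H w) w
      + c⁻¹ * (‖w‖ ^ 2 + (1 / (p - 1) - 1) * inner ℝ n w ^ 2))
    {DH : E →ₗ[ℝ] E} (hDH : ∀ w, DH w = c • rankOnePerturb (p - 2) n (H w))
    (htr : LinearMap.trace ℝ E DH ≤ 0) :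
    |LinearMap.det (1 + DH)| ≤ 1 := by
  have hs : 0 < p - 1 := by linarith
  set s := √(p - 1) with hsdef
  have hs2 : s ^ 2 = p - 1 := Real.sq_sqrt hs.le
  have hc2 : √c * √c = c := Real.mul_self_sqrt hc.le
  let S : E →ₗ[ℝ] E := √c • (rankOnePerturb (s - 1) n : E →ₗ[ℝ] E)
  have hS (v : E) : S v = √c • rankOnePerturb (s - 1) n v := rfl
  have hSsymm : S.IsSymmetric := fun v w => by
    simp only [hS, real_inner_smul_left, real_inner_smul_right, inner_rankOnePerturb_left,
      inner_rankOnePerturb_right]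
  have hSS : DH = S * (S * H) := by
    ext w
    rw [hDH, Module.End.mul_apply, Module.End.mul_apply, hS, hS, map_smul,
      rankOnePerturb_comp_self hn, smul_smul, hc2, hs2]
    congr 3
    ring
  have hnn : inner ℝ n n = (1 : ℝ) := by rw [real_inner_self_eq_norm_sq, hn]; norm_num
  have hinv (v : E) : c⁻¹ * (‖S v‖ ^ 2 + (1 / (p - 1) - 1) * inner ℝ n (S v) ^ 2) = ‖v‖ ^ 2 := by
    rw [← real_inner_self_eq_norm_sq, ← real_inner_self_eq_norm_sq, hS, real_inner_smul_left,
      real_inner_smul_right, real_inner_smul_right, inner_rankOnePerturb_left,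
      inner_rankOnePerturb_right, inner_rankOnePerturb_right, hnn, ← mul_assoc, hc2, mul_pow,
      pow_two (√c), hc2, ← hs2]
    have : s ≠ 0 := by positivity
    field_simp
    ring
  rw [hSS, LinearMap.det_one_add_mul_comm]
  refine LinearMap.IsPositive.abs_det_le_one ⟨?_, ?_⟩ ?_
  · intro v w
    simp only [LinearMap.add_apply, Module.End.one_apply, Module.End.mul_apply, inner_add_left,
      inner_add_right]
    rw [hSsymm, hH, hSsymm]
  · intro v
    simp only [LinearMap.add_apply, Module.End.one_apply, Module.End.mul_apply, inner_add_left]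
    rw [hSsymm, real_inner_self_eq_norm_sq, ← hinv v, add_comm]
    exact hpos (S v)
  · rw [map_add, LinearMap.trace_one, LinearMap.trace_mul_comm, ← hSS]
    linarith

end LinearAlgebra

section Calculus

variable {E : Type*} [NormedAddCommGroup E] [InnerProductSpace ℝ E]

/-- The derivative of `z ↦ ‖z‖ ^ (r - 2) z` away from the origin. -/
theorem hasFDerivAt_norm_rpow_smul {z : E} (hz : z ≠ 0) (r : ℝ) :
    HasFDerivAt (fun y : E => ‖y‖ ^ (r - 2) • y)
      (‖z‖ ^ (r - 2) • rankOnePerturb (r - 2) (‖z‖⁻¹ • z)) z := by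
  have hpos : 0 < ‖z‖ := norm_pos_iff.mpr hz
  have h1 : HasFDerivAt (fun y : E => (‖y‖ ^ 2) ^ ((r - 2) / 2)) _ z :=
    ((hasFDerivAt_id z).norm_sq).rpow_const (p := (r - 2) / 2) (Or.inl (by simpa using hz))
  have h2 := h1.smul (hasFDerivAt_id z)
  have hfun : (fun y : E => ‖y‖ ^ (r - 2) • y)
      = (fun y : E => (‖y‖ ^ 2) ^ ((r - 2) / 2)) • (id : E → E) := by
    funext y
    simp only [Pi.smul_apply', id]
    rw [← Real.rpow_natCast, ← Real.rpow_mul (norm_nonneg y)]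
    congr 2
    push_cast
    ring
  rw [hfun]
  refine h2.congr_fderiv ?_
  ext v
  have e1 : (‖z‖ ^ 2) ^ ((r - 2) / 2) = ‖z‖ ^ (r - 2) := by
    rw [← Real.rpow_natCast, ← Real.rpow_mul hpos.le]; congr 1; push_cast; ring
  have e2 : (‖z‖ ^ 2) ^ ((r - 2) / 2 - 1) = ‖z‖ ^ (r - 2) * (‖z‖⁻¹ * ‖z‖⁻¹) := by
    rw [Real.rpow_sub_one (by positivity), e1]
    field_simp
  simp only [id, _root_.add_apply, _root_.smul_apply,
    ContinuousLinearMap.smulRight_apply, ContinuousLinearMap.id_apply, rankOnePerturb_apply,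
    ContinuousLinearMap.comp_apply, innerSL_apply_apply, e1, e2, real_inner_smul_left, smul_add,
    smul_smul, smul_eq_mul, nsmul_eq_mul]
  congr 2
  push_cast
  ring

theorem IsLocalMin.second_deriv_nonneg {f g : ℝ → ℝ} {a m : ℝ} (hmin : IsLocalMin f a)
    (hf : ∀ᶠ t in nhds a, HasDerivAt f (g t) t) (hg : HasDerivAt g m a) : 0 ≤ m := by
  by_contra! hm
  have hd : deriv f =ᶠ[nhds a] g := hf.mono fun t ht => ht.deriv
  have hdd : deriv (deriv f) a = m := by rw [hd.deriv_eq, hg.deriv]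
  have hmax := isLocalMax_of_deriv_deriv_neg (hdd ▸ hm) hmin.deriv_eq_zero
    hf.self_of_nhds.continuousAt
  have hconst : f =ᶠ[nhds a] fun _ => f a := by
    filter_upwards [hmin, hmax] with t h1 h2 using le_antisymm h2 h1
  have : deriv (deriv f) a = 0 := by
    rw [hconst.deriv.deriv_eq]; simp
  linarith

/-- Second-order necessary condition for a local minimum, in terms of the derivative of the
gradient. -/
theorem IsLocalMin.inner_fderiv_gradient_nonneg {f : E → ℝ} {g : E → E} {y : E} {L : E →L[ℝ] E}
    (hmin : IsLocalMin f y) (hf : ∀ᶠ x in nhds y, HasFDerivAt f (innerSL ℝ (g x)) x)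
    (hg : HasFDerivAt g L y) (w : E) : 0 ≤ inner ℝ (L w) w := by
  have hline (t : ℝ) : HasDerivAt (fun t : ℝ => y + t • w) w t := by
    simpa using ((hasDerivAt_id t).smul_const w).const_add y
  have htend : Filter.Tendsto (fun t : ℝ => y + t • w) (nhds 0) (nhds y) := by
    simpa using (hline 0).continuousAt.tendsto
  refine IsLocalMin.second_deriv_nonneg (f := fun t : ℝ => f (y + t • w))
    (g := fun t : ℝ => inner ℝ (g (y + t • w)) w) (a := 0) ?_ ?_ ?_
  · have := htend.eventually hmin
    filter_upwards [this] with t ht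
    simpa using ht
  · filter_upwards [htend.eventually hf] with t ht
    exact ht.comp_hasDerivAt t (hline t)
  · have hg0 : HasFDerivAt g L (y + (0 : ℝ) • w) := by simpa using hg
    simpa using (hg0.comp_hasDerivAt (0 : ℝ) (hline 0)).inner ℝ (hasDerivAt_const (0 : ℝ) w)

/-- The gradient of a convex penalty `κ / q * ‖x - y‖ ^ q` in `y`. -/
theorem hasFDerivAt_penalty {q : ℝ} (hq : 1 < q) (κ : ℝ) (x y : E) :
    HasFDerivAt (fun y' => κ / q * ‖x - y'‖ ^ q)
      (innerSL ℝ (-(κ • (‖x - y‖ ^ (q - 2) • (x - y))))) y := by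
  have h := ((hasFDerivAt_norm_rpow (x - y) hq).comp y
    ((hasFDerivAt_id y).const_sub x)).const_mul (κ / q)
  refine h.congr_fderiv ?_
  ext v
  have : q ≠ 0 := by positivity
  simp
  field_simp

end Calculus

section Contact

variable {E : Type*} [NormedAddCommGroup E] [InnerProductSpace ℝ E] [CompleteSpace E]

/-- The vector field `‖∇ρ‖ ^ (p - 2) ∇ρ`, whose divergence is the `p`-Laplacian of `ρ`. -/
noncomputable def pFlux (p : ℝ) (ρ : E → ℝ) (y : E) : E :=
  ‖gradient ρ y‖ ^ (p - 2) • gradient ρ y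

theorem innerSL_gradient (f : E → ℝ) (y : E) : innerSL ℝ (gradient f y) = fderiv ℝ f y := by
  ext v
  simp [gradient]

theorem exists_hasFDerivAt_gradient_isSymmetric {ρ : E → ℝ} {y : E} (hρ : ContDiffAt ℝ 2 ρ y) :
    ∃ H : E →L[ℝ] E, HasFDerivAt (gradient ρ) H y ∧ (H : E →ₗ[ℝ] E).IsSymmetric := by
  have hd : DifferentiableAt ℝ (fderiv ℝ ρ) y :=
    (hρ.fderiv_right (m := 1) (by norm_num)).differentiableAt one_ne_zero
  let e : StrongDual ℝ E →L[ℝ] E :=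
    { toFun := (InnerProductSpace.toDual ℝ E).symm
      map_add' := map_add _
      map_smul' := fun c v => by simp
      cont := (InnerProductSpace.toDual ℝ E).symm.continuous }
  refine ⟨e ∘L fderiv ℝ (fderiv ℝ ρ) y, e.hasFDerivAt.comp y hd.hasFDerivAt, fun v w => ?_⟩
  have h (v w : E) : inner ℝ (e (fderiv ℝ (fderiv ℝ ρ) y v)) w = fderiv ℝ (fderiv ℝ ρ) y v w :=
    InnerProductSpace.toDual_symm_apply
  have hsymm := (hρ.isSymmSndFDerivAt (by simp)).eq v w
  simp only [ContinuousLinearMap.coe_coe, ContinuousLinearMap.comp_apply]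
  rw [h, real_inner_comm, h, hsymm]

theorem hasFDerivAt_pFlux {p : ℝ} {ρ : E → ℝ} {y : E} {H : E →L[ℝ] E}
    (hH : HasFDerivAt (gradient ρ) H y) (hy : gradient ρ y ≠ 0) :
    HasFDerivAt (pFlux p ρ) ((‖gradient ρ y‖ ^ (p - 2) •
      rankOnePerturb (p - 2) (‖gradient ρ y‖⁻¹ • gradient ρ y)) ∘L H) y :=
  (hasFDerivAt_norm_rpow_smul hy p).comp y hH

/-- At a local minimum, the gradient of `ρ` is balanced by that of the penalty. -/
theorem gradient_eq_of_isLocalMin {q κ : ℝ} (hq : 1 < q) {ρ : E → ℝ} {x y : E}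
    (hρ : DifferentiableAt ℝ ρ y) (hmin : IsLocalMin (fun y' => ρ y' + κ / q * ‖x - y'‖ ^ q) y) :
    gradient ρ y = κ • (‖x - y‖ ^ (q - 2) • (x - y)) := by
  have h := hmin.hasFDerivAt_eq_zero (hρ.hasFDerivAt.add (hasFDerivAt_penalty hq κ x y))
  rw [← innerSL_gradient, ← map_add] at h
  have h' : inner ℝ (gradient ρ y + -(κ • (‖x - y‖ ^ (q - 2) • (x - y))))
      (gradient ρ y + -(κ • (‖x - y‖ ^ (q - 2) • (x - y)))) = (0 : ℝ) :=
    DFunLike.congr_fun h _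
  rw [inner_self_eq_zero, ← sub_eq_add_neg, sub_eq_zero] at h'
  exact h'

/-- A minimum point `y` of `ρ + penalty` satisfies `x = y + ε ‖∇ρ(y)‖ ^ (p - 2) ∇ρ(y)`. -/
theorem eq_add_smul_pFlux_of_isLocalMin {p ε : ℝ} (hp : 1 < p) (hε : 0 < ε) {ρ : E → ℝ} {x y : E}
    (hρ : DifferentiableAt ℝ ρ y)
    (hmin : IsLocalMin (fun y' => ρ y' + ε ^ (1 - p / (p - 1)) / (p / (p - 1)) *
      ‖x - y'‖ ^ (p / (p - 1))) y) :
    x = y + ε • pFlux p ρ y := by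
  have hp' : 0 < p - 1 := by linarith
  have hq : 1 < p / (p - 1) := by rw [lt_div_iff₀ hp']; linarith
  have hg := gradient_eq_of_isLocalMin hq hρ hmin
  rcases eq_or_ne (x - y) 0 with hz | hz
  · rw [hz] at hg
    simp only [smul_zero] at hg
    rw [pFlux, hg, smul_zero, smul_zero, add_zero, sub_eq_zero.mp hz]
  rw [← sub_eq_iff_eq_add']
  set z := x - y
  have hpos : 0 < ‖z‖ := norm_pos_iff.mpr hz
  have hnorm : ‖gradient ρ y‖ = ε ^ (1 - p / (p - 1)) * ‖z‖ ^ (p / (p - 1) - 1) := by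
    rw [hg, norm_smul, norm_smul, Real.norm_of_nonneg (by positivity),
      Real.norm_of_nonneg (by positivity), ← Real.rpow_add_one hpos.ne']
    congr 2
    ring
  rw [pFlux, hnorm, hg, Real.mul_rpow (by positivity) (by positivity), ← Real.rpow_mul hε.le,
    ← Real.rpow_mul hpos.le, smul_smul, smul_smul, smul_smul]
  have e : ε * (ε ^ ((1 - p / (p - 1)) * (p - 2)) * ‖z‖ ^ ((p / (p - 1) - 1) * (p - 2)))
      * ε ^ (1 - p / (p - 1)) * ‖z‖ ^ (p / (p - 1) - 2) = 1 := by
    calc _ = (ε ^ (1 : ℝ) * ε ^ ((1 - p / (p - 1)) * (p - 2)) * ε ^ (1 - p / (p - 1)))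
          * (‖z‖ ^ ((p / (p - 1) - 1) * (p - 2)) * ‖z‖ ^ (p / (p - 1) - 2)) := by
          rw [Real.rpow_one]; ring
      _ = 1 := by
          rw [← Real.rpow_add hε, ← Real.rpow_add hε, ← Real.rpow_add hpos]
          have e1 : 1 + (1 - p / (p - 1)) * (p - 2) + (1 - p / (p - 1)) = 0 := by
            field_simp; ring
          have e2 : (p / (p - 1) - 1) * (p - 2) + (p / (p - 1) - 2) = 0 := by
            field_simp; ring
          rw [e1, e2, Real.rpow_zero, Real.rpow_zero, one_mul]
  rw [e, one_smul]

/-- At a noncritical minimum point of `ρ + penalty`, the map `y ↦ y + ε ‖∇ρ(y)‖ ^ (p - 2) ∇ρ(y)`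
does not expand volume if `ρ` is `p`-superharmonic. -/
theorem abs_det_le_one_of_isLocalMin [FiniteDimensional ℝ E] {p ε : ℝ} (hp : 1 < p) (hε : 0 < ε)
    {ρ : E → ℝ} {x y : E} (hρ : ContDiffAt ℝ 2 ρ y) (hy : gradient ρ y ≠ 0)
    (hmin : IsLocalMin (fun y' => ρ y' + ε ^ (1 - p / (p - 1)) / (p / (p - 1)) *
      ‖x - y'‖ ^ (p / (p - 1))) y)
    (htr : LinearMap.trace ℝ E (fderiv ℝ (pFlux p ρ) y : E →ₗ[ℝ] E) ≤ 0) :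
    |(ContinuousLinearMap.id ℝ E + ε • fderiv ℝ (pFlux p ρ) y).det| ≤ 1 := by
  have hp' : 0 < p - 1 := by linarith
  have hq : 1 < p / (p - 1) := by rw [lt_div_iff₀ hp']; linarith
  have hρd : DifferentiableAt ℝ ρ y := hρ.differentiableAt two_ne_zero
  have hx := eq_add_smul_pFlux_of_isLocalMin hp hε hρd hmin
  have hg := gradient_eq_of_isLocalMin hq hρd hmin
  obtain ⟨H, hH, hHsymm⟩ := exists_hasFDerivAt_gradient_isSymmetric hρ
  have hF := hasFDerivAt_pFlux (p := p) hH hy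
  set κ := ε ^ (1 - p / (p - 1)) with hκ
  set q := p / (p - 1) with hqdef
  set ξ := gradient ρ y with hξdef
  have hξ : 0 < ‖ξ‖ := norm_pos_iff.mpr hy
  have hxy : x - y = (ε * ‖ξ‖ ^ (p - 2)) • ξ := by
    rw [mul_smul]; exact sub_eq_iff_eq_add'.mpr hx
  set c := ε * ‖ξ‖ ^ (p - 2) with hc
  have hcpos : 0 < c := by positivity
  have hz : x - y ≠ 0 := by rw [hxy]; exact smul_ne_zero hcpos.ne' hy
  have hκc : κ * ‖x - y‖ ^ (q - 2) = c⁻¹ := by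
    rw [smul_smul] at hg
    nth_rewrite 2 [hxy] at hg
    rw [smul_smul] at hg
    have : (κ * ‖x - y‖ ^ (q - 2) * c - 1) • ξ = 0 := by
      rw [sub_smul, one_smul, ← hg, sub_self]
    have := (smul_eq_zero.mp this).resolve_right hy
    field_simp
    linarith
  have hunit : ‖x - y‖⁻¹ • (x - y) = ‖ξ‖⁻¹ • ξ := by
    rw [hxy, norm_smul, Real.norm_of_nonneg hcpos.le, smul_smul]
    congr 1
    field_simp
  have hpen : HasFDerivAt (fun y' => κ • (‖x - y'‖ ^ (q - 2) • (x - y')))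
      (-(c⁻¹ • rankOnePerturb (q - 2) (‖ξ‖⁻¹ • ξ))) y := by
    have h := ((hasFDerivAt_norm_rpow_smul hz q).comp y
      ((hasFDerivAt_id y).const_sub x)).const_smul κ
    refine h.congr_fderiv ?_
    ext v
    simp [hunit, smul_smul, hκc]
  have hsecond := hmin.inner_fderiv_gradient_nonneg
    (g := fun y' => gradient ρ y' + -(κ • (‖x - y'‖ ^ (q - 2) • (x - y')))) ?_ (hH.add hpen.neg)
  · rw [hF.fderiv] at htr ⊢
    refine abs_det_one_add_le_one hp hcpos (n := ‖ξ‖⁻¹ • ξ) (norm_smul_inv_norm hy) hHsymm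
      (fun w => ?_) (DH := ((ε • ((‖ξ‖ ^ (p - 2) • rankOnePerturb (p - 2) (‖ξ‖⁻¹ • ξ)) ∘L H)
        : E →L[ℝ] E) : E →ₗ[ℝ] E)) (fun w => ?_) ?_
    · have h := hsecond w
      simp only [neg_neg, _root_.add_apply, _root_.smul_apply, inner_add_left,
        real_inner_smul_left, inner_rankOnePerturb_left, real_inner_self_eq_norm_sq] at h
      have hq2 : q - 2 = 1 / (p - 1) - 1 := by rw [hqdef]; field_simp; ring
      rw [← hq2]
      refine h.trans_eq ?_
      simp only [real_inner_smul_left, ContinuousLinearMap.coe_coe]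
      ring
    · simp [hc, mul_smul]
    · rw [ContinuousLinearMap.toLinearMap_smul, map_smul]
      exact mul_nonpos_of_nonneg_of_nonpos hε.le htr
  · filter_upwards [hρ.eventually (by simp)] with y' hy'
    rw [map_add, innerSL_gradient]
    exact (hy'.differentiableAt two_ne_zero).hasFDerivAt.add (hasFDerivAt_penalty hq κ x y')

end Contact

section Transport

variable {E : Type*} [NormedAddCommGroup E] [InnerProductSpace ℝ E]

/-- If the penalty beats `ρ` at distance `δ`, then `ρ + penalty` has a minimum point near `x`. -/
theorem exists_isLocalMin_add_penalty [FiniteDimensional ℝ E] {q κ δ M : ℝ} (hq : 1 < q)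
    (hδ : 0 < δ) {ρ : E → ℝ} {x : E} (hcont : ContinuousOn ρ (Metric.closedBall x δ))
    (hpos : ∀ y ∈ Metric.closedBall x δ, 0 ≤ ρ y) (hM : ρ x ≤ M) (hκ : M < κ / q * δ ^ q) :
    ∃ y ∈ Metric.closedBall x δ, IsLocalMin (fun y' => ρ y' + κ / q * ‖x - y'‖ ^ q) y := by
  have hcont' : ContinuousOn (fun y' => ρ y' + κ / q * ‖x - y'‖ ^ q) (Metric.closedBall x δ) := by
    refine hcont.add (Continuous.continuousOn ?_)
    exact continuous_const.mul
      ((continuous_const.sub continuous_id).norm.rpow_const fun _ => Or.inr (by linarith))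
  obtain ⟨y, hy, hmin⟩ := (isCompact_closedBall x δ).exists_isMinOn
    ⟨x, Metric.mem_closedBall_self hδ.le⟩ hcont'
  refine ⟨y, hy, hmin.isLocalMin ?_⟩
  have hlt : dist y x < δ := by
    refine lt_of_le_of_ne (Metric.mem_closedBall.mp hy) fun heq => ?_
    have h := hmin (Metric.mem_closedBall_self hδ.le : x ∈ Metric.closedBall x δ)
    simp only [Set.mem_ofPred_eq] at h
    rw [sub_self, norm_zero, Real.zero_rpow (by linarith), mul_zero, add_zero,
      ← dist_eq_norm, dist_comm, heq] at h
    linarith [hpos y hy]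
  exact Filter.mem_of_superset (Metric.isOpen_ball.mem_nhds (Metric.mem_ball.mpr hlt))
    Metric.ball_subset_closedBall

theorem norm_pFlux [CompleteSpace E] {p : ℝ} (hp : 1 < p) (ρ : E → ℝ) (y : E) :
    ‖pFlux p ρ y‖ = ‖gradient ρ y‖ ^ (p - 1) := by
  rw [pFlux, norm_smul, Real.norm_of_nonneg (by positivity)]
  rcases eq_or_ne (gradient ρ y) 0 with h | h
  · rw [h, norm_zero, mul_zero, Real.zero_rpow (by linarith)]
  · rw [← Real.rpow_add_one (norm_ne_zero_iff.mpr h)]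
    congr 1
    ring

variable [FiniteDimensional ℝ E] [MeasurableSpace E] [BorelSpace E]

theorem measurable_gradient (f : E → ℝ) : Measurable (gradient f) :=
  (InnerProductSpace.toDual ℝ E).symm.continuous.measurable.comp (measurable_fderiv ℝ f)

theorem measurable_pFlux (p : ℝ) (ρ : E → ℝ) : Measurable (pFlux p ρ) :=
  ((measurable_gradient ρ).norm.pow_const (p - 2)).smul (measurable_gradient ρ)

/-- For a `p`-superharmonic `ρ`, the map `y ↦ y + ε ‖∇ρ(y)‖ ^ (p - 2) ∇ρ(y)` pushes the volume of
a neighbourhood of `K` to a measure dominating the volume of `K`. -/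
theorem restrict_le_map_add_smul_pFlux (μ : Measure E) [μ.IsAddHaarMeasure] {p ε δ M : ℝ}
    (hp : 1 < p) (hε : 0 < ε) (hδ : 0 < δ) {ρ : E → ℝ} {K : Set E}
    (hρ : ∀ y ∈ Metric.cthickening δ K, ContDiffAt ℝ 2 ρ y)
    (hpos : ∀ y ∈ Metric.cthickening δ K, 0 ≤ ρ y)
    (htr : ∀ y ∈ Metric.cthickening δ K,
      LinearMap.trace ℝ E (fderiv ℝ (pFlux p ρ) y : E →ₗ[ℝ] E) ≤ 0)
    (hM : ∀ y ∈ K, ρ y ≤ M)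
    (hκ : M < ε ^ (1 - p / (p - 1)) / (p / (p - 1)) * δ ^ (p / (p - 1))) :
    μ.restrict K ≤ (μ.restrict (Metric.cthickening δ K)).map fun y => y + ε • pFlux p ρ y := by
  have hq : 1 < p / (p - 1) := by rw [lt_div_iff₀ (by linarith)]; linarith
  set K' := Metric.cthickening δ K
  set T : E → E := fun y => y + ε • pFlux p ρ y with hT
  have hTmeas : Measurable T := measurable_id.add ((measurable_pFlux p ρ).const_smul ε)
  have hK' : MeasurableSet K' := Metric.isClosed_cthickening.measurableSet
  have hZ : MeasurableSet {y | gradient ρ y = 0} :=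
    measurable_gradient ρ (measurableSet_singleton 0)
  set T' : E → E →L[ℝ] E := fun y => ContinuousLinearMap.id ℝ E + ε • fderiv ℝ (pFlux p ρ) y
    with hT'
  have hdet : MeasurableSet {y | |(T' y).det| ≤ 1} := by
    refine measurableSet_le (Measurable.abs ?_) measurable_const
    exact ContinuousLinearMap.continuous_det.measurable.comp
      (((measurable_fderiv ℝ (pFlux p ρ)).const_smul ε).const_add _)
  refine Measure.le_iff.mpr fun B hB => ?_
  rw [Measure.map_apply hTmeas hB, Measure.restrict_apply hB,
    Measure.restrict_apply (hTmeas hB)]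
  set A := T ⁻¹' B ∩ K'
  have hA : MeasurableSet A := (hTmeas hB).inter hK'
  set A₁ := A ∩ {y | gradient ρ y = 0}
  set A₂ := (A \ {y | gradient ρ y = 0}) ∩ {y | |(T' y).det| ≤ 1}
  have hA₂ : MeasurableSet A₂ := (hA.diff hZ).inter hdet
  have hcover : B ∩ K ⊆ T '' A₁ ∪ T '' A₂ := by
    rintro x ⟨hxB, hxK⟩
    have hball : Metric.closedBall x δ ⊆ K' := Metric.closedBall_subset_cthickening hxK δ
    obtain ⟨y, hy, hmin⟩ := exists_isLocalMin_add_penalty hq hδ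
      (fun y hy => (hρ y (hball hy)).continuousAt.continuousWithinAt)
      (fun y hy => hpos y (hball hy)) (hM x hxK) hκ
    have hyK' := hball hy
    have hTy : T y = x :=
      (eq_add_smul_pFlux_of_isLocalMin hp hε
        ((hρ y hyK').differentiableAt two_ne_zero) hmin).symm
    have hyA : y ∈ A := ⟨by rw [Set.mem_preimage, hTy]; exact hxB, hyK'⟩
    by_cases hg : gradient ρ y = 0
    · exact Or.inl ⟨y, ⟨hyA, hg⟩, hTy⟩
    · exact Or.inr ⟨y, ⟨⟨hyA, hg⟩,
        abs_det_le_one_of_isLocalMin hp hε (hρ y hyK') hg hmin (htr y hyK')⟩, hTy⟩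
  have h₁ : T '' A₁ ⊆ A₁ := by
    rintro _ ⟨y, hy, rfl⟩
    have : T y = y := by simp [hT, pFlux, show gradient ρ y = 0 from hy.2]
    rwa [this]
  have h₂ : μ (T '' A₂) ≤ μ A₂ := by
    refine (addHaar_image_le_lintegral_abs_det_fderiv μ hA₂ (f' := T') fun y hy => ?_).trans ?_
    · obtain ⟨H, hH, -⟩ := exists_hasFDerivAt_gradient_isSymmetric (hρ y hy.1.1.2)
      have hF := (hasFDerivAt_pFlux (p := p) hH hy.1.2).differentiableAt.hasFDerivAt
      exact ((hasFDerivAt_id y).add (hF.const_smul ε)).hasFDerivWithinAt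
    · calc ∫⁻ y in A₂, ENNReal.ofReal |(T' y).det| ∂μ ≤ ∫⁻ _ in A₂, 1 ∂μ :=
            setLIntegral_mono' hA₂ fun y hy => ENNReal.ofReal_le_one.mpr hy.2
        _ = μ A₂ := by simp
  calc μ (B ∩ K) ≤ μ (T '' A₁) + μ (T '' A₂) := (measure_mono hcover).trans (measure_union_le _ _)
    _ ≤ μ A₁ + μ A₂ := add_le_add (measure_mono h₁) h₂
    _ ≤ μ A₁ + μ (A \ {y | gradient ρ y = 0}) := by gcongr; exact Set.inter_subset_left
    _ = μ A := measure_inter_add_sdiff A hZ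

/-- A classically `p`-superharmonic function is weakly `p`-superharmonic. No differentiability of
the flux is needed at critical points. -/
theorem integral_fderiv_pFlux_nonneg (μ : Measure E) [μ.IsAddHaarMeasure] {p : ℝ} (hp : 1 < p)
    {Ω K : Set E} (hΩ : IsOpen Ω) (hK : IsCompact K) (hKΩ : K ⊆ Ω) {ρ : E → ℝ}
    (hρ : ContDiffOn ℝ 2 ρ Ω) (hpos : ∀ y ∈ Ω, 0 ≤ ρ y)
    (htr : ∀ y ∈ Ω, LinearMap.trace ℝ E (fderiv ℝ (pFlux p ρ) y : E →ₗ[ℝ] E) ≤ 0)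
    {φ : E → ℝ} (hφ : ContDiff ℝ 1 φ) (hφ0 : ∀ y, 0 ≤ φ y) (hφK : tsupport φ ⊆ K) :
    IntegrableOn (fun y => fderiv ℝ φ y (pFlux p ρ y)) K μ ∧
      0 ≤ ∫ y in K, fderiv ℝ φ y (pFlux p ρ y) ∂μ := by
  have hq : 1 < p / (p - 1) := by rw [lt_div_iff₀ (by linarith)]; linarith
  obtain ⟨δ, hδ, hδΩ⟩ := hK.exists_cthickening_subset_open hΩ hKΩ
  have hKK' : K ⊆ Metric.cthickening δ K := Metric.self_subset_cthickening K
  have hK'c : IsCompact (Metric.cthickening δ K) := hK.cthickening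
  have hρat (y : E) (hy : y ∈ Ω) : ContDiffAt ℝ 2 ρ y := hρ.contDiffAt (hΩ.mem_nhds hy)
  obtain ⟨M, hM⟩ := hK.bddAbove_image (hρ.continuousOn.mono hKΩ)
  have hsupp : HasCompactSupport φ := hK.of_isClosed_subset (isClosed_tsupport φ) hφK
  obtain ⟨C, hC⟩ := hφ.lipschitzWith_of_hasCompactSupport hsupp one_ne_zero
  have hgcont : ContinuousOn (fun y => ‖gradient ρ y‖ ^ (p - 1)) (Metric.cthickening δ K) := by
    intro y hy
    obtain ⟨H, hH, -⟩ := exists_hasFDerivAt_gradient_isSymmetric (hρat y (hδΩ hy))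
    exact (hH.continuousAt.norm.rpow_const (Or.inr (by linarith))).continuousWithinAt
  have hbound : IntegrableOn (fun y => C * ‖gradient ρ y‖ ^ (p - 1)) (Metric.cthickening δ K) μ :=
    (hgcont.integrableOn_compact hK'c).const_mul _
  have hmeas : Measurable fun y => fderiv ℝ φ y (pFlux p ρ y) := by
    simp only [← innerSL_gradient, innerSL_apply_apply]
    exact (measurable_gradient φ).inner (measurable_pFlux p ρ)
  have hInt : IntegrableOn (fun y => fderiv ℝ φ y (pFlux p ρ y)) (Metric.cthickening δ K) μ := by
    refine hbound.mono' hmeas.aestronglyMeasurable (Filter.Eventually.of_forall fun y => ?_)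
    rw [← norm_pFlux hp]
    exact (ContinuousLinearMap.le_opNorm _ _).trans
      (mul_le_mul_of_nonneg_right (norm_fderiv_le_of_lipschitz ℝ hC) (norm_nonneg _))
  refine ⟨hInt.mono_set hKK', ?_⟩
  have hzero (y : E) (hy : y ∉ K) : φ y = 0 := image_eq_zero_of_notMem_tsupport fun h => hy (hφK h)
  have hdzero (y : E) (hy : y ∉ K) : fderiv ℝ φ y = 0 :=
    fderiv_of_notMem_tsupport ℝ fun h => hy (hφK h)
  have hset : ∫ y in K, fderiv ℝ φ y (pFlux p ρ y) ∂μ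
      = ∫ y in Metric.cthickening δ K, fderiv ℝ φ y (pFlux p ρ y) ∂μ :=
    (setIntegral_eq_of_subset_of_forall_sdiff_eq_zero Metric.isClosed_cthickening.measurableSet hKK'
      fun y hy => by rw [hdzero y hy.2]; rfl).symm
  rw [hset]
  have hTmeas (ε : ℝ) : Measurable fun y => y + ε • pFlux p ρ y :=
    measurable_id.add ((measurable_pFlux p ρ).const_smul ε)
  have : IsFiniteMeasure (μ.restrict (Metric.cthickening δ K)) :=
    ⟨by simpa using hK'c.measure_lt_top⟩
  obtain ⟨B, hB⟩ := hφ.continuous.bounded_above_of_compact_support hsupp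
  have hlim : Filter.Tendsto (fun ε : ℝ => ∫ y in Metric.cthickening δ K,
      ε⁻¹ * (φ (y + ε • pFlux p ρ y) - φ y) ∂μ) (nhdsWithin 0 (Set.Ioi 0))
      (nhds (∫ y in Metric.cthickening δ K, fderiv ℝ φ y (pFlux p ρ y) ∂μ)) := by
    refine tendsto_integral_filter_of_dominated_convergence _
      (Filter.Eventually.of_forall fun ε => ?_) ?_ hbound (Filter.Eventually.of_forall fun y => ?_)
    · exact ((((hφ.continuous.measurable.comp (hTmeas ε)).sub
        hφ.continuous.measurable).const_mul _)).aestronglyMeasurable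
    · filter_upwards [self_mem_nhdsWithin] with ε hε
      refine Filter.Eventually.of_forall fun y => ?_
      have hε' : (0 : ℝ) < ε := hε
      have h := hC.dist_le_mul (y + ε • pFlux p ρ y) y
      rw [dist_eq_norm, dist_eq_norm, add_sub_cancel_left, norm_smul, norm_pFlux hp,
        Real.norm_of_nonneg hε'.le] at h
      rw [norm_mul, norm_inv, Real.norm_of_nonneg hε'.le, inv_mul_le_iff₀ hε']
      linarith
    · have hd := (hφ.differentiable one_ne_zero y).hasFDerivAt.hasLineDerivAt (pFlux p ρ y)
      have := hd.tendsto_slope_zero_right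
      simpa using this
  refine ge_of_tendsto hlim ?_
  have hlarge : ∀ᶠ ε : ℝ in nhdsWithin 0 (Set.Ioi 0),
      M < ε ^ (1 - p / (p - 1)) / (p / (p - 1)) * δ ^ (p / (p - 1)) := by
    have h := ((tendsto_rpow_neg_nhdsGT_zero
      (show 1 - p / (p - 1) < 0 by linarith)).atTop_div_const
        (show 0 < p / (p - 1) by linarith)).atTop_mul_const
      (show 0 < δ ^ (p / (p - 1)) by positivity)
    exact h.eventually_gt_atTop M
  filter_upwards [hlarge, self_mem_nhdsWithin] with ε hεM hε
  have hε' : (0 : ℝ) < ε := hε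
  have hle := restrict_le_map_add_smul_pFlux μ hp hε' hδ (fun y hy => hρat y (hδΩ hy))
    (fun y hy => hpos y (hδΩ hy)) (fun y hy => htr y (hδΩ hy))
    (fun y hy => hM (Set.mem_image_of_mem ρ hy)) hεM
  have hφint (ν : Measure E) [IsFiniteMeasure ν] : Integrable φ ν :=
    Integrable.of_bound hφ.continuous.aestronglyMeasurable B (Filter.Eventually.of_forall hB)
  have hmono := integral_mono_measure hle (Filter.Eventually.of_forall hφ0) (hφint _)
  rw [integral_map (hTmeas ε).aemeasurable hφ.continuous.aestronglyMeasurable,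
    ← setIntegral_eq_of_subset_of_forall_sdiff_eq_zero Metric.isClosed_cthickening.measurableSet hKK'
      fun y hy => hzero y hy.2] at hmono
  have hcomp : Integrable (fun y => φ (y + ε • pFlux p ρ y))
      (μ.restrict (Metric.cthickening δ K)) :=
    Integrable.of_bound (hφ.continuous.measurable.comp (hTmeas ε)).aestronglyMeasurable B
      (Filter.Eventually.of_forall fun y => hB _)
  rw [integral_const_mul, integral_sub hcomp (hφint _)]
  exact mul_nonneg (inv_nonneg.mpr hε'.le) (sub_nonneg.mpr hmono)

end Transport

/-- Young's inequality in the form which yields the sharp Hardy constant. -/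
theorem hardy_young {p a b : ℝ} (hp : 1 < p) (ha : 0 ≤ a) (hb : 0 ≤ b) :
    ((p - 1) / p) ^ (p - 1) * (p * (a ^ (p - 1) * b) - (p - 1) * a ^ p)
      ≤ b ^ p - ((p - 1) / p) ^ p * a ^ p := by
  have hp0 : 0 < p := by linarith
  have hp1 : 0 < p - 1 := by linarith
  set c := (p - 1) / p with hc
  have hcpos : 0 < c := by positivity
  have hY := Real.young_inequality_of_nonneg (a := b) (b := (c * a) ^ (p - 1)) hb (by positivity)
    (Real.HolderConjugate.conjExponent hp)
  have e1 : ((c * a) ^ (p - 1)) ^ p.conjExponent = c ^ p * a ^ p := by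
    rw [← Real.rpow_mul (by positivity), Real.conjExponent, mul_div_cancel₀ _ hp1.ne',
      Real.mul_rpow hcpos.le ha]
  have e2 : c ^ p = c ^ (p - 1) * c := by
    rw [← Real.rpow_add_one hcpos.ne']; congr 1; ring
  have e3 : p * c = p - 1 := by rw [hc]; field_simp
  rw [e1, Real.mul_rpow hcpos.le ha, Real.conjExponent] at hY
  have hY' : p * (b * (c ^ (p - 1) * a ^ (p - 1))) ≤ b ^ p + (p - 1) * (c ^ p * a ^ p) := by
    calc _ ≤ p * (b ^ p / p + c ^ p * a ^ p / (p / (p - 1))) :=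
          mul_le_mul_of_nonneg_left hY hp0.le
      _ = _ := by field_simp
  have e4 : c ^ (p - 1) * (p - 1) * a ^ p = p * (c ^ p * a ^ p) := by
    rw [e2, ← e3]; ring
  linarith

theorem divg9_eq_trace {N : ℕ} (F : EuclideanSpace ℝ (Fin N) → EuclideanSpace ℝ (Fin N))
    (x : EuclideanSpace ℝ (Fin N)) :
    divg9 F x = LinearMap.trace ℝ _
      (fderiv ℝ F x : EuclideanSpace ℝ (Fin N) →ₗ[ℝ] EuclideanSpace ℝ (Fin N)) := by
  rw [LinearMap.trace_eq_sum_inner _ (EuclideanSpace.basisFun (Fin N) ℝ), divg9]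
  simp [EuclideanSpace.inner_single_left]

section Hardy

/-- The test function `|u| ^ p / ρ ^ (p - 1)`. -/
noncomputable def hardyTest {X : Type*} (p : ℝ) (ρ u : X → ℝ) (x : X) : ℝ :=
  |u x| ^ p * ρ x ^ (1 - p)

theorem tsupport_hardyTest_subset {X : Type*} [TopologicalSpace X] {p : ℝ} (hp : 1 < p)
    (ρ u : X → ℝ) :
    tsupport (hardyTest p ρ u) ⊆ tsupport u := by
  refine closure_mono fun x hx hux => hx ?_
  rw [hardyTest, hux, abs_zero, Real.zero_rpow (by linarith), zero_mul]

variable {E : Type*} [NormedAddCommGroup E] [InnerProductSpace ℝ E]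

theorem contDiff_hardyTest {p : ℝ} (hp : 1 < p) {Ω : Set E} (hΩ : IsOpen Ω) {ρ u : E → ℝ}
    (hρ : ContDiffOn ℝ 1 ρ Ω) (hρpos : ∀ x ∈ Ω, 0 < ρ x) (hu : ContDiff ℝ 1 u)
    (hΩu : tsupport u ⊆ Ω) : ContDiff ℝ 1 (hardyTest p ρ u) := by
  refine contDiff_iff_contDiffAt.mpr fun x => ?_
  by_cases hx : x ∈ Ω
  · exact (hu.norm_rpow hp).contDiffAt.mul
      ((hρ.contDiffAt (hΩ.mem_nhds hx)).rpow_const_of_ne (hρpos x hx).ne')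
  · have hx' : x ∉ tsupport (hardyTest p ρ u) :=
      fun h => hx (hΩu (tsupport_hardyTest_subset hp ρ u h))
    exact (contDiffAt_const (c := (0 : ℝ))).congr_of_eventuallyEq
      (notMem_tsupport_iff_eventuallyEq.mp hx')

theorem fderiv_hardyTest [CompleteSpace E] {p : ℝ} (hp : 1 < p) {ρ u : E → ℝ} {x : E}
    (hρ : DifferentiableAt ℝ ρ x) (hρpos : 0 < ρ x) (hu : DifferentiableAt ℝ u x) (v : E) :
    fderiv ℝ (hardyTest p ρ u) x v =
      p * |u x| ^ (p - 2) * u x * ρ x ^ (1 - p) * inner ℝ (gradient u x) v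
        - (p - 1) * |u x| ^ p * ρ x ^ (-p) * inner ℝ (gradient ρ x) v := by
  have h1 := (hasDerivAt_abs_rpow (u x) hp).comp_hasFDerivAt x hu.hasFDerivAt
  have h2 := hρ.hasFDerivAt.rpow_const (p := 1 - p) (Or.inl hρpos.ne')
  have h : HasFDerivAt (hardyTest p ρ u) _ x := h1.mul h2
  rw [h.fderiv, ← innerSL_gradient, ← innerSL_gradient]
  simp only [_root_.add_apply, _root_.smul_apply, innerSL_apply_apply, smul_eq_mul,
    Function.comp_apply, show 1 - p - 1 = -p by ring]
  ring

/-- Pointwise bound for the flux tested against the gradient of `|u| ^ p / ρ ^ (p - 1)`. -/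
theorem fderiv_hardyTest_pFlux_le [CompleteSpace E] {p : ℝ} (hp : 1 < p) {ρ u : E → ℝ} {x : E}
    (hρ : DifferentiableAt ℝ ρ x) (hρpos : 0 < ρ x) (hu : DifferentiableAt ℝ u x) :
    ((p - 1) / p) ^ (p - 1) * fderiv ℝ (hardyTest p ρ u) x (pFlux p ρ x) ≤
      ‖gradient u x‖ ^ p - ((p - 1) / p) ^ p * (|u x| ^ p * ‖gradient ρ x‖ ^ p / ρ x ^ p) := by
  have hp1 : 0 < p - 1 := by linarith
  have hpow {t : ℝ} (ht : 0 ≤ t) : t ^ (p - 2) * t = t ^ (p - 1) := by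
    rcases ht.eq_or_lt with rfl | ht
    · rw [mul_zero, Real.zero_rpow hp1.ne']
    · rw [← Real.rpow_add_one ht.ne']; congr 1; ring
  have hY := hardy_young hp (a := |u x| * ‖gradient ρ x‖ / ρ x) (b := ‖gradient u x‖)
    (by positivity) (norm_nonneg _)
  have ea (r : ℝ) : (|u x| * ‖gradient ρ x‖ / ρ x) ^ r
      = |u x| ^ r * ‖gradient ρ x‖ ^ r / ρ x ^ r := by
    rw [Real.div_rpow (by positivity) hρpos.le, Real.mul_rpow (abs_nonneg _) (norm_nonneg _)]
  rw [ea, ea] at hY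
  refine le_trans (mul_le_mul_of_nonneg_left ?_ (by positivity)) hY
  rw [fderiv_hardyTest hp hρ hρpos hu]
  refine sub_le_sub ?_ (le_of_eq ?_)
  · have hinner : u x * inner ℝ (gradient u x) (pFlux p ρ x)
        ≤ |u x| * (‖gradient u x‖ * ‖gradient ρ x‖ ^ (p - 1)) := by
      rw [← norm_pFlux hp]
      calc _ ≤ |u x * inner ℝ (gradient u x) (pFlux p ρ x)| := le_abs_self _
        _ = |u x| * |inner ℝ (gradient u x) (pFlux p ρ x)| := abs_mul _ _
        _ ≤ _ := mul_le_mul_of_nonneg_left (abs_real_inner_le_norm _ _) (abs_nonneg _)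
    calc _ = p * |u x| ^ (p - 2) * ρ x ^ (1 - p) *
          (u x * inner ℝ (gradient u x) (pFlux p ρ x)) := by ring
      _ ≤ p * |u x| ^ (p - 2) * ρ x ^ (1 - p) *
          (|u x| * (‖gradient u x‖ * ‖gradient ρ x‖ ^ (p - 1))) :=
          mul_le_mul_of_nonneg_left hinner (by positivity)
      _ = _ := by
          rw [← hpow (abs_nonneg (u x)), show 1 - p = -(p - 1) by ring, Real.rpow_neg hρpos.le]
          ring
  · have hself : inner ℝ (gradient ρ x) (pFlux p ρ x) = ‖gradient ρ x‖ ^ p := by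
      rw [pFlux, real_inner_smul_right, real_inner_self_eq_norm_sq, pow_two, ← mul_assoc,
        hpow (norm_nonneg _)]
      rcases eq_or_ne (gradient ρ x) 0 with h | h
      · rw [h, norm_zero, mul_zero, Real.zero_rpow (by linarith)]
      · rw [← Real.rpow_add_one (norm_ne_zero_iff.mpr h)]; congr 1; ring
    rw [hself, Real.rpow_neg hρpos.le]
    ring

end Hardy

theorem stmt_9 (N : ℕ) (p : ℝ) (hp : 1 < p)
    (Ω : Set (EuclideanSpace ℝ (Fin N))) (hΩ : IsOpen Ω)
    (ρ : EuclideanSpace ℝ (Fin N) → ℝ)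
    (hρC2 : ContDiffOn ℝ 2 ρ Ω) (hρpos : ∀ x ∈ Ω, 0 < ρ x)
    (hsuper : ∀ x ∈ Ω, pLap9 p ρ x ≤ 0)
    (u : EuclideanSpace ℝ (Fin N) → ℝ)
    (hu : ContDiff ℝ 1 u) (hsupp : HasCompactSupport u) (hΩu : tsupport u ⊆ Ω) :
    ∫ x in Ω, ‖gradient u x‖ ^ p ∂volume ≥
      ((p - 1) / p) ^ p *
        ∫ x in Ω, |u x| ^ p * ‖gradient ρ x‖ ^ p / ρ x ^ p ∂volume := by
  have hp0 : p ≠ 0 := by linarith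
  have hK : IsCompact (tsupport u) := hsupp
  have hzero (x : EuclideanSpace ℝ (Fin N)) (hx : x ∉ tsupport u) : u x = 0 :=
    image_eq_zero_of_notMem_tsupport hx
  have hgzero (x : EuclideanSpace ℝ (Fin N)) (hx : x ∉ tsupport u) : gradient u x = 0 := by
    rw [gradient, fderiv_of_notMem_tsupport ℝ hx, map_zero]
  have hρd (x) (hx : x ∈ Ω) : ContDiffAt ℝ 2 ρ x := hρC2.contDiffAt (hΩ.mem_nhds hx)
  rw [setIntegral_eq_of_subset_of_forall_sdiff_eq_zero hΩ.measurableSet hΩu fun x hx => by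
      rw [hgzero x hx.2, norm_zero, Real.zero_rpow hp0],
    setIntegral_eq_of_subset_of_forall_sdiff_eq_zero hΩ.measurableSet hΩu fun x hx => by
      rw [hzero x hx.2, abs_zero, Real.zero_rpow hp0, zero_mul, zero_div]]
  have hgu : Continuous (gradient u) :=
    (InnerProductSpace.toDual ℝ _).symm.continuous.comp (hu.continuous_fderiv one_ne_zero)
  have hInt₁ : IntegrableOn (fun x => ‖gradient u x‖ ^ p) (tsupport u) :=
    (hgu.norm.rpow_const fun _ => Or.inr (by linarith)).continuousOn.integrableOn_compact hK
  have hInt₂ : IntegrableOn (fun x => |u x| ^ p * ‖gradient ρ x‖ ^ p / ρ x ^ p) (tsupport u) := by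
    refine ContinuousOn.integrableOn_compact hK fun x hx => ContinuousAt.continuousWithinAt ?_
    obtain ⟨H, hH, -⟩ := exists_hasFDerivAt_gradient_isSymmetric (hρd x (hΩu hx))
    have hpos := hρpos x (hΩu hx)
    refine ((hu.continuous.continuousAt.abs.rpow_const (Or.inr (by linarith))).mul
      (hH.continuousAt.norm.rpow_const (Or.inr (by linarith)))).div
      ((hρd x (hΩu hx)).continuousAt.rpow_const (Or.inl hpos.ne')) (by positivity)
  obtain ⟨hInt, hnonneg⟩ := integral_fderiv_pFlux_nonneg volume hp hΩ hK hΩu hρC2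
    (fun x hx => (hρpos x hx).le)
    (fun x hx => (divg9_eq_trace (pFlux p ρ) x).symm.trans_le (hsuper x hx))
    (contDiff_hardyTest hp hΩ (hρC2.of_le one_le_two) hρpos hu hΩu)
    (fun x => by
      by_cases hx : x ∈ tsupport u
      · have := hρpos x (hΩu hx)
        rw [hardyTest]
        positivity
      · rw [hardyTest, hzero x hx, abs_zero, Real.zero_rpow hp0, zero_mul])
    (tsupport_hardyTest_subset hp ρ u)
  have hmono := setIntegral_mono_on (hInt.const_mul (((p - 1) / p) ^ (p - 1)))
    (hInt₁.sub (hInt₂.const_mul (((p - 1) / p) ^ p))) hK.measurableSet fun x hx =>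
      fderiv_hardyTest_pFlux_le hp ((hρd x (hΩu hx)).differentiableAt two_ne_zero)
        (hρpos x (hΩu hx)) (hu.differentiable one_ne_zero x)
  rw [integral_const_mul, integral_sub' hInt₁ (hInt₂.const_mul _), integral_const_mul] at hmono
  have hc : 0 ≤ ((p - 1) / p) ^ (p - 1) :=
    Real.rpow_nonneg (div_nonneg (by linarith) (by linarith)) _
  linarith [mul_nonneg hc hnonneg]
end

section
/- Let 1 < p < ∞, Ω ⊆ ℝᴺ open, ρ : Ω → (0,∞) of class C², α, β ∈ ℝ with p-1+β > 0, satisfying the supersolution condition -(1/(p-1+β))Δ_p ρ ≥ ((α+β)/(p-1+β))‖∇ρ‖^p/ρ pointwise. Let p ≥ 2, let C(p) > 0 be a constant such that ‖X+Y‖^p - ‖X‖^p ≥ C(p)‖Y‖^p + p‖X‖^(p-2)⟨X,Y⟩ for all X,Y ∈ ℝᴺ. Suppose V : Ω → [0,∞) and a positive φ ∈ C²(Ω) satisfy pointwise Δ_p φ + (p-1+α+β)‖∇φ‖^(p-2)⟨∇φ, ∇ρ/ρ⟩ + (V/C(p))φ^(p-1) ≤ 0 on Ω. Then for every u ∈ C_c^1(Ω):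 ∫_Ω ‖∇u‖^p ρ^α dx ≥ ((p-1+β)/p)^p ∫_Ω |u|^p ‖∇ρ‖^p ρ^(α-p) dx + ∫_Ω V |u|^p ρ^α dx. -/
open MeasureTheory RealInnerProductSpace

noncomputable def divg14 {N : ℕ} (F : EuclideanSpace ℝ (Fin N) → EuclideanSpace ℝ (Fin N))
    (x : EuclideanSpace ℝ (Fin N)) : ℝ :=
  ∑ i, fderiv ℝ F x (EuclideanSpace.single i 1) i

noncomputable def pLap14 {N : ℕ} (p : ℝ) (f : EuclideanSpace ℝ (Fin N) → ℝ)
    (x : EuclideanSpace ℝ (Fin N)) : ℝ :=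
  divg14 (fun y => ‖gradient f y‖ ^ (p - 2) • gradient f y) x

theorem contDiff_norm_rpow_smul {E : Type*} [NormedAddCommGroup E] [InnerProductSpace ℝ E]
    {q : ℝ} (hq : 0 ≤ q) : ContDiff ℝ 1 (fun v : E => ‖v‖ ^ q • v) := by
  rcases hq.eq_or_lt with rfl | hq
  · simpa using contDiff_fun_id
  set D : E → E →L[ℝ] E := fun v => ‖v‖ ^ q • ContinuousLinearMap.id ℝ E +
    ((q * ‖v‖ ^ (q - 2)) • innerSL ℝ v).smulRight v with hD
  have hD0 : D 0 = 0 := by simp [hD, Real.zero_rpow hq.ne']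
  have hnorm : Filter.Tendsto (fun v : E => ‖v‖ ^ q) (nhds 0) (nhds 0) := by
    simpa [Real.zero_rpow hq.ne'] using
      (continuous_norm (E := E)).continuousAt.rpow_const (x := (0 : E)) (.inr hq.le) |>.tendsto
  have hbound : ∀ v, ‖D v‖ ≤ (1 + q) * ‖v‖ ^ q := by
    intro v
    rcases eq_or_ne v 0 with rfl | hv
    · simp [hD0, Real.zero_rpow hq.ne']
    have hv' : 0 < ‖v‖ := norm_pos_iff.mpr hv
    have hpow : ‖v‖ ^ (q - 2) * ‖v‖ * ‖v‖ = ‖v‖ ^ q := by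
      rw [mul_assoc, ← sq, ← Real.rpow_natCast, ← Real.rpow_add hv']
      norm_num
    calc ‖D v‖ ≤ ‖v‖ ^ q * 1 + q * (‖v‖ ^ (q - 2) * ‖v‖ * ‖v‖) := by
          refine (norm_add_le _ _).trans (add_le_add ?_ (le_of_eq ?_))
          · rw [norm_smul, Real.norm_of_nonneg (by positivity)]
            gcongr
            exact ContinuousLinearMap.norm_id_le
          · rw [ContinuousLinearMap.norm_smulRight_apply, norm_smul, innerSL_apply_norm,
              Real.norm_of_nonneg (by positivity)]
            ring
      _ = (1 + q) * ‖v‖ ^ q := by rw [hpow]; ring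
  have hderiv : ∀ v, HasFDerivAt (fun v : E => ‖v‖ ^ q • v) (D v) v := by
    intro v
    rcases eq_or_ne v 0 with rfl | hv
    · rw [hD0]
      refine .of_isLittleO ?_
      have := ((Asymptotics.isLittleO_one_iff ℝ).mpr hnorm).smul_isBigO
        (Asymptotics.isBigO_refl (fun v : E => v) (nhds 0))
      simpa using this
    · have hn : HasFDerivAt (fun v : E => ‖v‖ ^ q) ((q * ‖v‖ ^ (q - 2)) • innerSL ℝ v) v := by
        apply HasStrictFDerivAt.hasFDerivAt
        convert! (hasStrictFDerivAt_norm_sq v).rpow_const (p := q / 2) (by simp [hv]) using 0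
        simp_rw [← Real.rpow_natCast_mul (norm_nonneg _), ← Nat.cast_smul_eq_nsmul ℝ, smul_smul]
        ring_nf
      exact hn.smul (hasFDerivAt_id v)
  rw [contDiff_one_iff_hasFDerivAt]
  refine ⟨D, continuous_iff_continuousAt.mpr fun v => ?_, hderiv⟩
  rcases eq_or_ne v 0 with rfl | hv
  · rw [ContinuousAt, hD0]
    refine squeeze_zero_norm hbound ?_
    simpa using hnorm.const_mul (1 + q)
  · have h1 : ContinuousAt (fun v : E => ‖v‖ ^ q) v :=
      continuous_norm.continuousAt.rpow_const (.inr hq.le)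
    have h2 : ContinuousAt (fun v : E => ‖v‖ ^ (q - 2)) v :=
      continuous_norm.continuousAt.rpow_const (.inl (norm_ne_zero_iff.mpr hv))
    have h3 : ContinuousAt (fun v : E =>
        ContinuousLinearMap.smulRightL ℝ E E ((q * ‖v‖ ^ (q - 2)) • innerSL ℝ v) v) v := by
      fun_prop
    exact (h1.smul continuousAt_const).add h3

theorem mul_rpow_mul_inner_le {E : Type*} [NormedAddCommGroup E] [InnerProductSpace ℝ E]
    {p : ℝ} (hp : 1 < p) (Z Y : E) :
    p * ‖Z‖ ^ (p - 2) * ⟪Z, Y⟫ ≤ ‖Y‖ ^ p + (p - 1) * ‖Z‖ ^ p := by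
  rcases eq_or_ne Z 0 with rfl | hZ
  · simp only [inner_zero_left, mul_zero, norm_zero, Real.zero_rpow (by linarith : p ≠ 0)]
    positivity
  have hz : 0 < ‖Z‖ := norm_pos_iff.mpr hZ
  have hY := Real.young_inequality_of_nonneg (norm_nonneg Y)
    (Real.rpow_nonneg hz.le (p - 1)) (Real.HolderConjugate.conjExponent hp)
  have hp1 : p - 1 ≠ 0 := by linarith
  rw [← Real.rpow_mul hz.le, Real.conjExponent, mul_div_cancel₀ _ hp1] at hY
  have hpow : ‖Z‖ ^ (p - 1) = ‖Z‖ ^ (p - 2) * ‖Z‖ := by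
    rw [← Real.rpow_add_one hz.ne']; ring_nf
  calc p * ‖Z‖ ^ (p - 2) * ⟪Z, Y⟫ ≤ p * ‖Z‖ ^ (p - 2) * (‖Z‖ * ‖Y‖) := by
        gcongr
        exact real_inner_le_norm Z Y
    _ = p * (‖Y‖ * ‖Z‖ ^ (p - 1)) := by rw [hpow]; ring
    _ ≤ p * (‖Y‖ ^ p / p + ‖Z‖ ^ p / (p / (p - 1))) := by gcongr
    _ = ‖Y‖ ^ p + (p - 1) * ‖Z‖ ^ p := by field_simp

theorem divg14_smul {N : ℕ} {g : EuclideanSpace ℝ (Fin N) → ℝ}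
    {F : EuclideanSpace ℝ (Fin N) → EuclideanSpace ℝ (Fin N)} {x : EuclideanSpace ℝ (Fin N)}
    (hg : DifferentiableAt ℝ g x) (hF : DifferentiableAt ℝ F x) :
    divg14 (fun y => g y • F y) x = g x * divg14 F x + fderiv ℝ g x (F x) := by
  have hsum : fderiv ℝ g x (F x) =
      ∑ i, fderiv ℝ g x (EuclideanSpace.single i 1) * F x i := by
    conv_lhs => rw [← (EuclideanSpace.basisFun (Fin N) ℝ).sum_repr (F x)]
    simp [mul_comm]
  rw [hsum, divg14, divg14, Finset.mul_sum, ← Finset.sum_add_distrib]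
  refine Finset.sum_congr rfl fun i _ => ?_
  rw [fderiv_fun_smul hg hF]
  simp

theorem divg14_add {N : ℕ} {F G : EuclideanSpace ℝ (Fin N) → EuclideanSpace ℝ (Fin N)}
    {x : EuclideanSpace ℝ (Fin N)}
    (hF : DifferentiableAt ℝ F x) (hG : DifferentiableAt ℝ G x) :
    divg14 (fun y => F y + G y) x = divg14 F x + divg14 G x := by
  simp [divg14, fderiv_fun_add hF hG, Finset.sum_add_distrib]

theorem continuous_divg14 {N : ℕ} {G : EuclideanSpace ℝ (Fin N) → EuclideanSpace ℝ (Fin N)}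
    (hG : ContDiff ℝ 1 G) : Continuous (divg14 G) := by
  have := hG.continuous_fderiv one_ne_zero
  unfold divg14
  fun_prop

theorem divg14_of_notMem_tsupport {N : ℕ}
    {G : EuclideanSpace ℝ (Fin N) → EuclideanSpace ℝ (Fin N)}
    {x : EuclideanSpace ℝ (Fin N)} (hx : x ∉ tsupport G) : divg14 G x = 0 := by
  simp [divg14, fderiv_of_notMem_tsupport ℝ hx]

theorem integrable_divg14 {N : ℕ} {G : EuclideanSpace ℝ (Fin N) → EuclideanSpace ℝ (Fin N)}
    (hG : ContDiff ℝ 1 G) (hsupp : HasCompactSupport G) : Integrable (divg14 G) :=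
  (continuous_divg14 hG).integrable_of_hasCompactSupport
    (HasCompactSupport.intro hsupp fun _ => divg14_of_notMem_tsupport)

theorem integral_divg14_eq_zero {N : ℕ}
    {G : EuclideanSpace ℝ (Fin N) → EuclideanSpace ℝ (Fin N)}
    (hG : ContDiff ℝ 1 G) (hsupp : HasCompactSupport G) : ∫ x, divg14 G x = 0 := by
  have hc := hG.continuous_fderiv one_ne_zero
  have hInt : ∀ i : Fin N,
      Integrable (fun x => fderiv ℝ G x (EuclideanSpace.single i 1)) := fun i =>
    (hc.clm_apply continuous_const).integrable_of_hasCompactSupport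
      (hsupp.fderiv_apply ℝ _)
  have hzero : ∀ i : Fin N, ∫ x, fderiv ℝ G x (EuclideanSpace.single i 1) = 0 := by
    intro i
    have := integral_smul_fderiv_eq_neg_fderiv_smul_of_integrable (μ := volume)
      (f := fun _ : EuclideanSpace ℝ (Fin N) => (1 : ℝ)) (g := G)
      (v := EuclideanSpace.single i 1) (by simp) (by simpa using hInt i)
      (by simpa using hG.continuous.integrable_of_hasCompactSupport hsupp)
      (by simp) (fun x _ => hG.differentiable one_ne_zero x)
    simpa using this
  have hcoord : ∀ i : Fin N,
      ∫ x, fderiv ℝ G x (EuclideanSpace.single i 1) i = 0 := by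
    intro i
    have := (EuclideanSpace.proj (𝕜 := ℝ) i).integral_comp_comm (hInt i)
    simpa [hzero i] using this
  exact (integral_finsetSum _ fun i _ =>
    (EuclideanSpace.proj (𝕜 := ℝ) i).integrable_comp (hInt i)).trans
      (Finset.sum_eq_zero fun i _ => hcoord i)

theorem ContDiffOn.gradient_of_isOpen {N : ℕ} {f : EuclideanSpace ℝ (Fin N) → ℝ}
    {Ω : Set (EuclideanSpace ℝ (Fin N))} (hf : ContDiffOn ℝ 2 f Ω) (hΩ : IsOpen Ω) :
    ContDiffOn ℝ 1 (gradient f) Ω :=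
  (InnerProductSpace.toDual ℝ (EuclideanSpace ℝ (Fin N))).symm.contDiff.comp_contDiffOn
    (hf.fderiv_of_isOpen hΩ (by norm_num))

theorem integrable_of_continuousOn_isCompact {E : Type*} [NormedAddCommGroup E]
    [MeasurableSpace E] [BorelSpace E] {μ : Measure E} [IsFiniteMeasureOnCompacts μ]
    {f : E → ℝ} {K : Set E} (hK : IsCompact K)
    (hf : ContinuousOn f K) (hzero : ∀ x, x ∉ K → f x = 0) : Integrable f μ :=
  (integrableOn_iff_integrable_of_support_subset fun _ hx => by_contra fun h => hx (hzero _ h)).mp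
    (hf.integrableOn_compact hK)

theorem Real.rpow_eq_rpow_sub_two_mul_sq {x p : ℝ} (hx : 0 ≤ x) (hp : 2 ≤ p) :
    x ^ p = x ^ (p - 2) * x ^ 2 := by
  rw [← Real.rpow_natCast, ← Real.rpow_add' hx (by norm_num; linarith)]
  norm_num

/-- The pointwise inequality behind the improved Hardy inequality: `a`, `r`, `f` stand for the
gradients of `u`, `ρ`, `φ`, and `L`, `M` for the `p`-Laplacians of `ρ`, `φ`. -/
theorem improved_hardy_pointwise {E : Type*} [NormedAddCommGroup E] [InnerProductSpace ℝ E]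
    {p α β C : ℝ} (hp : 2 ≤ p) (hβ : 0 < p - 1 + β) (hC : 0 < C)
    (hCineq : ∀ X Y : E, ‖X + Y‖ ^ p - ‖X‖ ^ p ≥ C * ‖Y‖ ^ p + p * ‖X‖ ^ (p - 2) * ⟪X, Y⟫)
    (a r f : E) {t ρ φ L M V : ℝ} (hρ : 0 < ρ) (hφ : 0 < φ)
    (hsuper : -(1 / (p - 1 + β)) * L ≥ ((α + β) / (p - 1 + β)) * ‖r‖ ^ p / ρ)
    (hode : M + (p - 1 + α + β) * ‖f‖ ^ (p - 2) * ⟪f, ρ⁻¹ • r⟫ + (V / C) * φ ^ (p - 1) ≤ 0) :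
    ((p - 1 + β) / p) ^ p * (|t| ^ p * ‖r‖ ^ p * ρ ^ (α - p)) + V * |t| ^ p * ρ ^ α
      + (((p - 1 + β) / p) ^ (p - 1) * (|t| ^ p * ρ ^ (α - p + 1) * L + ‖r‖ ^ (p - 2) *
          (p * |t| ^ (p - 2) * t * ρ ^ (α - p + 1) * ⟪a, r⟫
            + |t| ^ p * ((α - p + 1) * ρ ^ (α - p)) * ⟪r, r⟫))
        + C * (|t| ^ p * (ρ ^ α * φ ^ (1 - p)) * M + ‖f‖ ^ (p - 2) *
          (p * |t| ^ (p - 2) * t * (ρ ^ α * φ ^ (1 - p)) * ⟪a, f⟫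
            + |t| ^ p * (α * ρ ^ (α - 1) * φ ^ (1 - p) * ⟪r, f⟫
              + ρ ^ α * ((1 - p) * φ ^ (-p)) * ⟪f, f⟫))))
      ≤ ‖a‖ ^ p * ρ ^ α := by
  have hp0 : 0 < p := by linarith
  obtain ⟨θ, hθ⟩ : ∃ θ, θ = (p - 1 + β) / p := ⟨_, rfl⟩
  have hθpos : 0 < θ := by rw [hθ]; positivity
  rw [← hθ]
  obtain rfl : β = p * θ - p + 1 := by rw [hθ]; field_simp; ring
  set X : E := (θ * t / ρ) • r with hX
  set Z : E := (t / φ) • f with hZ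
  set Y : E := a - X with hY
  have hineq := hCineq X Y
  have hyoung := mul_rpow_mul_inner_le (by linarith : 1 < p) Z Y
  rw [show X + Y = a by simp [hY]] at hineq
  have hρp : ρ ^ (2 - p) = ρ ^ (-p) * ρ ^ 2 := by
    rw [← Real.rpow_natCast, ← Real.rpow_add hρ]; congr 1; push_cast; ring
  have hφp : φ ^ (2 - p) = φ ^ (-p) * φ ^ 2 := by
    rw [← Real.rpow_natCast, ← Real.rpow_add hφ]; congr 1; push_cast; ring
  have hρ1 : ρ ^ (α - p) = ρ ^ α * ρ ^ (-p) := by rw [← Real.rpow_add hρ]; rfl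
  have hρ2 : ρ ^ (α - p + 1) = ρ ^ α * ρ ^ (-p) * ρ := by
    rw [Real.rpow_add_one hρ.ne', hρ1]
  have hρ3 : ρ ^ (α - 1) = ρ ^ α * ρ⁻¹ := by rw [Real.rpow_sub_one hρ.ne', div_eq_mul_inv]
  have hφ1 : φ ^ (1 - p) = φ ^ (-p) * φ := by
    rw [← Real.rpow_add_one hφ.ne']; congr 1; ring
  have hφ2 : φ ^ (-p) * φ * φ ^ (p - 1) = 1 := by
    rw [← hφ1, ← Real.rpow_add hφ]; simp
  have hθ1 : θ ^ (p - 1) = θ ^ (p - 2) * θ := by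
    rw [← Real.rpow_add_one hθpos.ne']; congr 1; ring
  have hθ2 : θ ^ p = θ ^ (p - 2) * θ ^ 2 := Real.rpow_eq_rpow_sub_two_mul_sq hθpos.le hp
  have ht : |t| ^ p = |t| ^ (p - 2) * t ^ 2 := by
    rw [Real.rpow_eq_rpow_sub_two_mul_sq (abs_nonneg t) hp, sq_abs]
  have hr : ‖r‖ ^ p = ‖r‖ ^ (p - 2) * ⟪r, r⟫ := by
    rw [Real.rpow_eq_rpow_sub_two_mul_sq (norm_nonneg r) hp, real_inner_self_eq_norm_sq]
  have hXn : ‖X‖ ^ (p - 2) =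
      θ ^ (p - 2) * |t| ^ (p - 2) * (ρ ^ (-p) * ρ ^ 2) * ‖r‖ ^ (p - 2) := by
    rw [hX, norm_smul, Real.norm_eq_abs, abs_div, abs_mul, abs_of_pos hθpos, abs_of_pos hρ,
      Real.mul_rpow (by positivity) (by positivity), Real.div_rpow (by positivity) hρ.le,
      Real.mul_rpow hθpos.le (abs_nonneg t), ← hρp, div_eq_mul_inv, ← Real.rpow_neg hρ.le, neg_sub]
  have hZn : ‖Z‖ ^ (p - 2) = |t| ^ (p - 2) * (φ ^ (-p) * φ ^ 2) * ‖f‖ ^ (p - 2) := by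
    rw [hZ, norm_smul, Real.norm_eq_abs, abs_div, abs_of_pos hφ,
      Real.mul_rpow (by positivity) (by positivity), Real.div_rpow (by positivity) hφ.le,
      ← hφp, div_eq_mul_inv, ← Real.rpow_neg hφ.le, neg_sub]
  have hXp : ‖X‖ ^ p = ‖X‖ ^ (p - 2) * ((θ * t / ρ) ^ 2 * ⟪r, r⟫) := by
    rw [Real.rpow_eq_rpow_sub_two_mul_sq (norm_nonneg X) hp, ← real_inner_self_eq_norm_sq, hX,
      real_inner_smul_left, real_inner_smul_right]
    ring
  have hZp : ‖Z‖ ^ p = ‖Z‖ ^ (p - 2) * ((t / φ) ^ 2 * ⟪f, f⟫) := by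
    rw [Real.rpow_eq_rpow_sub_two_mul_sq (norm_nonneg Z) hp, ← real_inner_self_eq_norm_sq, hZ,
      real_inner_smul_left, real_inner_smul_right]
    ring
  have hXY : ⟪X, Y⟫ = θ * t / ρ * (⟪a, r⟫ - θ * t / ρ * ⟪r, r⟫) := by
    rw [hY, hX, inner_sub_right, real_inner_smul_left, real_inner_smul_left,
      real_inner_smul_right, real_inner_comm]
    ring
  have hZY : ⟪Z, Y⟫ = t / φ * (⟪a, f⟫ - θ * t / ρ * ⟪r, f⟫) := by
    rw [hY, hX, hZ, inner_sub_right, real_inner_smul_left, real_inner_smul_left,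
      real_inner_smul_right, real_inner_comm, real_inner_comm r f]
    ring
  rw [real_inner_smul_right, real_inner_comm] at hode
  rw [hr] at hsuper
  have hsuper' : L * ρ + (α + (p * θ - p + 1)) * (‖r‖ ^ (p - 2) * ⟪r, r⟫) ≤ 0 := by
    rw [show p - 1 + (p * θ - p + 1) = p * θ by ring] at hsuper
    have h := mul_le_mul_of_nonneg_left hsuper.le (by positivity : 0 ≤ p * θ * ρ)
    have e1 : p * θ * ρ * (-(1 / (p * θ)) * L) = -(L * ρ) := by field_simp
    have e2 : p * θ * ρ * ((α + (p * θ - p + 1)) / (p * θ) * (‖r‖ ^ (p - 2) * ⟪r, r⟫) / ρ)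
        = (α + (p * θ - p + 1)) * (‖r‖ ^ (p - 2) * ⟪r, r⟫) := by field_simp
    rw [e1, e2] at h
    linarith
  rw [hXp, hXY, hXn] at hineq
  rw [hZp, hZY, hZn] at hyoung
  rw [hr, ht, hρ1, hρ2, hρ3, hφ1, hθ1, hθ2]
  clear_value X Y Z
  clear hXp hXY hXn hZp hZY hZn hCineq hX hY hZ hsuper ht hr hθ1 hθ2 hρ1 hρ2 hρ3 hφ1 hρp hφp
  have hR : 0 < ρ ^ α := by positivity
  have hq : 0 < ρ ^ (-p) := by positivity
  have hs : 0 < φ ^ (-p) := by positivity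
  have hT : 0 < θ ^ (p - 2) := by positivity
  have hP : 0 ≤ |t| ^ (p - 2) := by positivity
  generalize ρ ^ α = R at *
  generalize ρ ^ (-p) = q at *
  generalize φ ^ (-p) = s at *
  generalize θ ^ (p - 2) = T at *
  generalize |t| ^ (p - 2) = P at *
  generalize ‖r‖ ^ (p - 2) = A at *
  generalize ‖f‖ ^ (p - 2) = B at *
  generalize φ ^ (p - 1) = w at *
  have H1 := mul_le_mul_of_nonneg_left hineq.le hR.le
  have H2 := mul_le_mul_of_nonneg_left hyoung (by positivity : 0 ≤ R * C)
  have H3 := mul_le_mul_of_nonneg_left hsuper' (by positivity : 0 ≤ T * θ * P * t ^ 2 * R * q)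
  have H4 := mul_le_mul_of_nonneg_left hode (by positivity : 0 ≤ C * P * t ^ 2 * R * (s * φ))
  have e1 : T * P * (q * ρ ^ 2) * A * ((θ * t / ρ) ^ 2 * ⟪r, r⟫) =
      T * P * q * A * θ ^ 2 * t ^ 2 * ⟪r, r⟫ := by field_simp
  have e2 : p * (T * P * (q * ρ ^ 2) * A) * (θ * t / ρ * (⟪a, r⟫ - θ * t / ρ * ⟪r, r⟫)) =
      p * T * P * q * A * θ * t * (ρ * ⟪a, r⟫ - θ * t * ⟪r, r⟫) := by field_simp
  have e3 : p * (P * (s * φ ^ 2) * B) * (t / φ * (⟪a, f⟫ - θ * t / ρ * ⟪r, f⟫)) =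
      p * P * s * φ * B * t * (⟪a, f⟫ - θ * t * ρ⁻¹ * ⟪r, f⟫) := by field_simp
  have e4 : P * (s * φ ^ 2) * B * ((t / φ) ^ 2 * ⟪f, f⟫) = P * s * B * t ^ 2 * ⟪f, f⟫ := by
    field_simp
  have e5 : C * P * t ^ 2 * R * (s * φ) * (V / C * w) = V * (P * t ^ 2) * R := by
    calc _ = V * (P * t ^ 2) * R * (s * φ * w) := by field_simp
      _ = _ := by rw [hφ2, mul_one]
  rw [e1, e2] at H1
  rw [e3, e4] at H2
  rw [mul_add _ _ (V / C * w), e5] at H4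
  linarith

theorem hasFDerivAt_abs_rpow_comp {N : ℕ} {u : EuclideanSpace ℝ (Fin N) → ℝ}
    {x : EuclideanSpace ℝ (Fin N)} {p : ℝ} (hp : 1 < p) (hu : DifferentiableAt ℝ u x) :
    HasFDerivAt (fun y => |u y| ^ p) ((p * |u x| ^ (p - 2) * u x) • fderiv ℝ u x) x :=
  (hasDerivAt_abs_rpow (u x) hp).comp_hasFDerivAt x hu.hasFDerivAt

theorem stmt_14 (N : ℕ) (p α β C : ℝ) (hp : 2 ≤ p) (hβ : 0 < p - 1 + β) (hC : 0 < C)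
    (hCineq : ∀ X Y : EuclideanSpace ℝ (Fin N),
      ‖X + Y‖ ^ p - ‖X‖ ^ p ≥ C * ‖Y‖ ^ p + p * ‖X‖ ^ (p - 2) * ⟪X, Y⟫)
    (Ω : Set (EuclideanSpace ℝ (Fin N))) (hΩ : IsOpen Ω)
    (ρ : EuclideanSpace ℝ (Fin N) → ℝ)
    (hρC2 : ContDiffOn ℝ 2 ρ Ω) (hρpos : ∀ x ∈ Ω, 0 < ρ x)
    (hsuper : ∀ x ∈ Ω,
      -(1 / (p - 1 + β)) * pLap14 p ρ x ≥
        ((α + β) / (p - 1 + β)) * ‖gradient ρ x‖ ^ p / ρ x)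
    (V φ : EuclideanSpace ℝ (Fin N) → ℝ)
    (hV : ∀ x ∈ Ω, 0 ≤ V x)
    (hφC2 : ContDiffOn ℝ 2 φ Ω) (hφpos : ∀ x ∈ Ω, 0 < φ x)
    (hode : ∀ x ∈ Ω,
      pLap14 p φ x
        + (p - 1 + α + β) * ‖gradient φ x‖ ^ (p - 2) * ⟪gradient φ x, (ρ x)⁻¹ • gradient ρ x⟫
        + (V x / C) * φ x ^ (p - 1) ≤ 0)
    (u : EuclideanSpace ℝ (Fin N) → ℝ)
    (hu : ContDiff ℝ 1 u) (hsupp : HasCompactSupport u) (hΩu : tsupport u ⊆ Ω) :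
    ∫ x in Ω, ‖gradient u x‖ ^ p * ρ x ^ α ∂volume ≥
      ((p - 1 + β) / p) ^ p *
        ∫ x in Ω, |u x| ^ p * ‖gradient ρ x‖ ^ p * ρ x ^ (α - p) ∂volume
      + ∫ x in Ω, V x * |u x| ^ p * ρ x ^ α ∂volume := by
  have hp1 : 1 < p := by linarith
  have hp0 : 0 < p := by linarith
  set θ : ℝ := (p - 1 + β) / p with hθ
  set A := fun y => ‖gradient ρ y‖ ^ (p - 2) • gradient ρ y with hA
  set B := fun y => ‖gradient φ y‖ ^ (p - 2) • gradient φ y with hB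
  set g := fun y => θ ^ (p - 1) * (|u y| ^ p * ρ y ^ (α - p + 1)) with hg
  set k := fun y => C * (|u y| ^ p * (ρ y ^ α * φ y ^ (1 - p))) with hk
  set G := fun y => g y • A y + k y • B y with hG
  have hAC : ContDiffOn ℝ 1 A Ω :=
    (contDiff_norm_rpow_smul (by linarith)).comp_contDiffOn (hρC2.gradient_of_isOpen hΩ)
  have hBC : ContDiffOn ℝ 1 B Ω :=
    (contDiff_norm_rpow_smul (by linarith)).comp_contDiffOn (hφC2.gradient_of_isOpen hΩ)
  have hρC1 : ContDiffOn ℝ 1 ρ Ω := hρC2.of_le (by norm_num)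
  have hφC1 : ContDiffOn ℝ 1 φ Ω := hφC2.of_le (by norm_num)
  have huC : ContDiff ℝ 1 fun y => |u y| ^ p := hu.norm_rpow hp1
  have hρpow : ∀ s : ℝ, ContDiffOn ℝ 1 (fun y => ρ y ^ s) Ω := fun s =>
    hρC1.rpow_const_of_ne fun x hx => (hρpos x hx).ne'
  have hφpow : ∀ s : ℝ, ContDiffOn ℝ 1 (fun y => φ y ^ s) Ω := fun s =>
    hφC1.rpow_const_of_ne fun x hx => (hφpos x hx).ne'
  have hgC : ContDiffOn ℝ 1 g Ω := contDiffOn_const.mul (huC.contDiffOn.mul (hρpow _))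
  have hkC : ContDiffOn ℝ 1 k Ω :=
    contDiffOn_const.mul (huC.contDiffOn.mul ((hρpow _).mul (hφpow _)))
  have hGC : ContDiffOn ℝ 1 G Ω := (hgC.smul hAC).add (hkC.smul hBC)
  have hu0 : ∀ x, x ∉ tsupport u → |u x| ^ p = 0 := fun x hx => by
    simp [image_eq_zero_of_notMem_tsupport hx, Real.zero_rpow hp0.ne']
  have hGu : tsupport G ⊆ tsupport u :=
    closure_minimal (fun x hx => by_contra fun h => hx (by simp [hG, hg, hk, hu0 x h]))
      (isClosed_tsupport u)
  have hG1 : ContDiff ℝ 1 G := by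
    refine contDiff_iff_contDiffAt.mpr fun x => ?_
    by_cases hx : x ∈ tsupport G
    · exact hGC.contDiffAt (hΩ.mem_nhds (hΩu (hGu hx)))
    · exact contDiffAt_const.congr_of_eventuallyEq (notMem_tsupport_iff_eventuallyEq.mp hx)
  have hGsupp : HasCompactSupport G := hsupp.of_isClosed_subset (isClosed_tsupport G) hGu
  have hgrad0 : ∀ x, x ∉ tsupport u → ‖gradient u x‖ ^ p = 0 := fun x hx => by
    simp [gradient, fderiv_of_notMem_tsupport ℝ hx, Real.zero_rpow hp0.ne']
  have hpoint : ∀ x, θ ^ p * (|u x| ^ p * ‖gradient ρ x‖ ^ p * ρ x ^ (α - p))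
      + V x * |u x| ^ p * ρ x ^ α + divg14 G x ≤ ‖gradient u x‖ ^ p * ρ x ^ α := by
    intro x
    by_cases hx : x ∈ tsupport u
    swap
    · simp [hu0 x hx, hgrad0 x hx, divg14_of_notMem_tsupport fun h => hx (hGu h)]
    have hxΩ := hΩu hx
    have hnhds := hΩ.mem_nhds hxΩ
    have hdA := (hAC.contDiffAt hnhds).differentiableAt one_ne_zero
    have hdB := (hBC.contDiffAt hnhds).differentiableAt one_ne_zero
    have hdg := (hgC.contDiffAt hnhds).differentiableAt one_ne_zero
    have hdk := (hkC.contDiffAt hnhds).differentiableAt one_ne_zero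
    have hdu := hasFDerivAt_abs_rpow_comp hp1 (hu.differentiable one_ne_zero x)
    have hdρ := ((hρC1.contDiffAt hnhds).differentiableAt one_ne_zero).hasFDerivAt
    have hdφ := ((hφC1.contDiffAt hnhds).differentiableAt one_ne_zero).hasFDerivAt
    have hρx := hρpos x hxΩ
    have hφx := hφpos x hxΩ
    have hg' := (hdu.mul (hdρ.rpow_const (p := α - p + 1) (.inl hρx.ne'))).const_mul
      (θ ^ (p - 1))
    have hk' := (hdu.mul ((hdρ.rpow_const (p := α) (.inl hρx.ne')).mul
      (hdφ.rpow_const (p := 1 - p) (.inl hφx.ne')))).const_mul C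
    have hgx : fderiv ℝ g x (A x) = _ := congrArg (fun T => T (A x)) hg'.fderiv
    have hkx : fderiv ℝ k x (B x) = _ := congrArg (fun T => T (B x)) hk'.fderiv
    have key := improved_hardy_pointwise hp hβ hC hCineq (gradient u x) (gradient ρ x)
      (gradient φ x) (t := u x) hρx hφx (hsuper x hxΩ) (hode x hxΩ)
    rw [← hθ] at key
    refine le_trans (le_of_eq ?_) key
    rw [hG, divg14_add (hdg.fun_smul hdA) (hdk.fun_smul hdB), divg14_smul hdg hdA, divg14_smul hdk hdB,
      hgx, hkx, show divg14 A x = pLap14 p ρ x from rfl, show divg14 B x = pLap14 p φ x from rfl]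
    simp only [inner_gradient_left, hg, hk, hA, hB, map_smul, smul_eq_mul, add_apply, smul_apply,
      Pi.mul_apply]
    rw [show α - p + 1 - 1 = α - p by ring, show 1 - p - 1 = -p by ring]
    ring
  have hInt1 : Integrable fun x => ‖gradient u x‖ ^ p * ρ x ^ α := by
    refine integrable_of_continuousOn_isCompact hsupp ?_ fun x hx => by simp [hgrad0 x hx]
    have hcu : Continuous (gradient u) :=
      (InnerProductSpace.toDual ℝ (EuclideanSpace ℝ (Fin N))).symm.continuous.comp
        (hu.continuous_fderiv one_ne_zero)
    exact (hcu.norm.rpow_const fun _ => .inr hp0.le).continuousOn.mul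
      ((hρpow α).continuousOn.mono hΩu)
  have hInt2 : Integrable fun x => |u x| ^ p * ‖gradient ρ x‖ ^ p * ρ x ^ (α - p) := by
    refine integrable_of_continuousOn_isCompact hsupp ?_ fun x hx => by simp [hu0 x hx]
    exact (huC.continuous.continuousOn.mul
      (((hρC2.gradient_of_isOpen hΩ).continuousOn.mono hΩu).norm.rpow_const
        fun _ _ => .inr hp0.le)).mul ((hρpow _).continuousOn.mono hΩu)
  have hIntG := integrable_divg14 hG1 hGsupp
  have hzeroG := integral_divg14_eq_zero hG1 hGsupp
  have hnot : ∀ x, x ∉ Ω → x ∉ tsupport u := fun x hx h => hx (hΩu h)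
  rw [setIntegral_eq_integral_of_forall_compl_eq_zero fun x hx => by simp [hgrad0 x (hnot x hx)],
    setIntegral_eq_integral_of_forall_compl_eq_zero fun x hx => by simp [hu0 x (hnot x hx)],
    setIntegral_eq_integral_of_forall_compl_eq_zero fun x hx => by simp [hu0 x (hnot x hx)]]
  have hInt2' := hInt2.const_mul (θ ^ p)
  rw [ge_iff_le, ← integral_const_mul]
  by_cases hInt3 : Integrable fun x => V x * |u x| ^ p * ρ x ^ α
  · have := integral_mono ((hInt2'.add hInt3).add hIntG) hInt1 hpoint
    rwa [integral_add' (hInt2'.add hInt3) hIntG, hzeroG, add_zero,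
      integral_add' hInt2' hInt3] at this
  · rw [integral_undef hInt3, add_zero]
    have := integral_mono (hInt2'.add hIntG) hInt1 fun x => by
      refine le_trans ?_ (hpoint x)
      have hV0 : 0 ≤ V x * |u x| ^ p * ρ x ^ α := by
        by_cases hx : x ∈ Ω
        · have := hV x hx
          have := hρpos x hx
          positivity
        · simp [hu0 x (hnot x hx)]
      simp only [Pi.add_apply]
      linarith
    rwa [integral_add' hInt2' hIntG, hzeroG, add_zero] at this
end
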